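/- Let N ≥ 2 be an integer and η > 0 a real number satisfying η log N > 2 and (1+η) log N ≥ 8π. Then the spherical ensemble with N particles satisfies 𝐏_N( wce(x_N; 2) ≤ e·√((1+η)/(8π)) · (log N)^{1/2}/N ) ≥ 1 − (log N)^{1/2} · N^{−η/2} · ( η · e^{ (1+η)/(η − 2/log N) + 1 } )^{1/2}. -/

import Mathlib

open MeasureTheory Real Metric
open scoped ENNReal RealInnerProductSpace Manifold

noncomputable section

/-- Euclidean 3-space. -/
abbrev E3 : Type := EuclideanSpace ℝ (Fin 3)

/-- The unit two-sphere in `ℝ³`. -/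
abbrev S2 : Type := Metric.sphere (0 : E3) 1

instance : Fact (Module.finrank ℝ E3 = 2 + 1) := ⟨finrank_euclideanSpace_fin⟩

/-- The Riemannian area measure `dV_g` on the unit two-sphere (total mass `4π`). -/
abbrev sphereArea : Measure S2 := (volume : Measure E3).toSphere

/-- The uniform probability measure `σ = dV_g / (4π)` on the unit two-sphere. -/
def sphereUniform : Measure S2 := (ENNReal.ofReal (4 * π))⁻¹ • sphereArea

instance : IsFiniteMeasure sphereUniform := by
  constructor
  rw [sphereUniform, Measure.smul_apply, smul_eq_mul]
  exact ENNReal.mul_lt_top (by simp [Real.pi_pos]) (measure_lt_top _ _)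

/-- The density (up to normalization) of the spherical ensemble:
`∏_{i ≠ j} |x_i − x_j| = ∏_{i < j} |x_i − x_j|²`. -/
def ensembleDensity (N : ℕ) (x : Fin N → S2) : ℝ≥0∞ :=
  ENNReal.ofReal (∏ p ∈ Finset.univ.offDiag, dist (x p.1) (x p.2))

/-- The spherical ensemble with `N` particles: the probability measure on `(S²)^N`
with density proportional to `∏_{i<j} |x_i − x_j|²` with respect to `σ^{⊗N}`. -/
def sphericalEnsemble (N : ℕ) : Measure (Fin N → S2) :=
  (∫⁻ x, ensembleDensity N x ∂(Measure.pi fun _ : Fin N => sphereUniform))⁻¹ •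
    (Measure.pi fun _ : Fin N => sphereUniform).withDensity (ensembleDensity N)

/-- The Legendre polynomial of degree `l` (Rodrigues' formula). -/
def legendreP (l : ℕ) : Polynomial ℝ :=
  Polynomial.C ((2 ^ l * l.factorial : ℝ)⁻¹) *
    (Polynomial.derivative^[l] ((Polynomial.X ^ 2 - 1) ^ l))

/-- The degree-`l` zonal harmonic kernel `Z_l(x,y) = ((2l+1)/(4π)) P_l(⟨x,y⟩)`, which is the
reproducing kernel of the eigenspace of the Laplace–Beltrami operator with eigenvalue `l(l+1)`,
inside `L²(X, dV_g)`. -/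
def zonal (l : ℕ) (x y : S2) : ℝ :=
  ((2 * l + 1 : ℝ) / (4 * π)) * (legendreP l).eval ⟪(x : E3), (y : E3)⟫

/-- `∫∫ f(x) Z_l(x,y) f(y) dV_g(x) dV_g(y)`, the squared `L²(dV_g)`-norm of the projection
of `f` onto the degree-`l` eigenspace of the Laplace–Beltrami operator. -/
def levelSq (l : ℕ) (f : S2 → ℝ) : ℝ :=
  ∫ x, ∫ y, f x * zonal l x y * f y ∂sphereArea ∂sphereArea

/-- The squared Sobolev norm `‖f‖²_{H^s(X)} = ∫_X f (Δ_g)^s f dV_g`, expressed spectrally: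
`Σ_{l≥1} (l(l+1))^s ‖proj_l f‖²_{L²(dV_g)}`, where `l(l+1)` are the positive eigenvalues of the
(positive) Laplace–Beltrami operator `Δ_g` on the unit two-sphere. -/
def sobNormSq (s : ℝ) (f : S2 → ℝ) : ℝ :=
  ∑' l : ℕ, (((l + 1) * (l + 2) : ℕ) : ℝ) ^ s * levelSq (l + 1) f

/-- Smooth real-valued functions on the two-sphere. -/
def SmoothOnSphere (f : S2 → ℝ) : Prop :=
  ContMDiff (𝓡 2) 𝓘(ℝ, ℝ) (⊤ : ℕ∞) f

/-- The worst-case error `wce(x_N; s)` of the numerical integration rule with node set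
`x_N = (x_1, …, x_N)` and smoothness parameter `s`. -/
def wce (N : ℕ) (s : ℝ) (x : Fin N → S2) : ℝ :=
  sSup { r | ∃ f : S2 → ℝ, SmoothOnSphere f ∧ sobNormSq s f ≤ 1 ∧
    r = |(∫ y, f y ∂sphereUniform) - (1 / N : ℝ) * ∑ i, f (x i)| }

end

open MeasureTheory Real Metric
open scoped ENNReal RealInnerProductSpace Manifold

noncomputable section
namespace SE

instance : IsProbabilityMeasure sphereUniform := by
  constructor
  rw [sphereUniform, Measure.smul_apply, Measure.toSphere_apply_univ, smul_eq_mul,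
    EuclideanSpace.volume_ball_fin_three, finrank_euclideanSpace_fin]
  simp only [one_pow, ENNReal.ofReal_one, one_mul]
  rw [show ((3 : ℕ) : ℝ≥0∞) = ENNReal.ofReal 3 by simp, ← ENNReal.ofReal_mul (by norm_num)]
  rw [show (3 : ℝ) * (π * 4 / 3) = 4 * π by ring]
  exact ENNReal.inv_mul_cancel (by simp [Real.pi_pos]) ENNReal.ofReal_ne_top

/-- inner product on the sphere -/
def ip (x y : S2) : ℝ := inner ℝ (x : E3) (y : E3)

def vv (x y : S2) : ℝ := (1 + ip x y) / 2

lemma ip_comm (x y : S2) : ip x y = ip y x := real_inner_comm _ _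
lemma vv_comm (x y : S2) : vv x y = vv y x := by simp [vv, ip_comm]
lemma norm_S2 (x : S2) : ‖(x : E3)‖ = 1 := by simpa using x.2
lemma ip_self (x : S2) : ip x x = 1 := by simp [ip, norm_S2]
lemma vv_self (x : S2) : vv x x = 1 := by simp [vv, ip_self]
lemma abs_ip_le (x y : S2) : |ip x y| ≤ 1 := by
  have := abs_real_inner_le_norm (x : E3) (y : E3)
  simpa [ip, norm_S2] using this
lemma vv_nonneg (x y : S2) : 0 ≤ vv x y := by
  have := (abs_le.1 (abs_ip_le x y)).1
  unfold vv; linarith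
lemma vv_le_one (x y : S2) : vv x y ≤ 1 := by
  have := (abs_le.1 (abs_ip_le x y)).2
  unfold vv; linarith

lemma continuous_ip : Continuous (fun p : S2 × S2 => ip p.1 p.2) := by
  unfold ip; fun_prop
lemma continuous_vv : Continuous (fun p : S2 × S2 => vv p.1 p.2) := by
  unfold vv ip; fun_prop

@[fun_prop]
lemma Continuous.ip' {X : Type*} [TopologicalSpace X] {f g : X → S2} (hf : Continuous f)
    (hg : Continuous g) : Continuous (fun t => ip (f t) (g t)) :=
  continuous_ip.comp (hf.prodMk hg)
@[fun_prop]
lemma Continuous.vv' {X : Type*} [TopologicalSpace X] {f g : X → S2} (hf : Continuous f)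
    (hg : Continuous g) : Continuous (fun t => vv (f t) (g t)) :=
  continuous_vv.comp (hf.prodMk hg)

lemma integrable_cont {X : Type*} [TopologicalSpace X] [CompactSpace X] [MeasurableSpace X]
    [BorelSpace X] {μ : Measure X} [IsFiniteMeasure μ] {F : Type*} [NormedAddCommGroup F]
    [SecondCountableTopology F]
    {f : X → F} (hf : Continuous f) :
    Integrable f μ := by
  have h : BddAbove (Set.range fun x => ‖f x‖) := (isCompact_range hf.norm).bddAbove
  obtain ⟨C, hC⟩ := h
  exact Integrable.of_bound hf.aestronglyMeasurable C
    (Filter.Eventually.of_forall fun x => hC ⟨x, rfl⟩)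

/-- action of isometries on the sphere -/
def act (A : E3 ≃ₗᵢ[ℝ] E3) (x : S2) : S2 := ⟨A x, by simp [norm_S2]⟩

lemma continuous_act (A : E3 ≃ₗᵢ[ℝ] E3) : Continuous (act A) := by
  unfold act; fun_prop

lemma act_symm_act (A : E3 ≃ₗᵢ[ℝ] E3) (x : S2) : act A.symm (act A x) = x := by
  ext1; simp [act]
lemma act_act_symm (A : E3 ≃ₗᵢ[ℝ] E3) (x : S2) : act A (act A.symm x) = x := by
  ext1; simp [act]

lemma ip_act (A : E3 ≃ₗᵢ[ℝ] E3) (x y : S2) : ip (act A x) (act A y) = ip x y := by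
  simp [ip, act]

open Pointwise in
lemma mp_act (A : E3 ≃ₗᵢ[ℝ] E3) : MeasurePreserving (act A) sphereUniform sphereUniform := by
  refine ⟨(continuous_act A).measurable, ?_⟩
  ext s hs
  rw [Measure.map_apply (continuous_act A).measurable hs]
  unfold sphereUniform
  rw [Measure.smul_apply, Measure.smul_apply, Measure.toSphere_apply' _ hs,
    Measure.toSphere_apply' _ ((continuous_act A).measurable hs)]
  congr 2
  have h : (Set.Ioo (0 : ℝ) 1 • ((↑) '' (act A ⁻¹' s)) : Set E3) =
      A ⁻¹' (Set.Ioo (0 : ℝ) 1 • ((↑) '' s)) := by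
    ext z
    simp only [Set.mem_smul, Set.mem_image, Set.mem_preimage]
    constructor
    · rintro ⟨r, hr, y, ⟨w, hw, rfl⟩, rfl⟩
      exact ⟨r, hr, _, ⟨act A w, hw, rfl⟩, by simp [act]⟩
    · rintro ⟨r, hr, y, ⟨w, hw, rfl⟩, h⟩
      refine ⟨r, hr, _, ⟨act A.symm w, by rwa [act_act_symm], rfl⟩, ?_⟩
      apply A.injective
      rw [← h]; simp [act]
  rw [h]
  exact A.measurePreserving.measure_preimage_equiv (f := A.toMeasurableEquiv) _

lemma integral_act (A : E3 ≃ₗᵢ[ℝ] E3) {F : Type*} [NormedAddCommGroup F] [NormedSpace ℝ F]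
    (f : S2 → F) : ∫ x, f (act A x) ∂sphereUniform = ∫ x, f x ∂sphereUniform := by
  have e : MeasurableEmbedding (act A) := by
    let h : S2 ≃ₜ S2 := ⟨⟨act A, act A.symm, act_symm_act A, act_act_symm A⟩,
      continuous_act A, continuous_act _⟩
    exact h.measurableEmbedding
  exact (mp_act A).integral_comp e f

lemma sphereArea_eq : sphereArea = (ENNReal.ofReal (4 * π)) • sphereUniform := by
  unfold sphereUniform
  rw [smul_smul, ENNReal.mul_inv_cancel (by simp [Real.pi_pos]) ENNReal.ofReal_ne_top, one_smul]

lemma integral_area {F : Type*} [NormedAddCommGroup F] [NormedSpace ℝ F] (f : S2 → F) :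
    ∫ x, f x ∂sphereArea = (4 * π) • ∫ x, f x ∂sphereUniform := by
  rw [sphereArea_eq, integral_smul_measure, ENNReal.toReal_ofReal (by positivity)]

end SE
end

open MeasureTheory Real Metric
open scoped ENNReal RealInnerProductSpace Manifold

noncomputable section
namespace SE

def Gr (m : ℕ) : ℝ := ∫ r in Set.Ioi (0 : ℝ), r ^ m * rexp (-r ^ 2)

lemma Gr_eq (m : ℕ) : Gr m = (1 / 2) * Real.Gamma (((m : ℝ) + 1) / 2) := by
  have := integral_rpow_mul_exp_neg_rpow (p := 2) (q := m) (by norm_num) (by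
    have : (0 : ℝ) ≤ m := Nat.cast_nonneg m
    linarith)
  rw [← this]
  unfold Gr
  refine setIntegral_congr_fun measurableSet_Ioi fun r hr => ?_
  simp

lemma Gr_pos (m : ℕ) : 0 < Gr m := by
  rw [Gr_eq]
  have : 0 < Real.Gamma (((m : ℝ) + 1) / 2) := Real.Gamma_pos_of_pos (by positivity)
  positivity

lemma Gr_succ2 (m : ℕ) : Gr (m + 2) = ((m : ℝ) + 1) / 2 * Gr m := by
  rw [Gr_eq, Gr_eq]
  have : ((((m + 2 : ℕ) : ℝ)) + 1) / 2 = ((m : ℝ) + 1) / 2 + 1 := by push_cast; ring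
  rw [this, Real.Gamma_add_one (by positivity)]
  ring

lemma gauss_prod (m : ℕ) : ∫ x : E3, (x 2) ^ m * rexp (-‖x‖ ^ 2) =
    π * ∫ t : ℝ, t ^ m * rexp (-t ^ 2) := by
  have h1 := (PiLp.volume_preserving_toLp (Fin 3)).integral_comp
    (MeasurableEquiv.toLp 2 _).measurableEmbedding
    (fun x : E3 => (x 2) ^ m * rexp (-‖x‖ ^ 2))
  rw [← h1]
  let g : Fin 3 → ℝ → ℝ := ![fun t => rexp (-t ^ 2), fun t => rexp (-t ^ 2),
    fun t => t ^ m * rexp (-t ^ 2)]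
  have h2 := integral_fintype_prod_volume_eq_prod (𝕜 := ℝ) (ι := Fin 3) (E := fun _ => ℝ) (f := g)
  have h3 : ∀ x : Fin 3 → ℝ, ((WithLp.toLp 2 x : E3) 2) ^ m * rexp (-‖(WithLp.toLp 2 x : E3)‖ ^ 2)
      = ∏ i, g i (x i) := by
    intro x
    rw [EuclideanSpace.norm_sq_eq, Fin.prod_univ_three, Fin.sum_univ_three]
    simp only [g, Matrix.cons_val_zero, Matrix.cons_val_one, Matrix.cons_val, Real.norm_eq_abs,
      sq_abs]
    rw [show -(x 0 ^ 2 + x 1 ^ 2 + x 2 ^ 2) = -x 0 ^ 2 + (-x 1 ^ 2) + (-x 2 ^ 2) by ring,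
      Real.exp_add, Real.exp_add]
    ring
  simp_rw [h3]
  rw [h2, Fin.prod_univ_three]
  simp only [g, Matrix.cons_val_zero, Matrix.cons_val_one, Matrix.cons_val]
  have h4 : ∫ t : ℝ, rexp (-t ^ 2) = √π := by
    have := integral_gaussian 1
    simpa using this
  rw [h4, Real.mul_self_sqrt Real.pi_pos.le]

lemma polar_mom (m : ℕ) : ∫ x : E3, (x 2) ^ m * rexp (-‖x‖ ^ 2) =
    (∫ y : S2, ((y : E3) 2) ^ m ∂sphereArea) * Gr (m + 2) := by
  have key := (volume : Measure E3).measurePreserving_homeomorphUnitSphereProd.integral_comp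
        (Homeomorph.measurableEmbedding _) (fun p => ((p.1 : E3) 2) ^ m * ((p.2 : ℝ) ^ m * rexp (-(p.2 : ℝ) ^ 2)))
  have h1 : ∫ x : E3, (x 2) ^ m * rexp (-‖x‖ ^ 2) = ∫ x : ({(0)}ᶜ : Set E3), ((x.1) 2) ^ m * rexp (-‖x.1‖ ^ 2) ∂((volume : Measure E3).comap (↑)) := by
      rw [integral_subtype_comap (measurableSet_singleton _).compl fun x : E3 ↦ (x 2) ^ m * rexp (-‖x‖ ^ 2),
        restrict_compl_singleton]
  rw [h1]
  have h2 : ∀ x : ({(0)}ᶜ : Set E3), ((x.1) 2) ^ m * rexp (-‖x.1‖ ^ 2) =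
    (((homeomorphUnitSphereProd E3 x).1 : E3) 2) ^ m * (((homeomorphUnitSphereProd E3 x).2 : ℝ) ^ m * rexp (-((homeomorphUnitSphereProd E3 x).2 : ℝ) ^ 2)) := by
    intro x
    have hx : ‖x.1‖ ≠ 0 := norm_ne_zero_iff.2 x.2
    simp only [homeomorphUnitSphereProd_apply_snd_coe, homeomorphUnitSphereProd_apply_fst_coe, PiLp.smul_apply, smul_eq_mul]
    rw [← mul_assoc, ← mul_pow]
    congr 2
    field_simp
  simp_rw [h2]
  rw [key, integral_prod_mul (μ := (volume : Measure E3).toSphere) (fun y : S2 => ((y : E3) 2) ^ m)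
    (fun r : Set.Ioi (0 : ℝ) => (r : ℝ) ^ m * rexp (-(r : ℝ) ^ 2))]
  congr 1
  rw [finrank_euclideanSpace_fin]
  simp only [Measure.volumeIoiPow, ENNReal.ofReal]
  rw [integral_withDensity_eq_integral_smul, 
        integral_subtype_comap measurableSet_Ioi fun a : ℝ ↦ Real.toNNReal (a ^ (3 - 1)) • (a ^ m * rexp (-a ^ 2))]
  · unfold Gr
    refine setIntegral_congr_fun measurableSet_Ioi fun x hx ↦ ?_
    rw [NNReal.smul_def, Real.coe_toNNReal _ (pow_nonneg hx.out.le _), smul_eq_mul]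
    ring
  · exact (measurable_subtype_coe.pow_const _).real_toNNReal

lemma mom_even (k : ℕ) : ∫ y : S2, ((y : E3) 2) ^ (2 * k) ∂sphereUniform = 1 / (2 * k + 1) := by
  have h := polar_mom (2 * k)
  rw [gauss_prod, integral_area] at h
  have h2 : ∫ t : ℝ, t ^ (2 * k) * rexp (-t ^ 2) = 2 * Gr (2 * k) := by
    have := integral_comp_abs (f := fun t => t ^ (2 * k) * rexp (-t ^ 2))
    unfold Gr
    rw [← this]
    congr 1; ext t
    rw [pow_mul, pow_mul, sq_abs]
  rw [h2, Gr_succ2] at h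
  have hG := Gr_pos (2 * k)
  have hp := Real.pi_pos
  have h3 : (0 : ℝ) < 2 * k + 1 := by positivity
  rw [smul_eq_mul] at h
  push_cast at h
  rw [eq_div_iff h3.ne']
  have h4 : (π * 2 * Gr (2 * k)) * ((∫ y : S2, ((y : E3) 2) ^ (2 * k) ∂sphereUniform) * (2 * k + 1))
     = (π * 2 * Gr (2 * k)) * 1 := by linear_combination -h
  exact mul_left_cancel₀ (by positivity) h4

def north : S2 := ⟨EuclideanSpace.single 2 1, by simp⟩

lemma exists_act (x y : S2) : ∃ A : E3 ≃ₗᵢ[ℝ] E3, act A x = y := by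
  refine ⟨(ℝ ∙ ((x : E3) - y))ᗮ.reflection, ?_⟩
  ext1
  exact Submodule.reflection_sub (by rw [norm_S2, norm_S2])

lemma integral_ip (x : S2) (g : ℝ → ℝ) :
    ∫ y, g (ip x y) ∂sphereUniform = ∫ y : S2, g ((y : E3) 2) ∂sphereUniform := by
  obtain ⟨A, hA⟩ := exists_act x north
  rw [← integral_act A (fun y : S2 => g ((y : E3) 2))]
  congr 1; ext y
  rw [← ip_act A x y, hA]
  congr 1
  simp only [ip, north, EuclideanSpace.inner_single_left]
  simp

/-- antipodal map is an isometry -/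
def negI : E3 ≃ₗᵢ[ℝ] E3 := LinearIsometryEquiv.neg ℝ

lemma ip_neg (x y : S2) : ip x (act negI y) = - ip x y := by
  simp [ip, act, negI]

lemma mom_ip_even (x : S2) (k : ℕ) : ∫ y, ip x y ^ (2 * k) ∂sphereUniform = 1 / (2 * k + 1) := by
  rw [integral_ip x (fun t => t ^ (2 * k)), mom_even]

lemma mom_ip_odd (x : S2) (k : ℕ) : ∫ y, ip x y ^ (2 * k + 1) ∂sphereUniform = 0 := by
  have := integral_act negI (fun y => ip x y ^ (2 * k + 1))
  simp only [ip_neg] at this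
  have h2 : ∀ y, (-ip x y) ^ (2 * k + 1) = - (ip x y ^ (2 * k + 1)) := by
    intro y; exact Odd.neg_pow ⟨k, rfl⟩ _
  simp only [h2, integral_neg] at this
  linarith

/-- normalized integral of a polynomial over `[-1,1]` -/
def Lam (p : Polynomial ℝ) : ℝ := (1 / 2) * ∫ t in (-1 : ℝ)..1, p.eval t

lemma Lam_add (p q : Polynomial ℝ) : Lam (p + q) = Lam p + Lam q := by
  unfold Lam
  simp only [Polynomial.eval_add]
  rw [intervalIntegral.integral_add]
  · ring
  · exact (p.continuous).intervalIntegrable _ _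
  · exact (q.continuous).intervalIntegrable _ _

lemma Lam_C_mul (c : ℝ) (p : Polynomial ℝ) : Lam (Polynomial.C c * p) = c * Lam p := by
  unfold Lam
  simp only [Polynomial.eval_mul, Polynomial.eval_C]
  rw [intervalIntegral.integral_const_mul]
  ring

lemma Lam_X_pow (n : ℕ) : Lam (Polynomial.X ^ n) = (1 / 2) * ((1 - (-1) ^ (n + 1)) / (n + 1)) := by
  unfold Lam
  simp [integral_pow]

lemma integral_ip_poly (x : S2) (p : Polynomial ℝ) :
    ∫ y, p.eval (ip x y) ∂sphereUniform = Lam p := by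
  induction p using Polynomial.induction_on' with
  | add p q hp hq =>
    rw [Lam_add, ← hp, ← hq]
    simp only [Polynomial.eval_add]
    rw [integral_add]
    · exact integrable_cont (p.continuous.comp (by fun_prop))
    · exact integrable_cont (q.continuous.comp (by fun_prop))
  | monomial n a =>
    rw [← Polynomial.C_mul_X_pow_eq_monomial, Lam_C_mul, Lam_X_pow]
    simp only [Polynomial.eval_mul, Polynomial.eval_C, Polynomial.eval_pow, Polynomial.eval_X]
    rw [integral_const_mul]
    congr 1
    rcases Nat.even_or_odd' n with ⟨k, rfl | rfl⟩
    · rw [mom_ip_even, Odd.neg_one_pow ⟨k, rfl⟩]; push_cast; ring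
    · rw [mom_ip_odd, Even.neg_one_pow ⟨k + 1, by ring⟩]; ring

end SE
end

open MeasureTheory Real Metric
open scoped ENNReal RealInnerProductSpace Manifold

noncomputable section
namespace SE
open Polynomial in
lemma Lam_derivative (p : ℝ[X]) : Lam (derivative p) = (1 / 2) * (p.eval 1 - p.eval (-1)) := by
  unfold Lam
  congr 1
  exact intervalIntegral.integral_eq_sub_of_hasDerivAt (fun t _ => p.hasDerivAt t)
    ((derivative p).continuous.intervalIntegrable _ _)

def LamL : Polynomial ℝ →ₗ[ℝ] ℝ where
  toFun := Lam
  map_add' := Lam_add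
  map_smul' c p := by simp [Polynomial.smul_eq_C_mul, Lam_C_mul]

lemma Lam_sub (p q : Polynomial ℝ) : Lam (p - q) = Lam p - Lam q := LamL.map_sub p q
lemma Lam_neg (p : Polynomial ℝ) : Lam (-p) = - Lam p := LamL.map_neg p
lemma Lam_zero : Lam 0 = 0 := LamL.map_zero
lemma Lam_sum {ι : Type*} (s : Finset ι) (p : ι → Polynomial ℝ) :
  Lam (∑ i ∈ s, p i) = ∑ i ∈ s, Lam (p i) := map_sum LamL p s

open Polynomial

/-- the polynomial `(1+X)/2` -/
def pV : ℝ[X] := C (1 / 2) * (1 + X)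

lemma pV_eval (t : ℝ) : pV.eval t = (1 + t) / 2 := by simp [pV]; ring

lemma pV_deriv : derivative pV = C (1 / 2) := by simp [pV]

lemma Lam_pV (n : ℕ) : Lam (pV ^ n) = 1 / (n + 1) := by
  have h := Lam_derivative (pV ^ (n + 1))
  rw [derivative_pow, pV_deriv] at h
  have h2 : C ((n + 1 : ℕ) : ℝ) * pV ^ (n + 1 - 1) * C (1 / 2) = C (((n : ℝ) + 1) / 2) * pV ^ n := by
    rw [mul_right_comm, ← C_mul]; congr 2; push_cast; ring
  rw [h2, Lam_C_mul] at h
  simp only [eval_pow, pV_eval] at h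
  norm_num at h
  have : (0 : ℝ) < n + 1 := by positivity
  rw [eq_div_iff this.ne']; linarith

lemma Lam_beta_step (a b : ℕ) : (a + 1 : ℝ) * Lam (pV ^ a * (1 - pV) ^ (b + 1)) =
    (b + 1) * Lam (pV ^ (a + 1) * (1 - pV) ^ b) := by
  have h := Lam_derivative (pV ^ (a + 1) * (1 - pV) ^ (b + 1))
  have h2 : derivative (pV ^ (a + 1) * (1 - pV) ^ (b + 1)) =
     C (1 / 2) * (C ((a : ℝ) + 1) * (pV ^ a * (1 - pV) ^ (b + 1)) -
      C ((b : ℝ) + 1) * (pV ^ (a + 1) * (1 - pV) ^ b)) := by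
    rw [derivative_mul, derivative_pow, derivative_pow, derivative_sub, pV_deriv]
    simp
    ring
  rw [h2, Lam_C_mul, Lam_sub, Lam_C_mul, Lam_C_mul] at h
  simp only [eval_mul, eval_pow, eval_sub, pV_eval] at h
  norm_num at h
  linarith

lemma Lam_beta (a b : ℕ) : Lam (pV ^ a * (1 - pV) ^ b) =
    (a.factorial * b.factorial : ℝ) / (a + b + 1).factorial := by
  induction b generalizing a with
  | zero =>
    simp only [pow_zero, mul_one, Lam_pV, Nat.factorial_zero, Nat.cast_one, add_zero,
      Nat.factorial_succ]
    have := Nat.factorial_pos a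
    push_cast
    field_simp
  | succ b ih =>
    have h := Lam_beta_step a b
    rw [ih] at h
    have ha : (0 : ℝ) < a + 1 := by positivity
    rw [← mul_right_inj' ha.ne', h, show a + 1 + b + 1 = a + (b + 1) + 1 by ring]
    simp only [Nat.factorial_succ]
    push_cast
    have := Nat.factorial_pos (a + b + 1)
    field_simp

/-- iterated integration by parts -/
lemma Lam_ibp (l : ℕ) (q : ℝ[X]) (j : ℕ) (hj : j ≤ l) :
    Lam ((derivative^[l] ((X ^ 2 - 1 : ℝ[X]) ^ l)) * q) =
      (-1) ^ j * Lam ((derivative^[l - j] ((X ^ 2 - 1 : ℝ[X]) ^ l)) * derivative^[j] q) := by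
  induction j with
  | zero => simp
  | succ j ih =>
    rw [ih (by omega)]
    have h := Lam_derivative ((derivative^[l - (j + 1)] ((X ^ 2 - 1 : ℝ[X]) ^ l)) * derivative^[j] q)
    have e1 : l - j = (l - (j + 1)) + 1 := by omega
    rw [derivative_mul, ← Function.iterate_succ_apply' derivative,
      ← Function.iterate_succ_apply' derivative, Lam_add] at h
    have hd : (X ^ 2 - 1 : ℝ[X]) ∣ (derivative^[l - (j + 1)] ((X ^ 2 - 1 : ℝ[X]) ^ l)) := by
      refine dvd_trans ?_ (pow_sub_dvd_iterate_derivative_pow (X ^ 2 - 1 : ℝ[X]) l (l - (j + 1)))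
      exact dvd_pow_self _ (by omega)
    obtain ⟨w, hw⟩ := hd
    have e2 : (1 / 2 : ℝ) * (eval 1 (derivative^[l - (j + 1)] ((X ^ 2 - 1 : ℝ[X]) ^ l) * derivative^[j] q) -
       eval (-1) (derivative^[l - (j + 1)] ((X ^ 2 - 1 : ℝ[X]) ^ l) * derivative^[j] q)) = 0 := by
      rw [hw]; simp
    rw [e2] at h
    rw [e1]
    have : Lam (derivative^[(l - (j + 1)) + 1] ((X ^ 2 - 1 : ℝ[X]) ^ l) * derivative^[j] q)
       = - Lam (derivative^[(l - (j + 1))] ((X ^ 2 - 1 : ℝ[X]) ^ l) * derivative^[j+1] q) := by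
      linarith
    rw [this, pow_succ (-1 : ℝ) j]; ring

lemma Lam_leg (l : ℕ) (q : ℝ[X]) : Lam (legendreP l * q) =
    (2 ^ l * l.factorial : ℝ)⁻¹ * ((-1) ^ l * Lam ((X ^ 2 - 1 : ℝ[X]) ^ l * derivative^[l] q)) := by
  rw [legendreP, mul_assoc, Lam_C_mul, Lam_ibp l q l le_rfl]
  simp

lemma Lam_leg_lower (l : ℕ) (q : ℝ[X]) (h : q.natDegree < l) : Lam (legendreP l * q) = 0 := by
  rw [Lam_leg, iterate_derivative_eq_zero h]
  simp [Lam_zero]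

/-- `∫ v^n P_l` -/
def II (n l : ℕ) : ℝ := Lam (legendreP l * pV ^ n)

lemma II_zero {n l : ℕ} (h : n < l) : II n l = 0 := by
  apply Lam_leg_lower
  refine lt_of_le_of_lt ?_ h
  refine (natDegree_pow_le).trans ?_
  have : pV.natDegree ≤ 1 := by
    unfold pV; compute_degree
  nlinarith

lemma iter_pV (n l : ℕ) (h : l ≤ n) :
  derivative^[l] (pV ^ n) = C ((n.factorial : ℝ) / (n - l).factorial * (1 / 2) ^ l) * pV ^ (n - l) := by
  induction l with
  | zero =>
    have : (n.factorial : ℝ) ≠ 0 := by exact_mod_cast (Nat.factorial_pos n).ne'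
    simp [div_self this]
  | succ l ih =>
    rw [Function.iterate_succ_apply', ih (by omega), derivative_C_mul, derivative_pow, pV_deriv]
    have e : n - l - 1 = n - (l + 1) := by omega
    rw [e, mul_right_comm (C _) (pV ^ _), ← mul_assoc, ← C_mul, ← C_mul]
    congr 2
    have e2 : n - l = (n - (l + 1)) + 1 := by omega
    rw [e2, Nat.factorial_succ]
    have := Nat.factorial_pos (n - (l + 1))
    push_cast
    field_simp
    ring

lemma II_eq {n l : ℕ} (h : l ≤ n) : II n l =
    (n.factorial : ℝ) ^ 2 / ((n - l).factorial * (n + l + 1).factorial) := by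
  rw [II, Lam_leg, iter_pV n l h]
  have e : (X ^ 2 - 1 : ℝ[X]) ^ l * (C ((n.factorial : ℝ) / (n - l).factorial * (1 / 2) ^ l) * pV ^ (n - l))
    = C ((n.factorial : ℝ) / (n - l).factorial * (1 / 2) ^ l * (-4) ^ l) * (pV ^ n * (1 - pV) ^ l) := by
    have e1 : (X ^ 2 - 1 : ℝ[X]) = C (-4) * (pV * (1 - pV)) := by
      have hc : (C (1 / 2) : ℝ[X]) * C (1 / 2) * C (-4) = -1 := by
        rw [← C_mul, ← C_mul]; norm_num
      have hc2 : (C (1 / 2) : ℝ[X]) * C (-4) = -2 := by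
        rw [← C_mul]; norm_num; rfl
      unfold pV
      linear_combination (1 + X)^2 * hc - (1 + X) * hc2
    have e2 : pV ^ n = pV ^ l * pV ^ (n - l) := by rw [← pow_add]; congr 1; omega
    rw [e1, e2, mul_pow, mul_pow, ← C_pow, C_mul (b := (-4) ^ l)]
    ring
  rw [e, Lam_C_mul, Lam_beta]
  have h4 : ((-4 : ℝ)) ^ l = (-1) ^ l * 2 ^ l * 2 ^ l := by
    rw [← mul_pow, ← mul_pow]; norm_num
  rw [h4]
  have h1 : ((-1 : ℝ)) ^ l * (-1) ^ l = 1 := by rw [← mul_pow]; norm_num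
  have := Nat.factorial_pos (n - l)
  have := Nat.factorial_pos (n + l + 1)
  have := Nat.factorial_pos l
  have h5 : ((1 : ℝ) / 2) ^ l * 2 ^ l = 1 := by rw [← mul_pow]; norm_num
  field_simp
  rw [div_pow, one_pow] at h5
  field_simp at h5
  rw [div_pow, one_pow]
  field_simp
  nlinarith [h1]

lemma II_nonneg (n l : ℕ) : 0 ≤ II n l := by
  rcases lt_or_ge n l with h | h
  · rw [II_zero h]
  · rw [II_eq h]; positivity

end SE
end

open MeasureTheory Real Metric
open scoped ENNReal RealInnerProductSpace Manifold

noncomputable section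
namespace SE
open Polynomial

lemma natDegree_leg (l : ℕ) : (legendreP l).natDegree ≤ l := by
  unfold legendreP
  refine (natDegree_C_mul_le _ _).trans ?_
  refine (natDegree_iterate_derivative _ _).trans ?_
  have : ((X ^ 2 - 1 : ℝ[X]) ^ l).natDegree ≤ l * 2 := by
    refine natDegree_pow_le.trans ?_
    gcongr
    compute_degree
  omega

lemma coeff_leg (l : ℕ) : (legendreP l).coeff l =
    ((2 * l).factorial : ℝ) / (2 ^ l * l.factorial ^ 2) := by
  unfold legendreP
  rw [coeff_C_mul, coeff_iterate_derivative]
  have h1 : ((X ^ 2 - 1 : ℝ[X]) ^ l).coeff (l + l) = 1 := by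
    have hm : (X ^ 2 - 1 : ℝ[X]).Monic := by
      have := monic_X_pow_sub_C (1 : ℝ) (n := 2) (by norm_num)
      simpa using this
    have hd : (X ^ 2 - 1 : ℝ[X]).natDegree = 2 := by
      have := natDegree_X_pow_sub_C (n := 2) (r := (1 : ℝ))
      simpa using this
    have h2 := (hm.pow l).coeff_natDegree
    rwa [hm.natDegree_pow, hd, mul_comm, two_mul] at h2
  rw [h1, nsmul_eq_mul, mul_one]
  have h3 := Nat.factorial_mul_descFactorial (n := l + l) (k := l) (by omega)
  rw [Nat.add_sub_cancel, ← two_mul] at h3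
  rw [← two_mul, ← h3]
  have := Nat.factorial_pos l
  push_cast
  field_simp

lemma coeff_leg_pos (l : ℕ) : 0 < (legendreP l).coeff l := by
  rw [coeff_leg]; positivity

lemma iter_deriv_top (l : ℕ) (p : ℝ[X]) (h : p.natDegree ≤ l) :
    derivative^[l] p = C (l.factorial * p.coeff l) := by
  ext n
  rw [coeff_iterate_derivative, coeff_C]
  split_ifs with hn
  · subst hn
    simp [Nat.descFactorial_self]
  · rw [coeff_eq_zero_of_natDegree_lt (by omega)]; simp

lemma Lam_leg_sq (l : ℕ) : Lam (legendreP l * legendreP l) = 1 / (2 * l + 1) := by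
  have h0 : derivative^[l] (legendreP l) = C ((legendreP l).coeff l * 2 ^ l) * derivative^[l] (pV ^ l) := by
    rw [iter_deriv_top l _ (natDegree_leg l), iter_pV l l le_rfl]
    simp only [Nat.sub_self, pow_zero, mul_one, ← C_mul, Nat.factorial_zero, Nat.cast_one, div_one]
    congr 1
    have h5 : ((1 : ℝ) / 2) ^ l * 2 ^ l = 1 := by rw [← mul_pow]; norm_num
    linear_combination (-(l.factorial : ℝ) * (legendreP l).coeff l) * h5
  have h1 : Lam (legendreP l * legendreP l) = (legendreP l).coeff l * 2 ^ l * II l l := by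
    unfold II
    rw [Lam_leg, Lam_leg l (pV ^ l), h0]
    rw [mul_left_comm _ (C _), Lam_C_mul]; ring
  rw [h1, II_eq le_rfl, coeff_leg, ← two_mul, Nat.factorial_succ]
  have := Nat.factorial_pos l
  have := Nat.factorial_pos (2 * l)
  simp only [Nat.sub_self, Nat.factorial_zero]
  push_cast
  field_simp

lemma leg_one (l : ℕ) : (legendreP l).eval 1 = 1 := by
  unfold legendreP
  rw [show (X ^ 2 - 1 : ℝ[X]) = (X - C 1) * (X + C 1) by simp; ring, mul_pow,
    iterate_derivative_mul, eval_mul, eval_C, eval_finsetSum]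
  rw [Finset.sum_eq_single 0]
  · simp only [Nat.choose_zero_right, Nat.sub_zero, iterate_derivative_X_sub_pow_self, Function.iterate_zero, id]
    have := Nat.factorial_pos l
    simp
    norm_num
    field_simp
  · intro i hi hi0
    have hi' := Finset.mem_range.1 hi
    have hd : (X - C 1 : ℝ[X]) ∣ (derivative^[l - i] ((X - C 1 : ℝ[X]) ^ l)) := by
      refine dvd_trans ?_ (pow_sub_dvd_iterate_derivative_pow (X - C 1 : ℝ[X]) l (l - i))
      exact dvd_pow_self _ (by omega)
    obtain ⟨w, hw⟩ := hd
    rw [hw]; simp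
  · simp

lemma Lam_nonneg_sq (p : ℝ[X]) (h : Lam (p * p) = 0) : p = 0 := by
  unfold Lam at h
  have h1 : ∫ t in (-1 : ℝ)..1, (p * p).eval t = 0 := by linarith
  by_contra hp
  obtain ⟨t, ht, ht0⟩ : ∃ t ∈ Set.Icc (-1 : ℝ) 1, p.eval t ≠ 0 := by
    by_contra! hcon
    apply hp
    apply eq_zero_of_infinite_isRoot
    exact (Set.Icc_infinite (by norm_num : (-1 : ℝ) < 1)).mono fun t ht => hcon t ht
  have := intervalIntegral.integral_pos (a := -1) (b := 1) (f := fun t => (p * p).eval t) (by norm_num)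
    (p * p).continuous.continuousOn (fun t _ => by simp [mul_self_nonneg])
    ⟨t, ht, by simp only [eval_mul]; exact mul_self_pos.2 ht0⟩
  linarith

lemma Lam_mul_comm (p q : ℝ[X]) : Lam (p * q) = Lam (q * p) := by rw [mul_comm]

/-- a polynomial orthogonal to all `P_l` with `l ≤ n` is orthogonal to degree `≤ n`. -/
lemma Lam_orth_all (n : ℕ) (r : ℝ[X]) (h : ∀ l < n, Lam (r * legendreP l) = 0) :
    ∀ q : ℝ[X], q.natDegree < n → Lam (r * q) = 0 := by
  have key : ∀ d, d < n → ∀ q : ℝ[X], q.natDegree ≤ d → Lam (r * q) = 0 := by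
    intro d
    induction d with
    | zero =>
      intro hd q hq
      have h0 := h 0 hd
      have h1 : legendreP 0 = 1 := by simp [legendreP]
      rw [eq_C_of_natDegree_le_zero hq, mul_comm, Lam_C_mul]
      rw [h1, mul_one] at h0
      rw [h0]; simp
    | succ d ih =>
      intro hd q hq
      have hc := coeff_leg_pos (d + 1)
      set c := q.coeff (d + 1) / (legendreP (d + 1)).coeff (d + 1) with hcdef
      have hs : (q - C c * legendreP (d + 1)).natDegree ≤ d := by
        rw [natDegree_le_iff_coeff_eq_zero]
        intro N hN
        rw [coeff_sub, coeff_C_mul]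
        rcases Nat.lt_or_ge (d + 1) N with h2 | h2
        · rw [coeff_eq_zero_of_natDegree_lt (by omega),
            coeff_eq_zero_of_natDegree_lt (lt_of_le_of_lt (natDegree_leg _) h2)]; simp
        · have : N = d + 1 := by omega
          subst this
          rw [hcdef]; field_simp; simp
      have h3 := ih (by omega) _ hs
      rw [mul_sub, Lam_sub, mul_left_comm, Lam_C_mul, h _ hd] at h3
      linarith
  intro q hq
  exact key _ hq q le_rfl

lemma eq_zero_of_orth (n : ℕ) (r : ℝ[X]) (hr : r.natDegree < n)
    (h : ∀ l < n, Lam (r * legendreP l) = 0) : r = 0 :=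
  Lam_nonneg_sq r (Lam_orth_all n r h r hr)

lemma Lam_leg_leg (k l : ℕ) : Lam (legendreP k * legendreP l) = if k = l then 1 / (2 * (l : ℝ) + 1) else 0 := by
  split_ifs with h
  · subst h; exact Lam_leg_sq k
  · rcases lt_or_gt_of_ne h with h | h
    · rw [mul_comm]
      exact Lam_leg_lower _ _ (lt_of_le_of_lt (natDegree_leg k) h)
    · exact Lam_leg_lower _ _ (lt_of_le_of_lt (natDegree_leg l) h)

lemma pV_expand (n : ℕ) : pV ^ n = ∑ l ∈ Finset.range (n + 1), C ((2 * l + 1) * II n l) * legendreP l := by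
  rw [← sub_eq_zero]
  apply eq_zero_of_orth (n + 1)
  · rw [Nat.lt_succ_iff]
    refine (natDegree_sub_le _ _).trans (max_le ?_ ?_)
    · refine (natDegree_pow_le).trans ?_
      have : pV.natDegree ≤ 1 := by unfold pV; compute_degree
      nlinarith
    · refine natDegree_sum_le_of_forall_le _ _ fun l hl => ?_
      refine (natDegree_C_mul_le _ _).trans ((natDegree_leg l).trans ?_)
      have := Finset.mem_range.1 hl; omega
  · intro k hk
    rw [sub_mul, Lam_sub, Finset.sum_mul, Lam_sum]
    simp only [mul_assoc, Lam_C_mul, Lam_leg_leg]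
    rw [Finset.sum_eq_single k]
    · rw [if_pos rfl, mul_comm, ← II]
      field_simp; simp
    · intro b _ hb; rw [if_neg hb]; ring
    · intro h; exact absurd (Finset.mem_range.2 hk) h

/-- the reproducing kernels w.r.t. the uniform measure -/
def eK (l : ℕ) (x y : S2) : ℝ := (2 * l + 1) * (legendreP l).eval (ip x y)

lemma eK_comm (l : ℕ) (x y : S2) : eK l x y = eK l y x := by simp [eK, ip_comm]

@[fun_prop]
lemma Continuous.eK' {X : Type*} [TopologicalSpace X] {f g : X → S2} (l : ℕ) (hf : Continuous f)
    (hg : Continuous g) : Continuous (fun t => eK l (f t) (g t)) := by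
  unfold eK
  exact continuous_const.mul ((legendreP l).continuous.comp (by fun_prop))

lemma zonal_eq (l : ℕ) (x y : S2) : zonal l x y = eK l x y / (4 * π) := by
  unfold zonal eK ip; ring

lemma eK_zero (x y : S2) : eK 0 x y = 1 := by simp [eK, legendreP]

lemma vv_pow_eq (n : ℕ) (x y : S2) : vv x y ^ n = ∑ l ∈ Finset.range (n + 1), II n l * eK l x y := by
  have := congrArg (fun p => p.eval (ip x y)) (pV_expand n)
  simp only [eval_pow, pV_eval, eval_finsetSum, eval_mul, eval_C] at this
  unfold vv eK
  rw [this]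
  refine Finset.sum_congr rfl fun l _ => by ring

/-- moments in an arbitrary direction -/
lemma mom_dir (V : E3) (k : ℕ) : ∫ y : S2, (inner ℝ V (y : E3)) ^ (2 * k) ∂sphereUniform =
    (‖V‖ ^ 2) ^ k / (2 * k + 1) := by
  by_cases hV : V = 0
  · subst hV
    rcases Nat.eq_zero_or_pos k with rfl | hk
    · simp
    · simp [hk.ne']
  · have hn : ‖V‖ ≠ 0 := norm_ne_zero_iff.2 hV
    let u : S2 := ⟨‖V‖⁻¹ • V, by simp [norm_smul, hn]⟩
    have : ∀ y : S2, (inner ℝ V (y : E3)) = ‖V‖ * ip u y := by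
      intro y; simp only [ip, u, inner_smul_left]; simp; field_simp
    simp only [this, mul_pow]
    rw [integral_const_mul, mom_ip_even, pow_mul]; ring

lemma conv_mono (a b : ℕ) : ∃ R : ℝ[X], R.natDegree ≤ a ∧ ∀ x z : S2,
    ∫ y, ip x y ^ a * ip z y ^ b ∂sphereUniform = R.eval (ip x z) := by
  rcases Nat.even_or_odd' (a + b) with ⟨k, hk | hk⟩
  · let R : ℝ[X] := C ((((2 * k).choose a : ℝ))⁻¹ * (2 * (k : ℝ) + 1)⁻¹) * 
      ∑ j ∈ Finset.range (k + 1), if a < j then 0 else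
        C ((k.choose j : ℝ) * (j.choose (a - j))) * (C 2 * X) ^ (j - (a - j))
    refine ⟨R, ?_, fun x z => ?_⟩
    · refine (natDegree_C_mul_le _ _).trans ?_
      refine natDegree_sum_le_of_forall_le _ _ fun j hj => ?_
      split_ifs with h
      · simp
      · refine (natDegree_C_mul_le _ _).trans ?_
        refine natDegree_pow_le.trans ?_
        have : (C 2 * X : ℝ[X]).natDegree ≤ 1 := by compute_degree
        calc _ ≤ (j - (a - j)) * 1 := by gcongr
          _ ≤ a := by omega
    · set c := ip x z with hc
      let M : ℕ → ℝ := fun i => ∫ y, ip x y ^ i * ip z y ^ (2 * k - i) ∂sphereUniform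
      have hpoly : (∑ i ∈ Finset.range (2 * k + 1), C (((2 * k).choose i : ℝ) * M i) * X ^ i : ℝ[X]) =
          C ((2 * k + 1 : ℝ)⁻¹) * (X * (X + C (2 * c)) + 1) ^ k := by
        apply Polynomial.funext
        intro α
        have h1 := mom_dir (α • (x : E3) + z) k
        have h2 : ‖α • (x : E3) + z‖ ^ 2 = α * (α + 2 * c) + 1 := by
          rw [norm_add_sq_real, norm_smul, norm_S2, norm_S2, inner_smul_left, hc]
          simp [ip]; ring
        have h3 : ∀ y : S2, (inner ℝ (α • (x : E3) + z) (y : E3)) = α * ip x y + ip z y := by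
          intro y; rw [inner_add_left, inner_smul_left]; simp [ip]
        rw [h2] at h1
        have h4 : ∀ y : S2, (α * ip x y + ip z y) ^ (2 * k) = ∑ i ∈ Finset.range (2 * k + 1),
            (α * ip x y) ^ i * ip z y ^ (2 * k - i) * ((2 * k).choose i : ℝ) := fun y => add_pow _ _ _
        simp only [h3, h4] at h1
        rw [integral_finsetSum _ (fun i _ => integrable_cont (by fun_prop))] at h1
        simp only [eval_finsetSum, eval_mul, eval_C, eval_pow, eval_add, eval_X, eval_one]
        rw [inv_mul_eq_div, ← h1]
        refine Finset.sum_congr rfl fun i _ => ?_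
        rw [← integral_const_mul, ← integral_mul_const]
        congr 1; ext y; ring
      have hcoef := congrArg (fun p => p.coeff a) hpoly
      simp only [finset_sum_coeff, coeff_C_mul, coeff_X_pow] at hcoef
      rw [Finset.sum_eq_single a (by intro i _ hi; rw [if_neg (Ne.symm hi)]; ring)
        (by intro h; exact absurd (Finset.mem_range.2 (by omega)) h), if_pos rfl] at hcoef
      rw [add_pow, finset_sum_coeff] at hcoef
      have hMa : M a = ∫ y, ip x y ^ a * ip z y ^ b ∂sphereUniform := by
        simp only [M]; rw [show 2 * k - a = b by omega]
      rw [hMa] at hcoef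
      have hch : (0 : ℝ) < (2 * k).choose a := by exact_mod_cast Nat.choose_pos (by omega)
      simp only [R, eval_mul, eval_C, eval_finsetSum]
      have hsum : ∀ j ∈ Finset.range (k + 1),
          ((X * (X + C (2 * c))) ^ j * 1 ^ (k - j) * ((k.choose j : ℕ) : ℝ[X])).coeff a =
          eval c (if a < j then (0 : ℝ[X]) else
        C ((k.choose j : ℝ) * (j.choose (a - j))) * (C 2 * X) ^ (j - (a - j))) := by
        intro j _
        rw [one_pow, mul_one, ← C_eq_natCast, coeff_mul_C, mul_pow, coeff_X_pow_mul']
        by_cases h : a < j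
        · rw [if_neg (by omega), if_pos h]; simp
        · rw [if_pos (by omega), if_neg h, coeff_X_add_C_pow]
          simp; ring
      rw [Finset.sum_congr rfl hsum] at hcoef
      rw [mul_assoc, ← hcoef]
      field_simp
  · refine ⟨0, by simp, fun x z => ?_⟩
    have := integral_act negI (fun y => ip x y ^ a * ip z y ^ b)
    simp only [ip_neg] at this
    have h2 : ∀ y, (-ip x y) ^ a * (- ip z y) ^ b = - (ip x y ^ a * ip z y ^ b) := by
      intro y
      rw [neg_pow, neg_pow (ip z y), mul_mul_mul_comm, ← pow_add, hk, Odd.neg_one_pow ⟨k, rfl⟩]; ring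
    simp only [h2, integral_neg] at this
    simp; linarith

end SE
end

open MeasureTheory Real Metric
open scoped ENNReal RealInnerProductSpace Manifold

noncomputable section
namespace SE
open Polynomial

lemma conv_poly (p q : ℝ[X]) : ∃ R : ℝ[X], R.natDegree ≤ p.natDegree ∧ ∀ x z : S2,
    ∫ y, p.eval (ip x y) * q.eval (ip z y) ∂sphereUniform = R.eval (ip x z) := by
  choose R hR1 hR2 using conv_mono
  refine ⟨∑ i ∈ Finset.range (p.natDegree + 1), ∑ j ∈ Finset.range (q.natDegree + 1),
    C (p.coeff i * q.coeff j) * R i j, ?_, fun x z => ?_⟩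
  · refine natDegree_sum_le_of_forall_le _ _ fun i hi => ?_
    refine natDegree_sum_le_of_forall_le _ _ fun j hj => ?_
    refine (natDegree_C_mul_le _ _).trans ((hR1 i j).trans ?_)
    have := Finset.mem_range.1 hi; omega
  · simp only [eval_finsetSum, eval_mul, eval_C, ← hR2]
    simp only [eval_eq_sum_range (p := p), eval_eq_sum_range (p := q), Finset.sum_mul_sum]
    rw [integral_finsetSum _ (fun i _ => integrable_cont (by fun_prop))]
    refine Finset.sum_congr rfl fun i _ => ?_
    rw [integral_finsetSum _ (fun i _ => integrable_cont (by fun_prop))]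
    refine Finset.sum_congr rfl fun j _ => ?_
    rw [← integral_const_mul]
    congr 1; ext y; ring

lemma exists_ip (t : ℝ) (ht : t ∈ Set.Icc (-1 : ℝ) 1) : ∃ z : S2, ip north z = t := by
  have h1 : 0 ≤ 1 - t ^ 2 := by nlinarith [ht.1, ht.2]
  refine ⟨⟨!₂[√(1 - t ^ 2), 0, t], ?_⟩, ?_⟩
  · rw [mem_sphere_zero_iff_norm, EuclideanSpace.norm_eq, Fin.sum_univ_three]
    simp [Real.sq_sqrt h1]
  · simp [ip, north, EuclideanSpace.inner_single_left]

lemma poly_eq_of_ip (p q : ℝ[X]) (h : ∀ z, p.eval (ip north z) = q.eval (ip north z)) : p = q := by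
  apply eq_of_infinite_eval_eq
  refine (Set.Icc_infinite (by norm_num : (-1 : ℝ) < 1)).mono fun t ht => ?_
  obtain ⟨z, hz⟩ := exists_ip t ht
  have := h z
  rwa [hz] at this

lemma conv_poly_min (p q : ℝ[X]) : ∃ R : ℝ[X], R.natDegree ≤ p.natDegree ∧
    R.natDegree ≤ q.natDegree ∧ ∀ x z : S2,
    ∫ y, p.eval (ip x y) * q.eval (ip z y) ∂sphereUniform = R.eval (ip x z) := by
  obtain ⟨R, h1, h2⟩ := conv_poly p q
  obtain ⟨R', h1', h2'⟩ := conv_poly q p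
  have : R = R' := by
    apply poly_eq_of_ip
    intro z
    rw [← h2, ip_comm north z, ← h2']
    congr 1; ext y; ring
  exact ⟨R, h1, this ▸ h1', h2⟩

lemma swap_cont {f : S2 → S2 → ℝ} (hf : Continuous (fun p : S2 × S2 => f p.1 p.2)) :
    ∫ x, ∫ y, f x y ∂sphereUniform ∂sphereUniform = ∫ y, ∫ x, f x y ∂sphereUniform ∂sphereUniform :=
  integral_integral_swap (integrable_cont hf)

lemma Lam_conv (l k j : ℕ) (R S : ℝ[X])
    (hR : ∀ x z : S2, ∫ y, (legendreP l).eval (ip x y) * (legendreP k).eval (ip z y) ∂sphereUniform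
      = R.eval (ip x z))
    (hS : ∀ x z : S2, ∫ y, (legendreP k).eval (ip x y) * (legendreP j).eval (ip z y) ∂sphereUniform
      = S.eval (ip x z)) : Lam (R * legendreP j) = Lam (legendreP l * S) := by
  rw [← integral_ip_poly north, ← integral_ip_poly north]
  simp only [eval_mul]
  have h1 : ∀ z, R.eval (ip north z) * (legendreP j).eval (ip north z) =
    ∫ y, (legendreP l).eval (ip north y) * (legendreP k).eval (ip z y) * (legendreP j).eval (ip north z) ∂sphereUniform := by
    intro z; rw [integral_mul_const, hR]
  have h2 : ∀ y, (legendreP l).eval (ip north y) * S.eval (ip north y) =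
    ∫ z, (legendreP l).eval (ip north y) * (legendreP k).eval (ip z y) * (legendreP j).eval (ip north z) ∂sphereUniform := by
    intro y
    simp only [mul_assoc]
    rw [integral_const_mul, ip_comm north y, ← hS]
    congr 2; ext z; rw [ip_comm z y]
  simp only [h1, h2]
  apply swap_cont
  have c1 := (legendreP l).continuous
  have c2 := (legendreP k).continuous
  have c3 := (legendreP j).continuous
  exact ((c1.comp (by fun_prop : Continuous fun p : S2 × S2 => ip north p.2)).mul
    (c2.comp (by fun_prop : Continuous fun p : S2 × S2 => ip p.1 p.2))).mul
    (c3.comp (by fun_prop : Continuous fun p : S2 × S2 => ip north p.1))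

lemma conv_leg (l k : ℕ) (x z : S2) :
    ∫ y, (legendreP l).eval (ip x y) * (legendreP k).eval (ip z y) ∂sphereUniform =
      if l = k then (legendreP k).eval (ip x z) / (2 * k + 1) else 0 := by
  obtain ⟨R, hR1, hR2, hR⟩ := conv_poly_min (legendreP l) (legendreP k)
  have hlow : ∀ j, j < l ∨ j < k → Lam (R * legendreP j) = 0 := by
    intro j hj
    rcases hj with hj | hj
    · obtain ⟨S, hS1, hS2, hS⟩ := conv_poly_min (legendreP k) (legendreP j)
      rw [Lam_conv l k j R S hR hS]
      exact Lam_leg_lower _ _ (lt_of_le_of_lt (hS2.trans (natDegree_leg j)) hj)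
    · obtain ⟨S, hS1, hS2, hS⟩ := conv_poly_min (legendreP l) (legendreP j)
      rw [Lam_conv k l j R S (fun x z => by
        rw [ip_comm x z, ← hR]; congr 1; ext y; ring) hS]
      exact Lam_leg_lower _ _ (lt_of_le_of_lt (hS2.trans (natDegree_leg j)) hj)
  rw [hR]
  have dl := natDegree_leg l
  have dk := natDegree_leg k
  split_ifs with h
  · subst h
    have hc := coeff_leg_pos l
    set c := R.coeff l / (legendreP l).coeff l with hcdef
    have h0 : R - C c * legendreP l = 0 := by
      rcases Nat.eq_zero_or_pos l with rfl | hl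
      · have h1 : legendreP 0 = 1 := by simp [legendreP]
        rw [eq_C_of_natDegree_le_zero (hR1.trans dl), hcdef, h1]; simp
      · apply eq_zero_of_orth l
        · have : (R - C c * legendreP l).natDegree ≤ l - 1 := by
            rw [natDegree_le_iff_coeff_eq_zero]
            intro N hN
            rw [coeff_sub, coeff_C_mul]
            rcases Nat.lt_or_ge l N with h2 | h2
            · rw [coeff_eq_zero_of_natDegree_lt (by omega),
                coeff_eq_zero_of_natDegree_lt (lt_of_le_of_lt (natDegree_leg _) h2)]; simp
            · have : N = l := by omega
              subst this
              rw [hcdef]; field_simp; simp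
          omega
        · intro j hj
          rw [sub_mul, Lam_sub, hlow j (Or.inl hj), mul_assoc, Lam_C_mul,
            Lam_leg_lower _ _ (lt_of_le_of_lt (natDegree_leg j) hj)]; simp
    have hRc : R = C c * legendreP l := sub_eq_zero.1 h0
    have h1 : c = 1 / (2 * l + 1) := by
      have h2 := hR north north
      rw [hRc, ip_self] at h2
      have h3 := integral_ip_poly north (legendreP l * legendreP l)
      simp only [eval_mul] at h3
      rw [h3, Lam_leg_sq] at h2
      simpa [leg_one] using h2.symm
    rw [hRc, h1]; simp; ring
  · have : R = 0 := by
      apply eq_zero_of_orth (R.natDegree + 1) _ (by omega)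
      intro j hj
      apply hlow; omega
    rw [this]; simp

lemma eK_conv (k l : ℕ) (x z : S2) :
    ∫ y, eK k x y * eK l y z ∂sphereUniform = if k = l then eK l x z else 0 := by
  have h : ∀ y, eK k x y * eK l y z = ((2 * k + 1 : ℝ) * (2 * l + 1)) *
      ((legendreP k).eval (ip x y) * (legendreP l).eval (ip z y)) := by
    intro y; unfold eK; rw [ip_comm y z]; ring
  simp only [h]
  rw [integral_const_mul, conv_leg]
  split_ifs with h
  · subst h; unfold eK; field_simp
  · simp

/-- projection onto level `l` -/
def pr (l : ℕ) (f : S2 → ℝ) (x : S2) : ℝ := ∫ y, eK l x y * f y ∂sphereUniform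

def qf (l : ℕ) (f : S2 → ℝ) : ℝ := ∫ x, f x * pr l f x ∂sphereUniform

lemma continuous_op {K : S2 → S2 → ℝ} (hK : Continuous (fun p : S2 × S2 => K p.1 p.2)) :
    Continuous (fun x => ∫ y, K x y ∂sphereUniform) := by
  have := continuous_parametric_integral_of_continuous (μ := sphereUniform) (f := K) hK
    (s := Set.univ) isCompact_univ
  simpa using this

lemma continuous_pr (l : ℕ) {f : S2 → ℝ} (hf : Continuous f) : Continuous (pr l f) := by
  unfold pr
  exact continuous_op (K := fun x y => eK l x y * f y) (by fun_prop)

lemma pr_pr (k l : ℕ) {f : S2 → ℝ} (hf : Continuous f) (x : S2) :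
    pr k (pr l f) x = if k = l then pr l f x else 0 := by
  have h1 : ∀ y, eK k x y * pr l f y = ∫ z, eK k x y * eK l y z * f z ∂sphereUniform := by
    intro y; unfold pr; rw [← integral_const_mul]; congr 1; ext z; ring
  rw [pr]
  simp only [h1]
  rw [swap_cont (by fun_prop)]
  simp only [integral_mul_const, eK_conv]
  split_ifs with h
  · rfl
  · simp

lemma pr_adj (l : ℕ) {f g : S2 → ℝ} (hf : Continuous f) (hg : Continuous g) :
    ∫ x, f x * pr l g x ∂sphereUniform = ∫ x, pr l f x * g x ∂sphereUniform := by
  have h1 : ∀ x, f x * pr l g x = ∫ y, f x * eK l x y * g y ∂sphereUniform := by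
    intro y; unfold pr; rw [← integral_const_mul]; congr 1; ext z; ring
  have h2 : ∀ y, pr l f y * g y = ∫ x, f x * eK l x y * g y ∂sphereUniform := by
    intro y; unfold pr; rw [← integral_mul_const]; congr 1; ext z; rw [eK_comm]; ring
  simp only [h1, h2]
  exact swap_cont (by fun_prop)

lemma int_pr_pr (k l : ℕ) {f g : S2 → ℝ} (hf : Continuous f) (hg : Continuous g) :
    ∫ x, pr k f x * pr l g x ∂sphereUniform = if k = l then ∫ x, f x * pr l g x ∂sphereUniform else 0 := by
  rw [← pr_adj k hf (continuous_pr l hg)]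
  simp only [pr_pr k l hg]
  split_ifs <;> simp

lemma qf_eq (l : ℕ) {f : S2 → ℝ} (hf : Continuous f) : qf l f = ∫ x, pr l f x ^ 2 ∂sphereUniform := by
  have := int_pr_pr l l hf hf
  rw [if_pos rfl] at this
  rw [qf, ← this]; simp only [sq]

lemma qf_nonneg (l : ℕ) {f : S2 → ℝ} (hf : Continuous f) : 0 ≤ qf l f := by
  rw [qf_eq l hf]; exact integral_nonneg fun x => sq_nonneg _

lemma bessel (M : ℕ) {f : S2 → ℝ} (hf : Continuous f) :
    ∑ l ∈ Finset.range M, qf l f ≤ ∫ x, f x ^ 2 ∂sphereUniform := by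
  have hc : ∀ l, Continuous (pr l f) := fun l => continuous_pr l hf
  have h0 : 0 ≤ ∫ x, (f x - ∑ l ∈ Finset.range M, pr l f x) ^ 2 ∂sphereUniform :=
    integral_nonneg fun x => sq_nonneg _
  have h1 : ∀ x, (f x - ∑ l ∈ Finset.range M, pr l f x) ^ 2 =
    f x ^ 2 - 2 * (∑ l ∈ Finset.range M, f x * pr l f x) +
      ∑ k ∈ Finset.range M, ∑ l ∈ Finset.range M, pr k f x * pr l f x := by
    intro x
    rw [← Finset.sum_mul_sum, ← Finset.mul_sum]; ring
  simp only [h1] at h0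
  rw [integral_add (integrable_cont (by fun_prop)) (integrable_cont (by fun_prop)),
    integral_sub (integrable_cont (by fun_prop)) (integrable_cont (by fun_prop)),
    integral_const_mul, integral_finsetSum _ (fun i _ => integrable_cont (by fun_prop)),
    integral_finsetSum _ (fun i _ => integrable_cont (by fun_prop))] at h0
  have h2 : ∀ k ∈ Finset.range M, ∫ x, ∑ l ∈ Finset.range M, pr k f x * pr l f x ∂sphereUniform = qf k f := by
    intro k hk
    rw [integral_finsetSum _ (fun i _ => integrable_cont (by fun_prop))]
    simp only [int_pr_pr _ _ hf hf]
    rw [Finset.sum_ite_eq, if_pos hk]; rfl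
  rw [Finset.sum_congr rfl h2] at h0
  change 0 ≤ _ - 2 * ∑ l ∈ Finset.range M, qf l f + _ at h0
  linarith

/-- Berezin multipliers -/
def be (n l : ℕ) : ℝ := (n + 1) * II n l

def lam (l : ℕ) : ℝ := l * (l + 1)

lemma lam_nonneg (l : ℕ) : 0 ≤ lam l := by unfold lam; positivity
lemma two_le_lam {l : ℕ} (h : 1 ≤ l) : 2 ≤ lam l := by
  unfold lam
  have : (1 : ℝ) ≤ l := by exact_mod_cast h
  nlinarith

lemma be_nonneg (n l : ℕ) : 0 ≤ be n l := mul_nonneg (by positivity) (II_nonneg n l)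

lemma be_eq_zero {n l : ℕ} (h : n < l) : be n l = 0 := by rw [be, II_zero h, mul_zero]

lemma be_zero (n : ℕ) : be n 0 = 1 := by
  rw [be, II_eq (Nat.zero_le n)]
  simp only [Nat.sub_zero, add_zero, Nat.factorial_succ]
  have := Nat.factorial_pos n
  push_cast
  field_simp

lemma be_succ_l (n l : ℕ) : be n (l + 1) = be n l * ((n - l) / (n + l + 2)) := by
  rcases lt_trichotomy n l with h | h | h
  · rw [be_eq_zero h, be_eq_zero (by omega)]; simp
  · subst h; rw [be_eq_zero (by omega)]; simp
  · rw [be, be, II_eq h, II_eq h.le]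
    obtain ⟨d, rfl⟩ : ∃ d, n = l + 1 + d := ⟨n - (l + 1), by omega⟩
    rw [show l + 1 + d - (l + 1) = d by omega, show l + 1 + d - l = d + 1 by omega,
      show l + 1 + d + (l + 1) + 1 = (l + 1 + d + l + 1) + 1 by ring,
      Nat.factorial_succ (l + 1 + d + l + 1), Nat.factorial_succ d]
    have h1 := Nat.factorial_pos d
    have h2 := Nat.factorial_pos (l + 1 + d + l + 1)
    push_cast
    field_simp
    ring

lemma be_succ_n (n l : ℕ) : be n l = be (n + 1) l * (1 - lam l / ((n + 1) * (n + 2))) := by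
  unfold lam
  rcases lt_trichotomy (n + 1) l with h | h | h
  · rw [be_eq_zero h, be_eq_zero (by omega)]; simp
  · subst h; rw [be_eq_zero (by omega)]
    have : (1 : ℝ) - ((n + 1 : ℕ) : ℝ) * (((n + 1 : ℕ) : ℝ) + 1) / ((n + 1) * (n + 2)) = 0 := by
      push_cast; field_simp; ring
    rw [this]; simp
  · rw [be, be, II_eq (by omega), II_eq h.le]
    obtain ⟨d, rfl⟩ : ∃ d, n = l + d := ⟨n - l, by omega⟩
    rw [show l + d + 1 - l = d + 1 by omega, show l + d - l = d by omega,
      show l + d + 1 + l + 1 = (l + d + l + 1) + 1 by ring,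
      Nat.factorial_succ (l + d + l + 1), Nat.factorial_succ d, Nat.factorial_succ (l + d)]
    have h1 := Nat.factorial_pos d
    have h2 := Nat.factorial_pos (l + d + l + 1)
    have h3 := Nat.factorial_pos (l + d)
    push_cast
    field_simp
    ring

/-- `β ≤ N/(N+λ)` -/
lemma be_le (n l : ℕ) : be n l ≤ (n + 1) / (n + 1 + lam l) := by
  induction l with
  | zero => rw [be_zero, lam]; simp; rw [div_self (by positivity)]
  | succ l ih =>
    rcases le_or_gt n l with h | h
    · rw [be_eq_zero (by omega)]
      have := lam_nonneg (l + 1)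
      positivity
    · rw [be_succ_l]
      have hl : (0 : ℝ) ≤ n - l := by
        have : (l : ℝ) ≤ n := by exact_mod_cast h.le
        linarith
      have h0 := lam_nonneg l
      calc _ ≤ ((n : ℝ) + 1) / (n + 1 + lam l) * ((n - l) / (n + l + 2)) := by gcongr
        _ ≤ _ := by
          have e : lam (l + 1) = lam l + 2 * (l + 1) := by unfold lam; push_cast; ring
          rw [e, div_mul_div_comm, div_le_div_iff₀ (by positivity) (by positivity)]
          have hn : (0 : ℝ) ≤ n := by positivity
          have hl : (0 : ℝ) ≤ l := by positivity
          have hk : 0 ≤ (n + 1 : ℝ) * ((l + 1) * lam l + (l + 1) ^ 2) := by positivity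
          nlinarith

lemma be_le_one (n l : ℕ) : be n l ≤ 1 := by
  refine (be_le n l).trans ?_
  have := lam_nonneg l
  rw [div_le_one (by positivity)]; linarith

lemma one_sub_be_le (n l : ℕ) : 1 - be n l ≤ lam l / (n + 2) := by
  induction l with
  | zero => rw [be_zero]; simp [lam]
  | succ l ih =>
    rcases le_or_gt n l with h | h
    · rw [be_eq_zero (by omega)]
      rw [le_div_iff₀ (by positivity)]
      have : (n : ℝ) ≤ l := by exact_mod_cast h
      unfold lam
      push_cast
      nlinarith
    · rw [be_succ_l]
      have e : lam (l + 1) = lam l + 2 * (l + 1) := by unfold lam; push_cast; ring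
      have h1 := be_le_one n l
      have h0 := be_nonneg n l
      have e2 : ((n : ℝ) - l) / (n + l + 2) = 1 - 2 * (l + 1) / (n + l + 2) := by
        field_simp; ring
      have h3 : 2 * ((l : ℝ) + 1) / (n + l + 2) ≤ 2 * (l + 1) / (n + 2) := by
        gcongr; linarith [(Nat.cast_nonneg l : (0 : ℝ) ≤ l)]
      have h4 : 0 ≤ 2 * ((l : ℝ) + 1) / (n + l + 2) := by positivity
      rw [e2, e, add_div]
      nlinarith

lemma tel1 (K l : ℕ) (hl : 1 ≤ l) : ∑ n ∈ Finset.range K, II (n + 1) l / (n + 1) = be K l / lam l := by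
  have h2 := two_le_lam hl
  induction K with
  | zero => rw [be_eq_zero (by omega)]; simp
  | succ K ih =>
    rw [Finset.sum_range_succ, ih, be_succ_n K l]
    have : II (K + 1) l = be (K + 1) l / (K + 2) := by
      rw [be]; push_cast; field_simp; ring
    rw [this]
    field_simp
    ring

lemma tel2 (K l : ℕ) (hl : 1 ≤ l) : ∑ n ∈ Finset.range K, II (n + 1) l / (n + 1) ^ 2 =
    be K l * (1 / lam l ^ 2 + 1 / (lam l * (K + 1))) := by
  have h2 := two_le_lam hl
  induction K with
  | zero => rw [be_eq_zero (by omega)]; simp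
  | succ K ih =>
    rw [Finset.sum_range_succ, ih, be_succ_n K l]
    have : II (K + 1) l = be (K + 1) l / (K + 2) := by
      rw [be]; push_cast; field_simp; ring
    rw [this]
    push_cast
    field_simp
    ring

lemma tel2_le (K l : ℕ) (hl : 1 ≤ l) : ∑ n ∈ Finset.range K, II (n + 1) l / (n + 1) ^ 2 ≤
    1 / lam l ^ 2 := by
  rw [tel2 K l hl]
  have h2 := two_le_lam hl
  have h1 := be_le K l
  calc _ ≤ ((K : ℝ) + 1) / (K + 1 + lam l) * (1 / lam l ^ 2 + 1 / (lam l * (K + 1))) := by gcongr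
    _ = _ := by field_simp

lemma tel2_ge (K l : ℕ) (hl : 1 ≤ l) : be K l / lam l ^ 2 ≤
    ∑ n ∈ Finset.range K, II (n + 1) l / (n + 1) ^ 2 := by
  rw [tel2 K l hl, mul_add]
  have h2 := two_le_lam hl
  have := be_nonneg K l
  have : 0 ≤ be K l * (1 / (lam l * (K + 1))) := by positivity
  rw [mul_one_div]; linarith

lemma tel2_le_tel1 (K l : ℕ) (hl : 1 ≤ l) : ∑ n ∈ Finset.range K, II (n + 1) l / (n + 1) ^ 2 ≤
    (1 / 2 + 1 / (K + 1)) * ∑ n ∈ Finset.range K, II (n + 1) l / (n + 1) := by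
  rw [tel2 K l hl, tel1 K l hl]
  have h2 := two_le_lam hl
  have h0 := be_nonneg K l
  have : 1 / lam l ^ 2 ≤ 1 / 2 * (1 / lam l) := by
    rw [sq, ← one_div_mul_one_div]
    gcongr
  have e : (1 / 2 + 1 / ((K : ℝ) + 1)) * (be K l / lam l) =
    be K l * (1 / 2 * (1 / lam l) + 1 / (lam l * (K + 1))) := by field_simp
  rw [e]
  gcongr

end SE
end

open MeasureTheory Real Metric
open scoped ENNReal RealInnerProductSpace Manifold

noncomputable section
namespace SE

/-- Berezin transform of level `n` -/
def bz (n : ℕ) (f : S2 → ℝ) (x : S2) : ℝ := ∫ y, ((n + 1) * vv x y ^ n) * f y ∂sphereUniform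

lemma bz_eq (n : ℕ) {f : S2 → ℝ} (hf : Continuous f) (x : S2) :
    bz n f x = ∑ l ∈ Finset.range (n + 1), be n l * pr l f x := by
  unfold bz pr
  simp only [vv_pow_eq, Finset.mul_sum, Finset.sum_mul]
  rw [integral_finsetSum _ (fun i _ => integrable_cont (by fun_prop))]
  refine Finset.sum_congr rfl fun l _ => ?_
  rw [← integral_const_mul]
  congr 1; ext y; unfold be; ring

lemma bz_eq' (n L : ℕ) (hL : n ≤ L) {f : S2 → ℝ} (hf : Continuous f) (x : S2) :
    bz n f x = ∑ l ∈ Finset.range (L + 1), be n l * pr l f x := by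
  rw [bz_eq n hf]
  apply Finset.sum_subset
  · intro i hi; simp at *; omega
  · intro i hi hi2
    rw [be_eq_zero (by simpa using hi2), zero_mul]

lemma continuous_bz (n : ℕ) {f : S2 → ℝ} (hf : Continuous f) : Continuous (bz n f) := by
  unfold bz
  exact continuous_op (K := fun x y => ((n + 1) * vv x y ^ n) * f y) (by fun_prop)

lemma int_vv (n : ℕ) (x : S2) : ∫ y, vv x y ^ n ∂sphereUniform = 1 / (n + 1) := by
  have := integral_ip_poly x (pV ^ n)
  rw [Lam_pV] at this
  rw [← this]
  simp [pV_eval, vv]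

lemma bz_one (n : ℕ) (x : S2) : ∫ y, ((n + 1) * vv x y ^ n) ∂sphereUniform = 1 := by
  rw [integral_const_mul, int_vv]; field_simp

lemma pr_zero (f : S2 → ℝ) (x : S2) : pr 0 f x = ∫ y, f y ∂sphereUniform := by
  simp [pr, eK_zero]

lemma pr_bz (n l : ℕ) {f : S2 → ℝ} (hf : Continuous f) (x : S2) : pr l (bz n f) x = be n l * pr l f x := by
  have hc : ∀ l, Continuous (pr l f) := fun l => continuous_pr l hf
  have h : bz n f = fun x => ∑ k ∈ Finset.range ((max n l) + 1), be n k * pr k f x := by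
    ext x; exact bz_eq' n _ (le_max_left _ _) hf x
  rw [h]
  unfold pr
  simp only [Finset.mul_sum]
  rw [integral_finsetSum _ (fun i _ => integrable_cont (by
    have := hc i; unfold pr at this; fun_prop))]
  have h2 : ∀ k ∈ Finset.range (max n l + 1), ∫ y, eK l x y * (be n k * ∫ z, eK k y z * f z ∂sphereUniform) ∂sphereUniform
     = if k = l then be n k * pr k f x else 0 := by
    intro k _
    have h3 := pr_pr l k hf x
    rw [pr] at h3
    have : ∀ y, eK l x y * (be n k * ∫ z, eK k y z * f z ∂sphereUniform) = be n k * (eK l x y * pr k f y) := by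
      intro y; unfold pr; ring
    simp only [this]
    rw [integral_const_mul, h3]
    by_cases hkl : k = l
    · simp [hkl]
    · rw [if_neg hkl, if_neg (Ne.symm hkl), mul_zero]
  rw [Finset.sum_congr rfl h2, Finset.sum_ite_eq', if_pos]
  · rfl
  · simp

lemma qf_sub_bz (n l : ℕ) {f : S2 → ℝ} (hf : Continuous f) :
    qf l (fun x => f x - bz n f x) = (1 - be n l) ^ 2 * qf l f := by
  have hb := continuous_bz n hf
  rw [qf_eq l (by fun_prop), qf_eq l hf, ← integral_const_mul]
  congr 1; ext x
  have : pr l (fun x => f x - bz n f x) x = pr l f x - pr l (bz n f) x := by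
    unfold pr
    rw [← integral_sub (integrable_cont (by fun_prop)) (integrable_cont (by fun_prop))]
    congr 1; ext y; ring
  rw [this, pr_bz n l hf]; ring

variable {N : ℕ}

def UU (n : ℕ) (x : Fin N → S2) : ℝ := ∑ i, ∑ j, (vv (x i) (x j) ^ n - 1 / (n + 1))

def VV (l : ℕ) (x : Fin N → S2) : ℝ := ∑ i, ∑ j, eK l (x i) (x j)

lemma VV_eq (l : ℕ) (x : Fin N → S2) : VV l x = ∫ y, (∑ i, eK l (x i) y) ^ 2 ∂sphereUniform := by
  have : ∀ y, (∑ i, eK l (x i) y) ^ 2 = ∑ i, ∑ j, eK l (x i) y * eK l y (x j) := by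
    intro y
    rw [sq, Finset.sum_mul_sum]
    refine Finset.sum_congr rfl fun i _ => Finset.sum_congr rfl fun j _ => ?_
    rw [eK_comm l y]
  simp only [this]
  rw [integral_finsetSum _ (fun i _ => integrable_cont (by fun_prop))]
  unfold VV
  refine Finset.sum_congr rfl fun i _ => ?_
  rw [integral_finsetSum _ (fun i _ => integrable_cont (by fun_prop))]
  refine Finset.sum_congr rfl fun j _ => ?_
  rw [eK_conv, if_pos rfl]

lemma VV_nonneg (l : ℕ) (x : Fin N → S2) : 0 ≤ VV l x := by
  rw [VV_eq]; exact integral_nonneg fun _ => sq_nonneg _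

lemma II_zero_right (n : ℕ) : II n 0 = 1 / (n + 1) := by
  have := be_zero n
  unfold be at this
  field_simp; linarith

lemma UU_eq (n L : ℕ) (hL : n ≤ L) (x : Fin N → S2) :
    UU n x = ∑ l ∈ Finset.range L, II n (l + 1) * VV (l + 1) x := by
  have h : ∀ a b : S2, vv a b ^ n - 1 / (n + 1) = ∑ l ∈ Finset.range L, II n (l + 1) * eK (l + 1) a b := by
    intro a b
    rw [vv_pow_eq]
    have : ∑ l ∈ Finset.range (n + 1), II n l * eK l a b = ∑ l ∈ Finset.range (L + 1), II n l * eK l a b := by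
      apply Finset.sum_subset
      · intro i hi; simp at *; omega
      · intro i hi hi2
        rw [II_zero (by simpa using hi2), zero_mul]
    rw [this, Finset.sum_range_succ', II_zero_right, eK_zero]; ring
  unfold UU VV
  simp only [h]
  simp only [Finset.mul_sum]
  have h2 : ∀ i, ∑ j, ∑ l ∈ Finset.range L, II n (l + 1) * eK (l + 1) (x i) (x j)
    = ∑ l ∈ Finset.range L, ∑ j, II n (l + 1) * eK (l + 1) (x i) (x j) := fun i => Finset.sum_comm
  simp only [h2]
  rw [Finset.sum_comm]

lemma UU_nonneg (n : ℕ) (x : Fin N → S2) : 0 ≤ UU n x := by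
  rw [UU_eq n n le_rfl]
  exact Finset.sum_nonneg fun l _ => mul_nonneg (II_nonneg _ _) (VV_nonneg _ _)

/-- weighted sums -/
def W2 (K : ℕ) (x : Fin N → S2) : ℝ := ∑ n ∈ Finset.range K, UU (n + 1) x / (n + 1) ^ 2
def W1 (K : ℕ) (x : Fin N → S2) : ℝ := ∑ n ∈ Finset.range K, UU (n + 1) x / (n + 1)

lemma W2_eq (K : ℕ) (x : Fin N → S2) : W2 K x = ∑ l ∈ Finset.range K,
    (∑ n ∈ Finset.range K, II (n + 1) (l + 1) / (n + 1) ^ 2) * VV (l + 1) x := by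
  unfold W2
  have : ∀ n ∈ Finset.range K, UU (n + 1) x / ((n : ℝ) + 1) ^ 2 = ∑ l ∈ Finset.range K, II (n + 1) (l + 1) / (n + 1) ^ 2 * VV (l + 1) x := by
    intro n hn
    rw [UU_eq (n + 1) K (by simpa using hn), Finset.sum_div]
    refine Finset.sum_congr rfl fun l _ => by ring
  rw [Finset.sum_congr rfl this, Finset.sum_comm]
  simp only [Finset.sum_mul]

lemma W1_eq (K : ℕ) (x : Fin N → S2) : W1 K x = ∑ l ∈ Finset.range K,
    (∑ n ∈ Finset.range K, II (n + 1) (l + 1) / (n + 1)) * VV (l + 1) x := by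
  unfold W1
  have : ∀ n ∈ Finset.range K, UU (n + 1) x / ((n : ℝ) + 1) = ∑ l ∈ Finset.range K, II (n + 1) (l + 1) / (n + 1) * VV (l + 1) x := by
    intro n hn
    rw [UU_eq (n + 1) K (by simpa using hn), Finset.sum_div]
    refine Finset.sum_congr rfl fun l _ => by ring
  rw [Finset.sum_congr rfl this, Finset.sum_comm]
  simp only [Finset.sum_mul]

lemma W2_le_W1 (K : ℕ) (x : Fin N → S2) : W2 K x ≤ (1 / 2 + 1 / (K + 1)) * W1 K x := by
  rw [W2_eq, W1_eq, Finset.mul_sum]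
  refine Finset.sum_le_sum fun l _ => ?_
  rw [← mul_assoc]
  exact mul_le_mul_of_nonneg_right (tel2_le_tel1 K (l + 1) (by omega)) (VV_nonneg _ _)

lemma sum_pr_sq_le (l : ℕ) {f : S2 → ℝ} (hf : Continuous f) (x : Fin N → S2) :
    (∑ i, pr l f (x i)) ^ 2 ≤ VV l x * qf l f := by
  have hc := continuous_pr l hf
  have h1 : ∑ i, pr l f (x i) = ∫ y, (∑ i, eK l (x i) y) * pr l f y ∂sphereUniform := by
    simp only [Finset.sum_mul]
    rw [integral_finsetSum _ (fun i _ => integrable_cont (by fun_prop))]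
    refine Finset.sum_congr rfl fun i _ => ?_
    have := pr_pr l l hf (x i)
    rw [if_pos rfl] at this
    rw [← this]; rfl
  rw [h1, VV_eq, qf_eq l hf]
  -- Cauchy-Schwarz through the discriminant
  set g : S2 → ℝ := fun y => ∑ i, eK l (x i) y with hg
  have hgc : Continuous g := by rw [hg]; fun_prop
  set A := ∫ y, g y ^ 2 ∂sphereUniform
  set B := ∫ y, g y * pr l f y ∂sphereUniform
  set D := ∫ y, pr l f y ^ 2 ∂sphereUniform
  have hq : ∀ t : ℝ, 0 ≤ A * (t * t) + 2 * B * t + D := by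
    intro t
    have h : 0 ≤ ∫ y, (t * g y + pr l f y) ^ 2 ∂sphereUniform := integral_nonneg fun _ => sq_nonneg _
    have e : ∀ y, (t * g y + pr l f y) ^ 2 = (t * t) * g y ^ 2 + (2 * t) * (g y * pr l f y) + pr l f y ^ 2 := by
      intro y; ring
    simp only [e] at h
    rw [integral_add (integrable_cont (by fun_prop)) (integrable_cont (by fun_prop)),
      integral_add (integrable_cont (by fun_prop)) (integrable_cont (by fun_prop)),
      integral_const_mul, integral_const_mul] at h
    linarith
  have := discrim_le_zero hq
  unfold discrim at this
  nlinarith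

lemma dual_bound (K : ℕ) {f : S2 → ℝ} (hf : Continuous f) (x : Fin N → S2) :
    (∑ i, bz K f (x i) - N * ∫ y, f y ∂sphereUniform) ^ 2 ≤
      (∑ l ∈ Finset.range K, lam (l + 1) ^ 2 * qf (l + 1) f) * W2 K x := by
  have h1 : ∑ i, bz K f (x i) - N * ∫ y, f y ∂sphereUniform =
      ∑ l ∈ Finset.range K, be K (l + 1) * ∑ i, pr (l + 1) f (x i) := by
    simp only [bz_eq K hf]
    simp only [Finset.sum_range_succ', be_zero, pr_zero, one_mul, Finset.sum_add_distrib]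
    simp only [Finset.sum_const, Finset.card_univ, Fintype.card_fin, nsmul_eq_mul, add_sub_cancel_right]
    rw [Finset.sum_comm]
    simp only [Finset.mul_sum]
  rw [h1, W2_eq]
  refine Finset.sum_sq_le_sum_mul_sum_of_sq_le_mul _ ?_ ?_ ?_
  · intro l _; exact mul_nonneg (sq_nonneg _) (qf_nonneg _ hf)
  · intro l _
    exact mul_nonneg (Finset.sum_nonneg fun n _ => div_nonneg (II_nonneg _ _) (by positivity)) (VV_nonneg _ _)
  · intro l _
    have h2 := sum_pr_sq_le (l + 1) hf x
    have h3 := tel2_ge K (l + 1) (by omega)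
    have h4 := two_le_lam (l := l + 1) (by omega)
    have hb0 := be_nonneg K (l + 1)
    have hb1 := be_le_one K (l + 1)
    have hv := VV_nonneg (l + 1) x
    have hq := qf_nonneg (l + 1) hf
    calc (be K (l + 1) * ∑ i, pr (l + 1) f (x i)) ^ 2 = be K (l + 1) ^ 2 * (∑ i, pr (l + 1) f (x i)) ^ 2 := by ring
      _ ≤ be K (l + 1) * (VV (l + 1) x * qf (l + 1) f) := by
        apply mul_le_mul _ h2 (sq_nonneg _) hb0
        nlinarith
      _ = lam (l + 1) ^ 2 * qf (l + 1) f * (be K (l + 1) / lam (l + 1) ^ 2 * VV (l + 1) x) := by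
        field_simp
      _ ≤ _ := by gcongr

end SE
end

open MeasureTheory Real Metric
open scoped ENNReal RealInnerProductSpace Manifold ContDiff

noncomputable section
namespace SE

/-- normalization onto the sphere -/
def nrm (z : E3) : S2 := if h : z = 0 then north else ⟨(‖z‖)⁻¹ • z, by
  rw [mem_sphere_zero_iff_norm, norm_smul, norm_inv, norm_norm, inv_mul_cancel₀ (norm_ne_zero_iff.2 h)]⟩

lemma nrm_smul_S2 (x : S2) {t : ℝ} (ht : 0 < t) : nrm (t • (x : E3)) = x := by
  have h : t • (x : E3) ≠ 0 := by
    rw [Ne, smul_eq_zero]; push Not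
    exact ⟨ht.ne', by rw [← norm_ne_zero_iff, norm_S2]; norm_num⟩
  rw [nrm, dif_neg h]
  ext1
  simp only [norm_smul, norm_S2, smul_smul, mul_one, norm_eq_abs, abs_of_pos ht]
  rw [inv_mul_cancel₀ ht.ne', one_smul]

lemma nrm_smul (z : E3) {t : ℝ} (ht : 0 < t) : nrm (t • z) = nrm z := by
  by_cases h : z = 0
  · simp [h]
  · have h2 : t • z ≠ 0 := by simp [ht.ne', h]
    rw [nrm, nrm, dif_neg h, dif_neg h2]
    ext1
    simp only [norm_smul, norm_eq_abs, abs_of_pos ht, smul_smul, mul_inv]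
    congr 1
    field_simp

lemma contDiffAt_nrm {f : S2 → ℝ} (hf : SmoothOnSphere f) {z0 : E3} (hz : z0 ≠ 0) :
    ContDiffAt ℝ 2 (fun z => f (nrm z)) z0 := by
  have hp : 0 < ‖z0‖ := norm_pos_iff.2 hz
  let χ : ContDiffBump z0 := ⟨‖z0‖ / 4, ‖z0‖ / 2, by positivity, by linarith⟩
  let w : E3 → E3 := fun z => z0 + χ z • (z - z0)
  have hw0 : ∀ z, w z ≠ 0 := by
    intro z hzz
    have h1 : ‖w z - z0‖ ≤ ‖z0‖ / 2 := by
      simp only [w, add_sub_cancel_left, norm_smul, norm_eq_abs, abs_of_nonneg χ.nonneg]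
      by_cases h : dist z z0 < ‖z0‖ / 2
      · rw [dist_eq_norm] at h
        calc χ z * ‖z - z0‖ ≤ 1 * ‖z - z0‖ := by
              gcongr; exact χ.le_one
          _ ≤ _ := by linarith
      · rw [χ.zero_of_le_dist (by simpa [χ] using h)]; simp; positivity
    rw [hzz] at h1
    simp at h1
    linarith
  have hwc : ContDiff ℝ ∞ w := by
    have : ContDiff ℝ ∞ (χ : E3 → ℝ) := χ.contDiff
    fun_prop
  have hn : ContDiff ℝ ∞ (fun z => (‖w z‖)⁻¹ • w z) := by
    exact ((hwc.norm ℝ hw0).inv (fun z => norm_ne_zero_iff.2 (hw0 z))).smul hwc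
  have hm : ∀ z, (‖w z‖)⁻¹ • w z ∈ sphere (0 : E3) 1 := by
    intro z
    rw [mem_sphere_zero_iff_norm, norm_smul, norm_inv, norm_norm, inv_mul_cancel₀ (norm_ne_zero_iff.2 (hw0 z))]
  have h3 := ContMDiff.codRestrict_sphere (n := 2) hn.contMDiff hm
  have h4 : ContMDiff 𝓘(ℝ, E3) 𝓘(ℝ, ℝ) ∞ (f ∘ Set.codRestrict _ _ hm) := ContMDiff.comp hf h3
  have h5 : ContDiff ℝ ∞ (f ∘ Set.codRestrict _ _ hm) := h4.contDiff
  refine ((h5.of_le (m := 2) (by norm_cast)).contDiffAt).congr_of_eventuallyEq ?_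
  have : ball z0 (‖z0‖ / 4) ∈ nhds z0 := ball_mem_nhds _ (by positivity)
  filter_upwards [this] with z hz
  have : χ z = 1 := χ.one_of_mem_closedBall (by simpa [χ] using (mem_ball.1 hz).le)
  have hwz : w z = z := by simp [w, this]
  simp only [Function.comp]
  congr 1
  have hz0 : z ≠ 0 := by rw [← hwz]; exact hw0 z
  rw [nrm, dif_neg hz0]
  ext1
  simp [hwz]

lemma bdd_help {X : Type*} (E : Type*) [TopologicalSpace X] [NormedAddCommGroup E] {g : X → E}
    {S : Set X} (hS : IsCompact S) (hg : ContinuousOn g S) : ∃ C, ∀ z ∈ S, ‖g z‖ ≤ C :=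
  hS.exists_bound_of_continuousOn hg

lemma taylor_gen {V : Type*} [NormedAddCommGroup V] [InnerProductSpace ℝ V] [ProperSpace V]
    (F : V → ℝ) (hFF : ∀ z ≠ 0, ContDiffAt ℝ 2 F z) : ∃ C : ℝ, 0 ≤ C ∧ ∀ (x u : V), ‖x‖ = 1 → 
    inner ℝ x u = 0 → ‖u‖ ≤ 2 →
    |F (x + u) + F (x - u) - 2 * F x| ≤ C * ‖u‖ ^ 2 := by
  have hU : IsOpen {z : V | z ≠ 0} := isOpen_ne
  have hc : ContDiffOn ℝ 2 F {z : V | z ≠ 0} := fun z hz => (hFF z hz).contDiffWithinAt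
  have hc1 : ContDiffOn ℝ 1 (fderiv ℝ F) {z : V | z ≠ 0} :=
    hc.fderiv_of_isOpen hU (by norm_num)
  have hc2 : ContDiffOn ℝ 0 (fderiv ℝ (fderiv ℝ F)) {z : V | z ≠ 0} :=
    hc1.fderiv_of_isOpen hU (by norm_num)
  let S : Set V := closedBall 0 3 \ ball 0 1
  have hS : IsCompact S := (isCompact_closedBall _ _).diff isOpen_ball
  have hS0 : S ⊆ {z : V | z ≠ 0} := by
    rintro z ⟨_, hz⟩ h0
    exact hz (by simp [h0])
  obtain ⟨C, hC⟩ := bdd_help (V →L[ℝ] V →L[ℝ] ℝ) hS (hc2.continuousOn.mono hS0)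
  have hC0 : 0 ≤ max C 0 := le_max_right _ _
  refine ⟨2 * max C 0, by positivity, fun x u hx1 hxu hu => ?_⟩
  have key : ∀ u : V, inner ℝ x u = 0 → ‖u‖ ≤ 2 →
      ‖F (x + u) - F x - fderiv ℝ F x u‖ ≤ max C 0 * ‖u‖ ^ 2 := by
    intro u hxu hu
    have hseg : segment ℝ x (x + u) ⊆ S := by
      intro z hz
      rw [segment_eq_image'] at hz
      obtain ⟨t, ht, rfl⟩ := hz
      have h1 : ‖x + t • u‖ ^ 2 = 1 + t ^ 2 * ‖u‖ ^ 2 := by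
        rw [norm_add_sq_real, hx1, inner_smul_right, hxu, norm_smul, mul_pow, norm_eq_abs, sq_abs]
        ring
      simp only [add_sub_cancel_left, S, Set.mem_sdiff, mem_closedBall, mem_ball, dist_zero_right, not_lt]
      constructor
      · have h2 := norm_add_le x (t • u)
        rw [hx1, norm_smul, norm_eq_abs, abs_of_nonneg ht.1] at h2
        have : t * ‖u‖ ≤ 1 * 2 := mul_le_mul ht.2 hu (norm_nonneg _) zero_le_one
        linarith
      · have : 1 ≤ ‖x + t • u‖ ^ 2 := by rw [h1]; nlinarith [mul_nonneg (sq_nonneg t) (sq_nonneg ‖u‖)]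
        nlinarith [norm_nonneg (x + t • u)]
    have hd1 : ∀ z ∈ segment ℝ x (x + u), DifferentiableAt ℝ F z := fun z hz =>
      ((hc.contDiffAt (hU.mem_nhds (hS0 (hseg hz)))).differentiableAt (by norm_num))
    have hd2 : ∀ z ∈ segment ℝ x (x + u), DifferentiableAt ℝ (fderiv ℝ F) z := fun z hz =>
      ((hc1.contDiffAt (hU.mem_nhds (hS0 (hseg hz)))).differentiableAt (by norm_num))
    have hx : x ∈ segment ℝ x (x + u) := left_mem_segment _ _ _
    have hb : ∀ z ∈ segment ℝ x (x + u), ‖fderiv ℝ F z - fderiv ℝ F x‖ ≤ max C 0 * ‖u‖ := by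
      intro z hz
      have h1 := Convex.norm_image_sub_le_of_norm_fderiv_le (𝕜 := ℝ) (f := fderiv ℝ F) (C := max C 0)
        hd2 (fun z hz => (hC z (hseg hz)).trans (le_max_left _ _)) (convex_segment _ _) hx hz
      refine h1.trans ?_
      gcongr
      have hz' := hz
      rw [segment_eq_image'] at hz'
      obtain ⟨t, ht, rfl⟩ := hz'
      simp only [add_sub_cancel_left, norm_smul, norm_eq_abs, abs_of_nonneg ht.1]
      nlinarith [norm_nonneg u, ht.2]
    have h2 := Convex.norm_image_sub_le_of_norm_fderiv_le' (𝕜 := ℝ) (f := F) (φ := fderiv ℝ F x)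
      hd1 hb (convex_segment _ _) hx (right_mem_segment _ _ _)
    simp only [add_sub_cancel_left] at h2
    refine h2.trans (le_of_eq (by ring))
  have k1 := key u hxu hu
  have k2 := key (-u) (by simp [hxu]) (by simpa using hu)
  rw [map_neg, norm_neg, ← sub_eq_add_neg] at k2
  have h3 := norm_add_le (F (x + u) - F x - fderiv ℝ F x u) (F (x - u) - F x - -fderiv ℝ F x u)
  rw [show (F (x + u) - F x - fderiv ℝ F x u) + (F (x - u) - F x - -fderiv ℝ F x u) =
    F (x + u) + F (x - u) - 2 * F x by ring] at h3
  rw [Real.norm_eq_abs] at h3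
  linarith

lemma taylor_nrm {f : S2 → ℝ} (hf : SmoothOnSphere f) : ∃ C : ℝ, 0 ≤ C ∧ ∀ (x : S2) (u : E3),
    inner ℝ (x : E3) u = 0 → ‖u‖ ≤ 2 →
    |f (nrm (x + u)) + f (nrm (x - u)) - 2 * f (nrm x)| ≤ C * ‖u‖ ^ 2 := by
  obtain ⟨C, h0, h⟩ := taylor_gen (fun z => f (nrm z)) (fun z hz => contDiffAt_nrm hf hz)
  exact ⟨C, h0, fun x u => h x u (norm_S2 x)⟩

lemma SmoothOnSphere.cont {f : S2 → ℝ} (hf : SmoothOnSphere f) : Continuous f :=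
  ContMDiff.continuous hf

/-- point reflection through the axis of `x` -/
def rfl' (x : S2) : E3 ≃ₗᵢ[ℝ] E3 := (ℝ ∙ (x : E3)).reflection

lemma rfl'_apply (x : S2) (y : E3) : rfl' x y = (2 * inner ℝ (x : E3) y) • (x : E3) - y := by
  rw [rfl', Submodule.reflection_apply, Submodule.starProjection_unit_singleton ℝ (norm_S2 x)]
  rw [two_smul, mul_smul, two_smul]

lemma sym_bound {f : S2 → ℝ} (hf : SmoothOnSphere f) : ∃ C : ℝ, 0 ≤ C ∧ ∀ x y : S2,
    |f y + f (act (rfl' x) y) - 2 * f x| ≤ C * (1 - vv x y) := by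
  obtain ⟨C, hC0, hC⟩ := taylor_nrm hf
  obtain ⟨M, hM⟩ := isCompact_univ.exists_bound_of_continuousOn (SmoothOnSphere.cont hf).continuousOn
  have hM : ∀ x, |f x| ≤ M := fun x => hM x trivial
  have hM0 : 0 ≤ M := (abs_nonneg _).trans (hM north)
  refine ⟨16 * C + 16 * M, by positivity, fun x y => ?_⟩
  have hv := vv_le_one x y
  by_cases ht : ip x y < 1 / 2
  · have h1 : 1 / 4 ≤ 1 - vv x y := by unfold vv; linarith
    have a1 := abs_le.1 (hM y)
    have a2 := abs_le.1 (hM (act (rfl' x) y))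
    have a3 := abs_le.1 (hM x)
    rw [abs_le]
    constructor <;> nlinarith
  · push Not at ht
    set t := ip x y with htd
    have ht0 : 0 < t := by linarith
    have ht1 : t ≤ 1 := (abs_le.1 (abs_ip_le x y)).2
    set u : E3 := t⁻¹ • (y : E3) - x with hu
    have hxu : inner ℝ (x : E3) u = 0 := by
      rw [hu, inner_sub_right, inner_smul_right, real_inner_self_eq_norm_sq, norm_S2]
      change t⁻¹ * ip x y - 1 ^ 2 = 0
      rw [← htd]; field_simp; norm_num
    have hun : ‖u‖ ^ 2 = 1 / t ^ 2 - 1 := by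
      rw [hu, norm_sub_sq_real, norm_smul, norm_S2, norm_S2, inner_smul_left, norm_eq_abs, mul_pow, sq_abs, real_inner_comm]
      change t⁻¹ ^ 2 * 1 ^ 2 - 2 * (t⁻¹ * ip x y) + 1 ^ 2 = _
      rw [← htd]; field_simp; ring
    have hun2 : ‖u‖ ^ 2 ≤ 16 * (1 - vv x y) := by
      rw [hun, vv, ← htd]
      rw [div_sub_one (by positivity), div_le_iff₀ (by positivity)]
      nlinarith [mul_nonneg (sub_nonneg.2 ht1) (sub_nonneg.2 ht), mul_nonneg (sub_nonneg.2 ht1) (sq_nonneg (t - 1/2))]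
    have hun3 : ‖u‖ ≤ 2 := by
      have : 1 - vv x y ≤ 1 / 4 := by rw [vv, ← htd]; linarith
      nlinarith [norm_nonneg u]
    have := hC x u hxu hun3
    have e1 : nrm (x + u) = y := by
      rw [hu, add_sub_cancel, nrm_smul_S2 _ (inv_pos.2 ht0)]
    have e2 : nrm (x - u) = act (rfl' x) y := by
      have : (x : E3) - u = t⁻¹ • (act (rfl' x) y : E3) := by
        simp only [act, rfl'_apply]
        change _ = t⁻¹ • ((2 * ip x y) • (x : E3) - y)
        rw [← htd, hu, smul_sub, smul_smul]
        rw [show t⁻¹ * (2 * t) = 2 by field_simp, two_smul]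
        abel
      rw [this, nrm_smul_S2 _ (inv_pos.2 ht0)]
    have e3 : nrm (x : E3) = x := by
      have := nrm_smul_S2 x one_pos
      rwa [one_smul] at this
    rw [e1, e2, e3] at this
    refine this.trans ?_
    have := mul_le_mul_of_nonneg_left hun2 hC0
    nlinarith

lemma vv_rfl' (x y : S2) : vv x (act (rfl' x) y) = vv x y := by
  have : act (rfl' x) x = x := by
    ext1
    simp only [act, rfl'_apply, real_inner_self_eq_norm_sq, norm_S2]
    rw [one_pow, mul_one, two_smul, add_sub_cancel_right]
  unfold vv
  conv_lhs => rw [← this]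
  rw [this, ← ip_act (rfl' x) x y, this]

lemma bz_sub_bound {f : S2 → ℝ} (hf : SmoothOnSphere f) : ∃ C : ℝ, 0 ≤ C ∧ ∀ (n : ℕ) (x : S2),
    |f x - bz n f x| ≤ C / (n + 1) := by
  obtain ⟨C, hC0, hC⟩ := sym_bound hf
  have hfc := SmoothOnSphere.cont hf
  refine ⟨C, hC0, fun n x => ?_⟩
  have hca := continuous_act (rfl' x)
  have h1 : bz n f x = ∫ y, ((n + 1) * vv x y ^ n) * f (act (rfl' x) y) ∂sphereUniform := by
    unfold bz
    rw [← integral_act (rfl' x)]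
    simp only [vv_rfl']
  have h2 : 2 * (bz n f x - f x) = ∫ y, ((n + 1) * vv x y ^ n) * (f y + f (act (rfl' x) y) - 2 * f x) ∂sphereUniform := by
    have : ∀ y, ((n + 1) * vv x y ^ n) * (f y + f (act (rfl' x) y) - 2 * f x) =
      (((n + 1) * vv x y ^ n) * f y + ((n + 1) * vv x y ^ n) * f (act (rfl' x) y)) - 2 * f x * ((n + 1) * vv x y ^ n) := by
      intro y; ring
    simp only [this]
    rw [integral_sub (integrable_cont (by fun_prop)) (integrable_cont (by fun_prop)),
      integral_add (integrable_cont (by fun_prop)) (integrable_cont (by fun_prop)), integral_const_mul (2 * f x), bz_one, ← h1]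
    unfold bz; ring
  have h3 : |2 * (bz n f x - f x)| ≤ ∫ y, C * (((n + 1) * vv x y ^ n) * (1 - vv x y)) ∂sphereUniform := by
    rw [h2, ← norm_eq_abs]
    apply norm_integral_le_of_norm_le (integrable_cont (by fun_prop))
    refine Filter.Eventually.of_forall fun y => ?_
    have hp : 0 ≤ (n + 1) * vv x y ^ n := mul_nonneg (by positivity) (pow_nonneg (vv_nonneg _ _) _)
    rw [norm_mul, norm_of_nonneg hp, norm_eq_abs]
    have := mul_le_mul_of_nonneg_left (hC x y) hp
    linarith
  have h4 : ∫ y, C * (((n + 1) * vv x y ^ n) * (1 - vv x y)) ∂sphereUniform = C * (1 / (n + 2)) := by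
    rw [integral_const_mul]
    congr 1
    have : ∀ y, ((n + 1) * vv x y ^ n) * (1 - vv x y) = (n + 1) * vv x y ^ n - (n + 1) * vv x y ^ (n + 1) := by
      intro y; ring
    simp only [this]
    rw [integral_sub (integrable_cont (by fun_prop)) (integrable_cont (by fun_prop)), bz_one, integral_const_mul, int_vv]
    push_cast
    field_simp
    ring
  rw [h4, abs_mul, abs_of_pos (by norm_num : (0:ℝ) < 2), abs_sub_comm] at h3
  have h5 : C * (1 / ((n : ℝ) + 2)) ≤ C / (n + 1) := by
    rw [mul_one_div]; gcongr; norm_num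
  have := abs_nonneg (f x - bz n f x)
  linarith

lemma summable_lvl {f : S2 → ℝ} (hf : SmoothOnSphere f) :
    Summable (fun l : ℕ => lam (l + 1) ^ 2 * qf (l + 1) f) := by
  obtain ⟨C, hC0, hC⟩ := bz_sub_bound hf
  have hfc := SmoothOnSphere.cont hf
  apply summable_of_sum_range_le (c := C ^ 2)
  · intro l; exact mul_nonneg (sq_nonneg _) (qf_nonneg _ hfc)
  intro M
  have h1 : ∀ n : ℕ, ∑ l ∈ Finset.range M, (((n : ℝ) + 1) / (n + 1 + lam (l + 1)) * lam (l + 1)) ^ 2 * qf (l + 1) f ≤ C ^ 2 := by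
    intro n
    have hb := continuous_bz n hfc
    have h2 := bessel (M + 1) (f := fun x => f x - bz n f x) (by fun_prop)
    have h3 : ∫ x, (f x - bz n f x) ^ 2 ∂sphereUniform ≤ (C / (n + 1)) ^ 2 := by
      have : ∫ x, (f x - bz n f x) ^ 2 ∂sphereUniform ≤ ∫ x : S2, (C / (n + 1)) ^ 2 ∂sphereUniform := by
        apply integral_mono (integrable_cont (by fun_prop)) (integrable_const _)
        intro x
        simp only
        rw [← sq_abs]
        have := hC n x
        gcongr
      simpa using this
    simp only [qf_sub_bz n _ hfc] at h2
    rw [Finset.sum_range_succ'] at h2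
    rw [be_zero, sub_self, zero_pow two_ne_zero, zero_mul, add_zero] at h2
    have h4 : ∀ l ∈ Finset.range M, (((n : ℝ) + 1) / (n + 1 + lam (l + 1)) * lam (l + 1)) ^ 2 * qf (l + 1) f ≤
        (n + 1) ^ 2 * ((1 - be n (l + 1)) ^ 2 * qf (l + 1) f) := by
      intro l _
      rw [← mul_assoc]
      refine mul_le_mul_of_nonneg_right ?_ (qf_nonneg _ hfc)
      rw [← mul_pow]
      have hl := lam_nonneg (l + 1)
      have h6 := be_le n (l + 1)
      have h7 : ((n : ℝ) + 1) / (n + 1 + lam (l + 1)) = 1 - lam (l + 1) / (n + 1 + lam (l + 1)) := by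
        field_simp; ring
      refine pow_le_pow_left₀ (by positivity) ?_ 2
      have : lam (l + 1) / (n + 1 + lam (l + 1)) ≤ 1 - be n (l + 1) := by linarith
      calc ((n : ℝ) + 1) / (n + 1 + lam (l + 1)) * lam (l + 1) = (n + 1) * (lam (l + 1) / (n + 1 + lam (l + 1))) := by ring
        _ ≤ _ := by gcongr
    refine (Finset.sum_le_sum h4).trans ?_
    rw [← Finset.mul_sum]
    calc _ ≤ ((n : ℝ) + 1) ^ 2 * (C / (n + 1)) ^ 2 := by gcongr; exact h2.trans h3
      _ = C ^ 2 := by field_simp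
  have h2 : Filter.Tendsto (fun n : ℕ => ∑ l ∈ Finset.range M, (((n : ℝ) + 1) / (n + 1 + lam (l + 1)) * lam (l + 1)) ^ 2 * qf (l + 1) f)
      Filter.atTop (nhds (∑ l ∈ Finset.range M, lam (l + 1) ^ 2 * qf (l + 1) f)) := by
    apply tendsto_finsetSum
    intro l _
    apply Filter.Tendsto.mul_const
    apply Filter.Tendsto.pow
    have : Filter.Tendsto (fun n : ℕ => 1 - lam (l + 1) / ((n : ℝ) + (1 + lam (l + 1)))) Filter.atTop (nhds (1 - 0)) := by
      apply Filter.Tendsto.sub tendsto_const_nhds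
      apply Filter.Tendsto.div_atTop tendsto_const_nhds
      exact Filter.tendsto_atTop_add_const_right _ _ tendsto_natCast_atTop_atTop
    have h3 := this.mul_const (lam (l + 1))
    rw [sub_zero, one_mul] at h3
    refine h3.congr fun n => ?_
    have hl := lam_nonneg (l + 1)
    congr 1
    rw [← add_assoc]
    field_simp; ring
  exact le_of_tendsto' h2 h1

lemma levelSq_eq (l : ℕ) (f : S2 → ℝ) : levelSq l f = 4 * π * qf l f := by
  unfold levelSq
  simp only [integral_area, smul_eq_mul]
  rw [qf]
  simp only [pr, ← integral_const_mul]
  congr 1; ext x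
  congr 1; ext y
  rw [zonal_eq]
  field_simp

lemma sobNormSq_eq {f : S2 → ℝ} (hf : SmoothOnSphere f) :
    sobNormSq 2 f = 4 * π * ∑' l : ℕ, lam (l + 1) ^ 2 * qf (l + 1) f := by
  unfold sobNormSq
  rw [← tsum_mul_left]
  congr 1; ext l
  rw [levelSq_eq]
  rw [show (2 : ℝ) = ((2 : ℕ) : ℝ) by norm_num, Real.rpow_natCast]
  unfold lam
  push_cast
  ring

/-- uniform bound on `W2` controls the worst case error -/
theorem wce_le {N : ℕ} (hN : 0 < N) (x : Fin N → S2) (X : ℝ) (hX : ∀ K, W2 K x ≤ X) :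
    wce N 2 x ≤ √(X / (4 * π)) / N := by
  have hX0 : 0 ≤ X := by simpa [W2] using hX 0
  have hNr : (0 : ℝ) < N := by exact_mod_cast hN
  unfold wce
  apply Real.sSup_le
  swap
  · positivity
  rintro r ⟨f, hf, hf1, rfl⟩
  have hfc := SmoothOnSphere.cont hf
  rw [sobNormSq_eq hf] at hf1
  have hsum := summable_lvl hf
  have h1 : ∀ K, ∑ l ∈ Finset.range K, lam (l + 1) ^ 2 * qf (l + 1) f ≤ 1 / (4 * π) := by
    intro K
    refine (hsum.sum_le_tsum _ fun l _ => mul_nonneg (sq_nonneg _) (qf_nonneg _ hfc)).trans ?_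
    rw [le_div_iff₀ (by positivity)]; linarith
  obtain ⟨C, hC0, hC⟩ := bz_sub_bound hf
  have hlim : ∀ x, Filter.Tendsto (fun n => bz n f x) Filter.atTop (nhds (f x)) := by
    intro x
    rw [tendsto_iff_dist_tendsto_zero]
    refine squeeze_zero (fun _ => dist_nonneg) (fun n => ?_) (tendsto_const_div_atTop_nhds_zero_nat C |>.comp (Filter.tendsto_add_atTop_nat 1))
    rw [dist_comm, Real.dist_eq]
    simpa using hC n x
  have hlim2 : Filter.Tendsto (fun n => (∑ i, bz n f (x i) - N * ∫ y, f y ∂sphereUniform) ^ 2) Filter.atTop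
      (nhds ((∑ i, f (x i) - N * ∫ y, f y ∂sphereUniform) ^ 2)) := by
    apply Filter.Tendsto.pow
    apply Filter.Tendsto.sub_const
    exact tendsto_finsetSum _ fun i _ => hlim (x i)
  have h2 : (∑ i, f (x i) - N * ∫ y, f y ∂sphereUniform) ^ 2 ≤ X / (4 * π) := by
    refine le_of_tendsto' hlim2 fun K => (dual_bound K hfc x).trans ?_
    calc _ ≤ 1 / (4 * π) * X := mul_le_mul (h1 K) (hX K) (Finset.sum_nonneg fun n _ => div_nonneg (UU_nonneg _ _) (by positivity)) (by positivity)
      _ = _ := by ring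
  have h3 : |∑ i, f (x i) - N * ∫ y, f y ∂sphereUniform| ≤ √(X / (4 * π)) := Real.abs_le_sqrt h2
  rw [le_div_iff₀ hNr]
  refine le_trans (le_of_eq ?_) h3
  rw [abs_sub_comm (∑ i, f (x i))]
  nth_rewrite 2 [← abs_of_pos hNr]
  rw [← abs_mul]
  congr 1
  field_simp

end SE
end

open MeasureTheory Real Metric
open scoped ENNReal RealInnerProductSpace Manifold ContDiff ComplexConjugate

noncomputable section
namespace SE

section DPP
set_option linter.unusedSectionVars false
variable {X : Type*} [MeasurableSpace X] {μ : Measure X} [IsProbabilityMeasure μ]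

lemma integrable_bdd {E : Type*} [NormedAddCommGroup E] [MeasurableSpace E] [BorelSpace E]
    [SecondCountableTopology E] {Y : Type*} [MeasurableSpace Y] {ν : Measure Y} [IsFiniteMeasure ν]
    {f : Y → E} (hf : Measurable f) (C : ℝ) (hC : ∀ x, ‖f x‖ ≤ C) : Integrable f ν :=
  Integrable.of_bound hf.aestronglyMeasurable C (Filter.Eventually.of_forall hC)

/-- orthonormality data of a determinantal projection process -/
structure ON (μ : Measure X) (N : ℕ) (ψ : X → Fin N → ℂ) : Prop where
  meas : ∀ k, Measurable (fun x => ψ x k)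
  nsq : ∀ x, ∑ k, ‖ψ x k‖ ^ 2 = 1
  orth : ∀ j k, ∫ x, ψ x j * conj (ψ x k) ∂μ = if j = k then (1 / N : ℂ) else 0

variable {N : ℕ} {ψ : X → Fin N → ℂ}

lemma ON.le_one (h : ON μ N ψ) (x : X) (k : Fin N) : ‖ψ x k‖ ≤ 1 := by
  have h1 := Finset.single_le_sum (f := fun k => ‖ψ x k‖ ^ 2) (fun k _ => sq_nonneg _) (Finset.mem_univ k)
  simp only [h.nsq x] at h1
  nlinarith [norm_nonneg (ψ x k)]

lemma ON.intg (h : ON μ N ψ) (j k : Fin N) {g : X → ℝ} (hg : Measurable g) (C : ℝ) (hC : ∀ x, |g x| ≤ C) :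
    Integrable (fun x => (g x : ℂ) * (ψ x j * conj (ψ x k))) μ := by
  have h1 := h.meas j
  have h2 := h.meas k
  refine integrable_bdd (by fun_prop) C fun x => ?_
  rw [norm_mul, norm_mul, RCLike.norm_conj, Complex.norm_real, norm_eq_abs]
  have a1 := h.le_one x j
  have a2 := h.le_one x k
  calc |g x| * (‖ψ x j‖ * ‖ψ x k‖) ≤ C * (1 * 1) := by
        apply mul_le_mul (hC x) (mul_le_mul a1 a2 (norm_nonneg _) zero_le_one) (by positivity) ((abs_nonneg _).trans (hC x))
    _ = C := by ring

/-- Gram matrix -/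
def GM (μ : Measure X) (ψ : X → Fin N → ℂ) (g : X → ℝ) : Matrix (Fin N) (Fin N) ℂ :=
  Matrix.of fun j k => ∫ x, (g x : ℂ) * (ψ x j * conj (ψ x k)) ∂μ

/-- squared Slater determinant -/
def slater (ψ : X → Fin N → ℂ) (x : Fin N → X) : ℝ := ‖(Matrix.of fun k i => ψ (x i) k).det‖ ^ 2

lemma slater_eq (ψ : X → Fin N → ℂ) (g : X → ℝ) (x : Fin N → X) :
    (((∏ i, g (x i)) * slater ψ x : ℝ) : ℂ) = ∑ τ : Equiv.Perm (Fin N), ∑ σ : Equiv.Perm (Fin N),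
      ((Equiv.Perm.sign σ : ℤ) : ℂ) * ((Equiv.Perm.sign τ : ℤ) : ℂ) *
      ∏ i, ((g (x i) : ℂ) * (ψ (x i) (σ i) * conj (ψ (x i) (τ i)))) := by
  unfold slater
  rw [Complex.ofReal_mul, Complex.ofReal_pow, ← Complex.mul_conj', Matrix.det_apply']
  rw [map_sum, Finset.sum_mul_sum, Finset.mul_sum, Finset.sum_comm]
  refine Finset.sum_congr rfl fun τ _ => ?_
  rw [Finset.mul_sum]
  refine Finset.sum_congr rfl fun σ _ => ?_
  simp only [Matrix.of_apply, map_mul, map_prod, Finset.prod_mul_distrib, Complex.ofReal_prod, map_intCast]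
  ring

lemma andreief (h : ON μ N ψ) {g : X → ℝ} (hg : Measurable g) (C : ℝ) (hC : ∀ x, |g x| ≤ C) :
    Integrable (fun x : Fin N → X => (((∏ i, g (x i)) * slater ψ x : ℝ) : ℂ)) (Measure.pi fun _ : Fin N => μ) ∧
    ∫ x : Fin N → X, (((∏ i, g (x i)) * slater ψ x : ℝ) : ℂ) ∂(Measure.pi fun _ : Fin N => μ) =
      (N.factorial : ℂ) * (GM μ ψ g).det := by
  have hintg : ∀ σ τ : Equiv.Perm (Fin N), Integrable (fun x : Fin N → X =>
      ∏ i, ((g (x i) : ℂ) * (ψ (x i) (σ i) * conj (ψ (x i) (τ i))))) (Measure.pi fun _ : Fin N => μ) := by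
    intro σ τ
    exact Integrable.fintype_prod (f := fun i y => ((g y : ℂ) * (ψ y (σ i) * conj (ψ y (τ i)))))
      (fun i => h.intg _ _ hg C hC)
  simp only [slater_eq]
  constructor
  · exact integrable_finsetSum _ fun τ _ => integrable_finsetSum _ fun σ _ => (hintg σ τ).const_mul _
  rw [integral_finsetSum _ (fun τ _ => integrable_finsetSum _ fun σ _ => (hintg σ τ).const_mul _)]
  have h1 : ∀ τ : Equiv.Perm (Fin N), ∫ x : Fin N → X, ∑ σ : Equiv.Perm (Fin N),
      ((Equiv.Perm.sign σ : ℤ) : ℂ) * ((Equiv.Perm.sign τ : ℤ) : ℂ) *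
      ∏ i, ((g (x i) : ℂ) * (ψ (x i) (σ i) * conj (ψ (x i) (τ i)))) ∂(Measure.pi fun _ : Fin N => μ) = (GM μ ψ g).det := by
    intro τ
    rw [integral_finsetSum _ (fun σ _ => (hintg σ τ).const_mul _)]
    rw [Matrix.det_apply', ← Equiv.sum_comp (Equiv.mulRight τ)]
    refine Finset.sum_congr rfl fun ρ _ => ?_
    rw [integral_const_mul]
    have := integral_fintype_prod_eq_prod (μ := fun _ : Fin N => μ) (fun (i : Fin N) y => ((g y : ℂ) * (ψ y ((ρ * τ) i) * conj (ψ y (τ i)))))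
    simp only [Equiv.coe_mulRight]
    rw [this]
    rw [← Equiv.prod_comp τ (fun j => GM μ ψ g (ρ j) j)]
    simp only [GM, Matrix.of_apply, Equiv.Perm.coe_mul, Function.comp]
    congr 1
    rw [Equiv.Perm.sign_mul]
    rcases Int.units_eq_one_or (Equiv.Perm.sign τ) with h | h <;> simp [h]
  simp only [h1]
  simp [Fintype.card_perm]

lemma GM_one (h : ON μ N ψ) : GM μ ψ (fun _ => 1) = (1 / N : ℂ) • (1 : Matrix (Fin N) (Fin N) ℂ) := by
  ext j k
  simp only [GM, Matrix.of_apply, Complex.ofReal_one, one_mul, h.orth, Matrix.smul_apply, Matrix.one_apply, smul_eq_mul]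
  split_ifs <;> simp

lemma int_slater (h : ON μ N ψ) : Integrable (slater ψ) (Measure.pi fun _ : Fin N => μ) ∧
    ∫ x, slater ψ x ∂(Measure.pi fun _ : Fin N => μ) = N.factorial * (1 / N) ^ N := by
  obtain ⟨h1, h2⟩ := andreief h (g := fun _ => 1) measurable_const 1 (by simp)
  simp only [Finset.prod_const_one, one_mul] at h1 h2
  refine ⟨by simpa using h1.re, ?_⟩
  rw [integral_complex_ofReal, GM_one h, Matrix.det_smul, Matrix.det_one] at h2
  simp only [Fintype.card_fin] at h2
  rw [mul_one] at h2
  apply Complex.ofReal_injective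
  rw [h2]; push_cast; rfl

/-- kernel -/
def ker (ψ : X → Fin N → ℂ) (x y : X) : ℂ := ψ x ⬝ᵥ star (ψ y)

lemma ker_rot (V : Matrix (Fin N) (Fin N) ℂ) (hV : V.conjTranspose * V = 1) (ψ : X → Fin N → ℂ) (x y : X) :
    ker (fun x => V.mulVec (ψ x)) x y = ker ψ x y := by
  unfold ker
  rw [Matrix.star_mulVec, dotProduct_comm, ← Matrix.dotProduct_mulVec, Matrix.mulVec_mulVec, hV, Matrix.one_mulVec,
    dotProduct_comm]

lemma ker_self (ψ : X → Fin N → ℂ) (x : X) : ker ψ x x = ((∑ k, ‖ψ x k‖ ^ 2 : ℝ) : ℂ) := by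
  unfold ker dotProduct
  simp only [Pi.star_apply]
  push_cast
  refine Finset.sum_congr rfl fun k _ => ?_
  rw [← Complex.mul_conj']; rfl

lemma GM_rot (h : ON μ N ψ) (V : Matrix (Fin N) (Fin N) ℂ) {g : X → ℝ} (hg : Measurable g) (C : ℝ) (hC : ∀ x, |g x| ≤ C) :
    GM μ (fun x => V.mulVec (ψ x)) g = V * GM μ ψ g * V.conjTranspose := by
  ext j k
  simp only [GM, Matrix.of_apply, Matrix.mul_apply, Matrix.mulVec, dotProduct, Matrix.conjTranspose_apply]
  have : ∀ x, (g x : ℂ) * ((∑ m, V j m * ψ x m) * conj (∑ n, V k n * ψ x n)) =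
      ∑ n, ∑ m, (V j m * star (V k n)) * ((g x : ℂ) * (ψ x m * conj (ψ x n))) := by
    intro x
    rw [map_sum, Finset.sum_mul_sum, Finset.mul_sum, Finset.sum_comm]
    refine Finset.sum_congr rfl fun n _ => ?_
    rw [Finset.mul_sum]
    refine Finset.sum_congr rfl fun m _ => ?_
    rw [map_mul]; simp only [RCLike.star_def]; ring
  simp only [this]
  rw [integral_finsetSum _ (fun n _ => integrable_finsetSum _ fun m _ => (h.intg m n hg C hC).const_mul _)]
  refine Finset.sum_congr rfl fun n _ => ?_
  rw [integral_finsetSum _ (fun m _ => (h.intg m n hg C hC).const_mul _), Finset.sum_mul]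
  refine Finset.sum_congr rfl fun m _ => ?_
  rw [integral_const_mul]; ring

/-- rotating the orthonormal system -/
lemma ON.rot (h : ON μ N ψ) (V : Matrix (Fin N) (Fin N) ℂ) (hV : V.conjTranspose * V = 1) :
    ON μ N (fun x => V.mulVec (ψ x)) := by
  constructor
  · intro k
    simp only [Matrix.mulVec, dotProduct]
    exact Finset.measurable_sum _ fun i _ => (h.meas i).const_mul _
  · intro x
    have h1 := ker_self (fun x => V.mulVec (ψ x)) x
    rw [ker_rot V hV, ker_self, h.nsq] at h1
    exact_mod_cast h1.symm
  · intro j k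
    have h1 := GM_rot h V (g := fun _ => 1) measurable_const 1 (by simp)
    rw [GM_one h, Matrix.mul_smul, Matrix.smul_mul, mul_one, mul_eq_one_comm.1 hV] at h1
    have h2 := congrFun (congrFun h1 j) k
    simp only [GM, Matrix.of_apply, Complex.ofReal_one, one_mul, Matrix.smul_apply, Matrix.one_apply, smul_eq_mul] at h2
    rw [h2]
    split_ifs <;> simp

lemma ker_norm_sq (ψ : X → Fin N → ℂ) (x y : X) : ((‖ker ψ x y‖ ^ 2 : ℝ) : ℂ) =
    ∑ j, ∑ k, (ψ x j * conj (ψ x k)) * (ψ y k * conj (ψ y j)) := by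
  rw [Complex.ofReal_pow, ← Complex.mul_conj']
  unfold ker dotProduct
  rw [map_sum, Finset.sum_mul_sum]
  refine Finset.sum_congr rfl fun j _ => Finset.sum_congr rfl fun k _ => ?_
  simp only [Pi.star_apply, map_mul, RCLike.star_def, Complex.conj_conj]
  ring

lemma ON.ker_le (h : ON μ N ψ) (x y : X) : ‖ker ψ x y‖ ≤ N := by
  unfold ker dotProduct
  refine (norm_sum_le _ _).trans ?_
  calc _ ≤ ∑ i : Fin N, (1 : ℝ) := by
        refine Finset.sum_le_sum fun i _ => ?_
        rw [norm_mul, Pi.star_apply, norm_star]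
        exact mul_le_one₀ (h.le_one x i) (norm_nonneg _) (h.le_one y i)
    _ = N := by simp

lemma ON.ker_meas (h : ON μ N ψ) : Measurable (fun p : X × X => ker ψ p.1 p.2) := by
  unfold ker dotProduct
  refine Finset.measurable_sum _ fun i _ => ?_
  have h1 := h.meas i
  have h2 : Measurable (fun p : X × X => ψ p.1 i) := h1.comp measurable_fst
  have h3 : Measurable (fun p : X × X => ψ p.2 i) := h1.comp measurable_snd
  exact h2.mul (Complex.continuous_conj.measurable.comp h3)

lemma ker_int (h : ON μ N ψ) {g g' : X → ℝ} (hg : Measurable g) (C : ℝ) (hC : ∀ x, |g x| ≤ C)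
    (hg' : Measurable g') (C' : ℝ) (hC' : ∀ x, |g' x| ≤ C') :
    Integrable (fun p : X × X => g p.1 * g' p.2 * ‖ker ψ p.1 p.2‖ ^ 2) (μ.prod μ) ∧
    ((∫ p : X × X, g p.1 * g' p.2 * ‖ker ψ p.1 p.2‖ ^ 2 ∂(μ.prod μ) : ℝ) : ℂ) = (GM μ ψ g * GM μ ψ g').trace := by
  constructor
  · have hk := h.ker_meas.norm
    have h1 : Measurable (fun p : X × X => g p.1) := hg.comp measurable_fst
    have h2 : Measurable (fun p : X × X => g' p.2) := hg'.comp measurable_snd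
    refine integrable_bdd (by fun_prop) (C * C' * N ^ 2) fun p => ?_
    rw [norm_mul, norm_mul, norm_eq_abs, norm_eq_abs, norm_pow, norm_norm]
    have a := h.ker_le p.1 p.2
    have := hC p.1
    have := hC' p.2
    have : 0 ≤ C := (abs_nonneg _).trans (hC p.1)
    have : 0 ≤ C' := (abs_nonneg _).trans (hC' p.2)
    gcongr
  · rw [← integral_complex_ofReal]
    have : ∀ p : X × X, ((g p.1 * g' p.2 * ‖ker ψ p.1 p.2‖ ^ 2 : ℝ) : ℂ) =
        ∑ j, ∑ k, ((g p.1 : ℂ) * (ψ p.1 j * conj (ψ p.1 k))) * ((g' p.2 : ℂ) * (ψ p.2 k * conj (ψ p.2 j))) := by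
      intro p
      rw [Complex.ofReal_mul, ker_norm_sq, Finset.mul_sum]
      refine Finset.sum_congr rfl fun j _ => ?_
      rw [Finset.mul_sum]
      refine Finset.sum_congr rfl fun k _ => ?_
      push_cast; ring
    simp only [this]
    have hi : ∀ j k, Integrable (fun p : X × X => ((g p.1 : ℂ) * (ψ p.1 j * conj (ψ p.1 k))) * ((g' p.2 : ℂ) * (ψ p.2 k * conj (ψ p.2 j)))) (μ.prod μ) :=
      fun j k => (h.intg j k hg C hC).mul_prod (h.intg k j hg' C' hC')
    rw [integral_finsetSum _ fun j _ => integrable_finsetSum _ fun k _ => hi j k]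
    simp only [Matrix.trace, Matrix.diag, Matrix.mul_apply]
    refine Finset.sum_congr rfl fun j _ => ?_
    rw [integral_finsetSum _ fun k _ => hi j k]
    refine Finset.sum_congr rfl fun k _ => ?_
    exact integral_prod_mul (fun x => ((g x : ℂ) * (ψ x j * conj (ψ x k)))) (fun x => ((g' x : ℂ) * (ψ x k * conj (ψ x j))))

/-- the quadratic form bounding the cumulant -/
def QF (μ : Measure X) (N : ℕ) (ψ : X → Fin N → ℂ) (u : X → ℝ) : ℝ :=
  N ^ 2 * ∫ p : X × X, ‖ker ψ p.1 p.2‖ ^ 2 * (cosh (u p.2 - u p.1) - 1) ∂(μ.prod μ)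

lemma exp_abs_le {u C : ℝ} (h : |u| ≤ C) : |rexp u| ≤ rexp C := by
  rw [abs_of_pos (exp_pos _)]; exact exp_le_exp.2 ((le_abs_self _).trans h)

lemma QF_eq (h : ON μ N ψ) (hN : 0 < N) {u : X → ℝ} (hu : Measurable u) (C : ℝ) (hC : ∀ x, |u x| ≤ C) :
    (QF μ N ψ u : ℂ) = N ^ 2 * (GM μ ψ (fun x => rexp (u x)) * GM μ ψ (fun x => rexp (-u x))).trace - N := by
  have hm : Measurable fun x => rexp (u x) := by fun_prop
  have hm' : Measurable fun x => rexp (-u x) := by fun_prop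
  have b1 : ∀ x, |rexp (u x)| ≤ rexp C := fun x => exp_abs_le (hC x)
  have b2 : ∀ x, |rexp (-u x)| ≤ rexp C := fun x => exp_abs_le (by rw [abs_neg]; exact hC x)
  obtain ⟨i1, e1⟩ := ker_int h hm _ b1 hm' _ b2
  obtain ⟨i2, e2⟩ := ker_int h hm' _ b2 hm _ b1
  obtain ⟨i3, e3⟩ := ker_int h (g := fun _ => 1) (g' := fun _ => 1) measurable_const 1 (by simp) measurable_const 1 (by simp)
  have : ∀ p : X × X, ‖ker ψ p.1 p.2‖ ^ 2 * (cosh (u p.2 - u p.1) - 1) =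
      (1 / 2) * (rexp (u p.1) * rexp (-u p.2) * ‖ker ψ p.1 p.2‖ ^ 2) +
      (1 / 2) * (rexp (-u p.1) * rexp (u p.2) * ‖ker ψ p.1 p.2‖ ^ 2) - (1 * 1 * ‖ker ψ p.1 p.2‖ ^ 2) := by
    intro p
    rw [cosh_eq, ← exp_add, ← exp_add, show -(u p.2 - u p.1) = u p.1 + -u p.2 by ring, show u p.2 - u p.1 = -u p.1 + u p.2 by ring]
    ring
  unfold QF
  simp only [this]
  have i4 : Integrable (fun p : X × X => (1 / 2) * (rexp (u p.1) * rexp (-u p.2) * ‖ker ψ p.1 p.2‖ ^ 2) +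
      (1 / 2) * (rexp (-u p.1) * rexp (u p.2) * ‖ker ψ p.1 p.2‖ ^ 2)) (μ.prod μ) :=
    (i1.const_mul _).add (i2.const_mul _)
  rw [integral_sub i4 i3, integral_add (i1.const_mul _) (i2.const_mul _),
    integral_const_mul, integral_const_mul]
  push_cast
  rw [e1, e2, e3, Matrix.trace_mul_comm (GM μ ψ (fun x => rexp (-u x))), GM_one h, Matrix.smul_mul, Matrix.mul_smul, mul_one,
    Matrix.trace_smul, Matrix.trace_smul, Matrix.trace_one]
  simp only [Fintype.card_fin, smul_eq_mul]
  have : (N : ℂ) ≠ 0 := by exact_mod_cast hN.ne'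
  field_simp
  ring

lemma GM_diag (h : ON μ N ψ) (g : X → ℝ) (j : Fin N) :
    GM μ ψ g j j = ((∫ x, g x * ‖ψ x j‖ ^ 2 ∂μ : ℝ) : ℂ) := by
  rw [← integral_complex_ofReal]
  simp only [GM, Matrix.of_apply, Complex.mul_conj']
  push_cast; rfl

lemma diag_ineq (h : ON μ N ψ) (hN : 0 < N) {u : X → ℝ} (hu : Measurable u) (C : ℝ) (hC : ∀ x, |u x| ≤ C)
    (d : Fin N → ℝ) (hd : GM μ ψ (fun x => rexp (u x)) = Matrix.diagonal (fun j => (d j : ℂ))) :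
    (∀ j, 0 < d j) ∧ ∑ j, log (N * d j) ≤ N * ∫ x, u x ∂μ + QF μ N ψ u := by
  have hNr : (0 : ℝ) < N := by exact_mod_cast hN
  have hmj := fun j => (h.meas j).norm
  have hb : ∀ x j, ‖ψ x j‖ ^ 2 ≤ 1 := fun x j => pow_le_one₀ (norm_nonneg _) (h.le_one x j)
  have hi : ∀ j (g : X → ℝ), Measurable g → ∀ C, (∀ x, |g x| ≤ C) → Integrable (fun x => g x * ‖ψ x j‖ ^ 2) μ := by
    intro j g hg C hC
    have := hmj j
    refine integrable_bdd (by fun_prop) C fun x => ?_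
    rw [norm_mul, norm_eq_abs, norm_pow, norm_norm]
    calc |g x| * ‖ψ x j‖ ^ 2 ≤ C * 1 := mul_le_mul (hC x) (hb x j) (by positivity) ((abs_nonneg _).trans (hC x))
      _ = C := mul_one C
  have hm : Measurable fun x => rexp (u x) := by fun_prop
  have hm' : Measurable fun x => rexp (-u x) := by fun_prop
  have b1 : ∀ x, |rexp (u x)| ≤ rexp C := fun x => exp_abs_le (hC x)
  have b2 : ∀ x, |rexp (-u x)| ≤ rexp C := fun x => exp_abs_le (by rw [abs_neg]; exact hC x)
  have hdj : ∀ j, d j = ∫ x, rexp (u x) * ‖ψ x j‖ ^ 2 ∂μ := by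
    intro j
    have h1 := GM_diag h (fun x => rexp (u x)) j
    rw [hd, Matrix.diagonal_apply_eq] at h1
    exact_mod_cast h1
  have hone : ∀ j, ∫ x, 1 * ‖ψ x j‖ ^ 2 ∂μ = (1 / N : ℝ) := by
    intro j
    have h1 := GM_diag h (fun x => 1) j
    rw [GM_one h, Matrix.smul_apply, Matrix.one_apply_eq, smul_eq_mul, mul_one] at h1
    apply Complex.ofReal_injective
    rw [← h1]; push_cast; rfl
  have i1 : ∀ j, Integrable (fun x => 1 * ‖ψ x j‖ ^ 2) μ := fun j => hi j (fun _ => 1) measurable_const 1 (by simp)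
  have ie := fun j => hi j _ hm _ b1
  have ie' := fun j => hi j _ hm' _ b2
  have iu := fun j => hi j _ hu _ hC
  have hpos : ∀ j, 0 < d j := by
    intro j
    have h1 : ∫ x, rexp (-C) * (1 * ‖ψ x j‖ ^ 2) ∂μ ≤ ∫ x, rexp (u x) * ‖ψ x j‖ ^ 2 ∂μ := by
      refine integral_mono ((i1 j).const_mul _) (ie j) fun x => ?_
      simp only [one_mul]
      have := (abs_le.1 (hC x)).1
      gcongr
    rw [integral_const_mul, hone, ← hdj] at h1
    exact lt_of_lt_of_le (by positivity) h1
  refine ⟨hpos, ?_⟩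
  have key : ∀ j, log (N * d j) ≤ N * (N * d j * ∫ x, rexp (-u x) * ‖ψ x j‖ ^ 2 ∂μ) - 1 + N * ∫ x, u x * ‖ψ x j‖ ^ 2 ∂μ := by
    intro j
    have hdp : 0 < N * d j := mul_pos hNr (hpos j)
    have h1 : ∫ x, log (N * d j) * (1 * ‖ψ x j‖ ^ 2) ∂μ ≤ ∫ x, ((N * d j) * (rexp (-u x) * ‖ψ x j‖ ^ 2) - (1 * ‖ψ x j‖ ^ 2) + u x * ‖ψ x j‖ ^ 2) ∂μ := by
      refine integral_mono ((i1 j).const_mul _) ((((ie' j).const_mul _).sub (i1 j)).add (iu j)) fun x => ?_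
      simp only
      have h2 := log_le_sub_one_of_pos (mul_pos hdp (exp_pos (-u x)))
      rw [log_mul hdp.ne' (exp_pos _).ne', log_exp] at h2
      have := mul_le_mul_of_nonneg_right h2 (sq_nonneg ‖ψ x j‖)
      linarith
    have i4 : Integrable (fun x => (N * d j) * (rexp (-u x) * ‖ψ x j‖ ^ 2) - (1 * ‖ψ x j‖ ^ 2)) μ :=
      ((ie' j).const_mul _).sub (i1 j)
    rw [integral_const_mul, hone, integral_add i4 (iu j), integral_sub ((ie' j).const_mul _) (i1 j),
      integral_const_mul, hone] at h1
    have := mul_le_mul_of_nonneg_left h1 hNr.le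
    have e : (N : ℝ) * (1 / N) = 1 := by field_simp
    calc log (N * d j) = N * (log (N * d j) * (1 / N)) := by field_simp
      _ ≤ _ := this
      _ = _ := by rw [mul_add, mul_sub, e]
  refine (Finset.sum_le_sum fun j _ => key j).trans (le_of_eq ?_)
  rw [Finset.sum_add_distrib, Finset.sum_sub_distrib]
  have e1 : ∑ j, (N : ℝ) * ∫ x, u x * ‖ψ x j‖ ^ 2 ∂μ = N * ∫ x, u x ∂μ := by
    rw [← Finset.mul_sum, ← integral_finsetSum _ fun j _ => iu j]
    congr 2; ext x
    rw [← Finset.mul_sum, h.nsq, mul_one]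
  have e2 : QF μ N ψ u = ∑ j, N * (N * d j * ∫ x, rexp (-u x) * ‖ψ x j‖ ^ 2 ∂μ) - N := by
    have h1 := QF_eq h hN hu C hC
    rw [hd, Matrix.trace] at h1
    simp only [Matrix.diag, Matrix.diagonal_mul, GM_diag h] at h1
    have h2 : (QF μ N ψ u : ℂ) = ((∑ j, N * (N * d j * ∫ x, rexp (-u x) * ‖ψ x j‖ ^ 2 ∂μ) - N : ℝ) : ℂ) := by
      rw [h1]
      push_cast
      rw [Finset.mul_sum]
      congr 1
      refine Finset.sum_congr rfl fun j _ => ?_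
      ring
    exact_mod_cast h2
  rw [e1, e2]
  simp
  ring

lemma QF_rot (V : Matrix (Fin N) (Fin N) ℂ) (hV : V.conjTranspose * V = 1) (u : X → ℝ) :
    QF μ N (fun x => V.mulVec (ψ x)) u = QF μ N ψ u := by
  unfold QF; simp only [ker_rot V hV]

/-- the determinantal cumulant bound -/
theorem dpp_bound (h : ON μ N ψ) (hN : 0 < N) {u : X → ℝ} (hu : Measurable u) (C : ℝ) (hC : ∀ x, |u x| ≤ C) :
    Integrable (fun x : Fin N → X => (∏ i, rexp (u (x i))) * slater ψ x) (Measure.pi fun _ : Fin N => μ) ∧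
    ∫ x : Fin N → X, (∏ i, rexp (u (x i))) * slater ψ x ∂(Measure.pi fun _ : Fin N => μ) ≤
      (N.factorial * (1 / N) ^ N) * rexp (N * ∫ x, u x ∂μ + QF μ N ψ u) := by
  have hNr : (0 : ℝ) < N := by exact_mod_cast hN
  have hm : Measurable fun x => rexp (u x) := by fun_prop
  have b1 : ∀ x, |rexp (u x)| ≤ rexp C := fun x => exp_abs_le (hC x)
  obtain ⟨i1, e1⟩ := andreief h hm _ b1
  refine ⟨by simpa only [RCLike.re_eq_complex_re, Complex.ofReal_re] using i1.re, ?_⟩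
  rw [integral_complex_ofReal] at e1
  set A := GM μ ψ (fun x => rexp (u x)) with hA
  have hH : A.IsHermitian := by
    ext j k
    simp only [hA, GM, Matrix.conjTranspose_apply, Matrix.of_apply]
    rw [RCLike.star_def, ← integral_conj]
    congr 1; ext x
    simp only [map_mul, Complex.conj_ofReal, Complex.conj_conj]
    ring
  let U := hH.eigenvectorUnitary
  let V : Matrix (Fin N) (Fin N) ℂ := (U : Matrix (Fin N) (Fin N) ℂ).conjTranspose
  have hV : V.conjTranspose * V = 1 := by
    simp only [V, Matrix.conjTranspose_conjTranspose]
    exact Unitary.coe_mul_star_self U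
  have hdiag : GM μ (fun x => V.mulVec (ψ x)) (fun x => rexp (u x)) = Matrix.diagonal (fun j => ((hH.eigenvalues j : ℝ) : ℂ)) := by
    rw [GM_rot h V hm _ b1]
    have := hH.conjStarAlgAut_star_eigenvectorUnitary
    rw [Unitary.conjStarAlgAut_apply] at this
    simp only [← hA, V, U, Matrix.conjTranspose_conjTranspose]
    simpa [Matrix.star_eq_conjTranspose, Function.comp_def] using this
  obtain ⟨hp, hs⟩ := diag_ineq (h.rot V hV) hN hu C hC _ hdiag
  rw [QF_rot V hV] at hs
  rw [hH.det_eq_prod_eigenvalues] at e1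
  have e2 : ∫ x : Fin N → X, (∏ i, rexp (u (x i))) * slater ψ x ∂(Measure.pi fun _ : Fin N => μ) = N.factorial * ∏ j, hH.eigenvalues j := by
    apply Complex.ofReal_injective
    rw [e1]; push_cast; rfl
  rw [e2, mul_assoc]
  gcongr
  have e3 : ∏ j, hH.eigenvalues j = (1 / N : ℝ) ^ N * ∏ j, (N * hH.eigenvalues j) := by
    rw [Finset.prod_mul_distrib]; simp [hNr.ne']
  rw [e3]
  gcongr
  rw [← exp_le_exp, exp_sum] at hs
  refine le_trans (le_of_eq ?_) hs
  exact Finset.prod_congr rfl fun j _ => (exp_log (mul_pos hNr (hp j))).symm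
end DPP
end SE
end

open MeasureTheory Real Metric
open scoped ENNReal RealInnerProductSpace Manifold ContDiff ComplexConjugate

noncomputable section
namespace SE

/-- real spinor component -/
def sA (x : S2) : ℝ := √((1 + (x : E3) 2) / 2)
def sP (x : S2) : ℝ := if (x : E3) 2 = -1 then 1 else (x : E3) 0 / √(2 * (1 + (x : E3) 2))
def sQ (x : S2) : ℝ := if (x : E3) 2 = -1 then 0 else (x : E3) 1 / √(2 * (1 + (x : E3) 2))
def sb (x : S2) : ℂ := (sP x : ℂ) + (sQ x : ℂ) * Complex.I

lemma S2_sq (x : S2) : (x : E3) 0 ^ 2 + (x : E3) 1 ^ 2 + (x : E3) 2 ^ 2 = 1 := by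
  have h := norm_S2 x
  rw [EuclideanSpace.norm_eq, Fin.sum_univ_three] at h
  have := congrArg (· ^ 2) h
  simp only [norm_eq_abs, sq_abs] at this
  rw [Real.sq_sqrt (by positivity)] at this
  simpa using this

lemma ip_coord (x y : S2) : ip x y = (x : E3) 0 * (y : E3) 0 + (x : E3) 1 * (y : E3) 1 + (x : E3) 2 * (y : E3) 2 := by
  rw [ip, PiLp.inner_apply, Fin.sum_univ_three]
  simp; ring

lemma z_ge (x : S2) : -1 ≤ (x : E3) 2 := by
  have := S2_sq x; nlinarith [sq_nonneg ((x : E3) 0), sq_nonneg ((x : E3) 1)]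

lemma sA_sq (x : S2) : sA x ^ 2 = (1 + (x : E3) 2) / 2 := by
  rw [sA, Real.sq_sqrt]; linarith [z_ge x]

lemma south_coord (x : S2) (h : (x : E3) 2 = -1) : (x : E3) 0 = 0 ∧ (x : E3) 1 = 0 := by
  have := S2_sq x
  rw [h] at this
  constructor <;> nlinarith [sq_nonneg ((x : E3) 0), sq_nonneg ((x : E3) 1)]

lemma sqrt_two (x : S2) : √(2 * (1 + (x : E3) 2)) = 2 * sA x := by
  have h := z_ge x
  rw [sA, show 2 * (1 + (x : E3) 2) = 2 ^ 2 * ((1 + (x : E3) 2) / 2) by ring,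
    Real.sqrt_mul (by positivity), Real.sqrt_sq (by norm_num)]

lemma sA_pos (x : S2) (h : (x : E3) 2 ≠ -1) : 0 < sA x := by
  have := lt_of_le_of_ne (z_ge x) (Ne.symm h)
  rw [sA]; apply Real.sqrt_pos.2; linarith

lemma sA_south (x : S2) (h : (x : E3) 2 = -1) : sA x = 0 := by
  rw [sA, h]; norm_num

lemma sAP (x : S2) : 2 * sA x * sP x = (x : E3) 0 := by
  by_cases h : (x : E3) 2 = -1
  · rw [sA_south x h, (south_coord x h).1]; ring
  · have := sA_pos x h
    rw [sP, if_neg h, sqrt_two]; field_simp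

lemma sAQ (x : S2) : 2 * sA x * sQ x = (x : E3) 1 := by
  by_cases h : (x : E3) 2 = -1
  · rw [sA_south x h, (south_coord x h).2]; ring
  · have := sA_pos x h
    rw [sQ, if_neg h, sqrt_two]; field_simp

lemma sPQ (x : S2) : sP x ^ 2 + sQ x ^ 2 = (1 - (x : E3) 2) / 2 := by
  by_cases h : (x : E3) 2 = -1
  · rw [sP, sQ, if_pos h, if_pos h, h]; norm_num
  · have h1 := sA_pos x h
    have h2 := sA_sq x
    have h3 := sAP x
    have h4 := sAQ x
    have h5 := S2_sq x
    rw [← h3, ← h4] at h5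
    have h6 : 4 * sA x ^ 2 * (sP x ^ 2 + sQ x ^ 2) = 4 * sA x ^ 2 * ((1 - (x : E3) 2) / 2) := by
      rw [show 4 * sA x ^ 2 * ((1 - (x : E3) 2) / 2) = 1 - (x : E3) 2 ^ 2 by rw [h2]; ring]
      linarith
    exact mul_left_cancel₀ (by positivity) h6

lemma spin_norm (x y : S2) : ‖(sA x : ℂ) * sA y + sb x * conj (sb y)‖ ^ 2 = vv x y := by
  rw [← Complex.normSq_eq_norm_sq, vv, ip_coord, Complex.normSq_apply, ← sAP x, ← sAP y, ← sAQ x, ← sAQ y]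
  have e1 := sA_sq x
  have e2 := sA_sq y
  have e3 := sPQ x
  have e4 := sPQ y
  simp [sb]
  have z1 : (x : E3) 2 = 2 * sA x ^ 2 - 1 := by linarith
  have z2 : (y : E3) 2 = 2 * sA y ^ 2 - 1 := by linarith
  have e3' : sP x ^ 2 + sQ x ^ 2 = 1 - sA x ^ 2 := by linarith
  have e4' : sP y ^ 2 + sQ y ^ 2 = 1 - sA y ^ 2 := by linarith
  rw [z1, z2]
  linear_combination (sP y ^ 2 + sQ y ^ 2) * e3' + (1 - sA x ^ 2) * e4'

lemma spin_diff (x y : S2) : ‖(sb y : ℂ) * sA x - sb x * sA y‖ ^ 2 = 1 - vv x y := by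
  rw [← Complex.normSq_eq_norm_sq, vv, ip_coord, Complex.normSq_apply, ← sAP x, ← sAP y, ← sAQ x, ← sAQ y]
  have e1 := sA_sq x
  have e2 := sA_sq y
  have e3 := sPQ x
  have e4 := sPQ y
  simp [sb]
  have z1 : (x : E3) 2 = 2 * sA x ^ 2 - 1 := by linarith
  have z2 : (y : E3) 2 = 2 * sA y ^ 2 - 1 := by linarith
  have e3' : sP x ^ 2 + sQ x ^ 2 = 1 - sA x ^ 2 := by linarith
  have e4' : sP y ^ 2 + sQ y ^ 2 = 1 - sA y ^ 2 := by linarith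
  rw [z1, z2]
  linear_combination (sA y ^ 2) * e3' + (sA x ^ 2) * e4'

lemma coord_meas (i : Fin 3) : Measurable (fun x : S2 => (x : E3) i) := by
  have : Continuous (fun x : S2 => (x : E3) i) := by fun_prop
  exact this.measurable

lemma sA_meas : Measurable sA := by
  unfold sA
  have := coord_meas 2
  fun_prop

lemma sb_meas : Measurable sb := by
  have h2 := coord_meas 2
  have h0 := coord_meas 0
  have h1 := coord_meas 1
  have hs : MeasurableSet {x : S2 | (x : E3) 2 = -1} := h2 (measurableSet_singleton _)
  have hP : Measurable sP := by
    unfold sP; exact Measurable.ite hs measurable_const (by fun_prop)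
  have hQ : Measurable sQ := by
    unfold sQ; exact Measurable.ite hs measurable_const (by fun_prop)
  unfold sb; fun_prop

/-- the orthonormal basis of the spin representation -/
def spsi (N : ℕ) (x : S2) (k : Fin N) : ℂ :=
  (√((N - 1).choose k : ℝ) : ℝ) * (sb x ^ k.1 * (sA x : ℂ) ^ k.rev.1)

lemma rev_val {N : ℕ} (k : Fin N) : k.rev.1 = N - 1 - k.1 := by
  rw [Fin.val_rev]; omega

lemma ker_spsi {N : ℕ} (hN : 0 < N) (x y : S2) :
    ker (spsi N) x y = ((sA x : ℂ) * sA y + sb x * conj (sb y)) ^ (N - 1) := by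
  rw [add_comm, add_pow, ker, dotProduct]
  obtain ⟨M, rfl⟩ : ∃ M, N = M + 1 := ⟨N - 1, by omega⟩
  rw [show Finset.range (M + 1 - 1 + 1) = Finset.range (M + 1) from rfl]
  rw [← Fin.sum_univ_eq_sum_range (fun m => (sb x * conj (sb y)) ^ m * ((sA x : ℂ) * sA y) ^ (M + 1 - 1 - m) *
    ((M + 1 - 1).choose m : ℂ)) (M + 1)]
  apply Finset.sum_congr rfl
  intro k _
  simp only [spsi, Pi.star_apply, RCLike.star_def, map_mul, map_pow, Complex.conj_ofReal, rev_val]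
  have : ((√((M + 1 - 1).choose k.1 : ℝ) : ℝ) : ℂ) * ((√((M + 1 - 1).choose k.1 : ℝ) : ℝ) : ℂ) = ((M + 1 - 1).choose k.1 : ℂ) := by
    rw [← Complex.ofReal_mul, Real.mul_self_sqrt (by positivity)]; simp
  rw [← this]; ring

lemma ker_spsi_norm {N : ℕ} (hN : 0 < N) (x y : S2) : ‖ker (spsi N) x y‖ ^ 2 = vv x y ^ (N - 1) := by
  rw [ker_spsi hN, norm_pow, ← pow_mul, mul_comm (N - 1) 2, pow_mul, spin_norm]

/-- rotation about the vertical axis -/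
def rotL (θ : ℝ) : E3 →ₗᵢ[ℝ] E3 where
  toFun v := !₂[cos θ * v 0 - sin θ * v 1, sin θ * v 0 + cos θ * v 1, v 2]
  map_add' v w := by
    ext i; fin_cases i <;> simp <;> ring
  map_smul' c v := by
    ext i; fin_cases i <;> simp <;> ring
  norm_map' v := by
    simp only [LinearMap.coe_mk, AddHom.coe_mk]
    rw [EuclideanSpace.norm_eq, EuclideanSpace.norm_eq, Fin.sum_univ_three, Fin.sum_univ_three]
    congr 1
    simp only [norm_eq_abs, sq_abs]
    simp
    have := sin_sq_add_cos_sq θ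
    linear_combination (v 0 ^ 2 + v 1 ^ 2) * this

def rot (θ : ℝ) : E3 ≃ₗᵢ[ℝ] E3 := (rotL θ).toLinearIsometryEquiv rfl

lemma rot_coord (θ : ℝ) (x : S2) : ((act (rot θ) x : S2) : E3) = !₂[cos θ * (x : E3) 0 - sin θ * (x : E3) 1, sin θ * (x : E3) 0 + cos θ * (x : E3) 1, (x : E3) 2] := rfl

lemma sA_rot (θ : ℝ) (x : S2) : sA (act (rot θ) x) = sA x := by
  simp [sA, rot_coord]

lemma sb_rot (θ : ℝ) (x : S2) (h : (x : E3) 2 ≠ -1) : sb (act (rot θ) x) = Complex.exp (θ * Complex.I) * sb x := by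
  rw [Complex.exp_mul_I]
  simp only [sb, sP, sQ, rot_coord]
  simp [h]
  rw [← Complex.ofReal_cos, ← Complex.ofReal_sin]
  ring_nf
  rw [Complex.I_sq]; ring

lemma spsi_rot {N : ℕ} {j k : Fin N} (hjk : j ≠ k) (x : S2) :
    spsi N (act (rot (π / ((j.1 : ℝ) - k.1))) x) j * conj (spsi N (act (rot (π / ((j.1 : ℝ) - k.1))) x) k) = 
      - (spsi N x j * conj (spsi N x k)) := by
  have hne : ((j.1 : ℝ) - k.1) ≠ 0 := by
    intro h; apply hjk; apply Fin.ext; exact_mod_cast sub_eq_zero.1 h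
  set θ := π / ((j.1 : ℝ) - k.1)
  by_cases h : (x : E3) 2 = -1
  · have h0 := sA_south x h
    have : j.rev.1 ≠ 0 ∨ k.rev.1 ≠ 0 := by
      by_contra hc
      push Not at hc
      apply hjk; apply Fin.rev_injective; apply Fin.ext; omega
    simp only [spsi, sA_rot, h0, map_mul, map_pow, Complex.conj_ofReal]
    rcases this with h | h <;> rw [Complex.ofReal_zero, zero_pow h] <;> ring
  · simp only [spsi, sA_rot, sb_rot θ x h, map_mul, map_pow, Complex.conj_ofReal]
    have e1 : Complex.exp (θ * Complex.I) ^ j.1 * (conj (Complex.exp (θ * Complex.I))) ^ k.1 = -1 := by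
      rw [← Complex.exp_conj, ← Complex.exp_nat_mul, ← Complex.exp_nat_mul, ← Complex.exp_add, ← Complex.exp_pi_mul_I]
      congr 1
      have : (π : ℂ) = ((θ * ((j.1 : ℝ) - k.1) : ℝ) : ℂ) := by
        congr 1; simp only [θ]; field_simp
      rw [this]; simp; ring
    rw [mul_pow, mul_pow]
    linear_combination (√((N - 1).choose j : ℝ) : ℝ) * (sb x ^ j.1 * (sA x : ℂ) ^ j.rev.1) * ((√((N - 1).choose k : ℝ) : ℝ) * (conj (sb x) ^ k.1 * (sA x : ℂ) ^ k.rev.1)) * e1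

lemma ip_north (x : S2) : ip north x = (x : E3) 2 := by
  rw [ip_coord]; simp [north]

lemma sb_norm (x : S2) : ‖sb x‖ ^ 2 = (1 - (x : E3) 2) / 2 := by
  rw [← Complex.normSq_eq_norm_sq, Complex.normSq_apply, ← sPQ x]
  simp [sb]; ring

theorem spsi_ON {N : ℕ} (hN : 0 < N) : ON sphereUniform N (spsi N) where
  meas k := by
    have h1 := sA_meas
    have h2 := sb_meas
    unfold spsi; fun_prop
  nsq x := by
    have h := ker_self (spsi N) x
    have h2 := ker_spsi hN x x
    have h3 : (sA x : ℂ) * sA x + sb x * conj (sb x) = 1 := by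
      rw [Complex.mul_conj, Complex.normSq_eq_norm_sq, sb_norm, ← Complex.ofReal_mul, ← Complex.ofReal_add, ← sq, sA_sq]
      rw [show (1 + (x : E3) 2) / 2 + (1 - (x : E3) 2) / 2 = 1 by ring]; simp
    rw [h3, one_pow, h] at h2
    exact_mod_cast h2
  orth j k := by
    by_cases hjk : j = k
    · subst hjk
      rw [if_pos rfl]
      have e : ∀ x, spsi N x j * conj (spsi N x j) = ((((N - 1).choose j.1 : ℝ) * (pV ^ (N - 1 - j.1) * (1 - pV) ^ j.1 : Polynomial ℝ).eval (ip north x) : ℝ) : ℂ) := by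
        intro x
        rw [Complex.mul_conj, Complex.normSq_eq_norm_sq, spsi, norm_mul, norm_mul, norm_pow, norm_pow]
        congr 1
        simp only [Complex.norm_real, norm_eq_abs, Polynomial.eval_mul, Polynomial.eval_pow, Polynomial.eval_sub, Polynomial.eval_one, pV_eval]
        rw [mul_pow, sq_abs, Real.sq_sqrt (by positivity), mul_pow, ← pow_mul, ← pow_mul, mul_comm j.1, mul_comm j.rev.1, pow_mul, pow_mul, sb_norm, sq_abs, sA_sq, rev_val, ip_north]
        ring
      simp_rw [e]
      rw [integral_complex_ofReal, integral_const_mul, integral_ip_poly, Lam_beta, show N - 1 - j.1 + j.1 = N - 1 by omega,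
        Nat.choose_eq_factorial_div_factorial (by omega : j.1 ≤ N - 1)]
      rw [Nat.cast_div (Nat.factorial_mul_factorial_dvd_factorial (by omega)) (by positivity)]
      obtain ⟨M, rfl⟩ : ∃ M, N = M + 1 := ⟨N - 1, by omega⟩
      simp only [Nat.add_sub_cancel, Nat.factorial_succ]
      push_cast
      have a1 : ((M.factorial : ℕ) : ℂ) ≠ 0 := by exact_mod_cast (Nat.factorial_ne_zero _)
      have a2 : ((j.1.factorial : ℕ) : ℂ) ≠ 0 := by exact_mod_cast (Nat.factorial_ne_zero _)
      have a3 : (((M - j.1).factorial : ℕ) : ℂ) ≠ 0 := by exact_mod_cast (Nat.factorial_ne_zero _)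
      have a4 : (M + 1 : ℂ) ≠ 0 := by exact_mod_cast (Nat.succ_ne_zero M)
      field_simp
    · rw [if_neg hjk]
      have h := (mp_act (rot (π / ((j.1 : ℝ) - k.1)))).integral_comp' (f := (⟨⟨act (rot (π / ((j.1 : ℝ) - k.1))), act (rot (π / ((j.1 : ℝ) - k.1))).symm, act_symm_act _, act_act_symm _⟩, (continuous_act _).measurable, (continuous_act _).measurable⟩ : S2 ≃ᵐ S2))
        (fun x => spsi N x j * conj (spsi N x k))
      simp only [MeasurableEquiv.coe_mk, Equiv.coe_fn_mk] at h
      simp_rw [spsi_rot hjk] at h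
      rw [integral_neg] at h
      exact self_eq_neg.1 h.symm

lemma slater_spsi {N : ℕ} (x : Fin N → S2) :
    slater (spsi N) x = (∏ k : Fin N, ((N - 1).choose k : ℝ)) * ∏ i : Fin N, ∏ j ∈ Finset.Ioi i, (1 - vv (x i) (x j)) := by
  have h : (Matrix.of fun k i => spsi N (x i) k) = Matrix.diagonal (fun k : Fin N => ((√((N - 1).choose k : ℝ) : ℝ) : ℂ)) *
      (Matrix.projVandermonde (fun i => sb (x i)) (fun i => (sA (x i) : ℂ))).transpose := by
    ext k i
    rw [Matrix.diagonal_mul, Matrix.transpose_apply, Matrix.projVandermonde_apply]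
    rfl
  rw [slater, h, Matrix.det_mul, Matrix.det_diagonal, Matrix.det_transpose, Matrix.det_projVandermonde, norm_mul, mul_pow, norm_prod, norm_prod, ← Finset.prod_pow, ← Finset.prod_pow]
  congr 1
  · apply Finset.prod_congr rfl
    intro k _
    rw [Complex.norm_real, norm_eq_abs, sq_abs, Real.sq_sqrt (by positivity)]
  · apply Finset.prod_congr rfl
    intro i _
    rw [norm_prod, ← Finset.prod_pow]
    apply Finset.prod_congr rfl
    intro j _
    exact spin_diff _ _

end SE
end

open MeasureTheory Real Metric
open scoped ENNReal RealInnerProductSpace Manifold ContDiff ComplexConjugate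

noncomputable section
namespace SE

lemma prod_offDiag_pairs {N : ℕ} (f : Fin N → Fin N → ℝ) :
    ∏ p ∈ (Finset.univ : Finset (Fin N)).offDiag, f p.1 p.2 = ∏ i, ∏ j ∈ Finset.Ioi i, f i j * f j i := by
  have h1 : (Finset.univ : Finset (Fin N)).offDiag = (Finset.univ.filter fun p : Fin N × Fin N => p.1 < p.2) ∪ (Finset.univ.filter fun p : Fin N × Fin N => p.2 < p.1) := by
    ext p; simp [lt_or_lt_iff_ne]
  have h2 : Disjoint (Finset.univ.filter fun p : Fin N × Fin N => p.1 < p.2) (Finset.univ.filter fun p : Fin N × Fin N => p.2 < p.1) := by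
    rw [Finset.disjoint_filter]; intro p _ h; exact not_lt.2 h.le
  have h3 : ∏ p ∈ (Finset.univ.filter fun p : Fin N × Fin N => p.2 < p.1), f p.1 p.2 = ∏ p ∈ (Finset.univ.filter fun p : Fin N × Fin N => p.1 < p.2), f p.2 p.1 := by
    apply Finset.prod_nbij' Prod.swap Prod.swap <;> simp
  rw [h1, Finset.prod_union h2, h3, ← Finset.prod_mul_distrib, Finset.prod_filter, ← Finset.univ_product_univ, Finset.prod_product]
  apply Finset.prod_congr rfl
  intro i _
  rw [← Finset.prod_filter]
  apply Finset.prod_congr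
  · ext j; simp
  · intros; rfl

lemma dist_sq (x y : S2) : dist x y * dist x y = 4 * (1 - vv x y) := by
  rw [← sq, Subtype.dist_eq, dist_eq_norm, @norm_sub_sq_real, norm_S2, norm_S2, vv, ip]
  ring

/-- combinatorial normalization -/
def cN (N : ℕ) : ℝ := ∏ k : Fin N, ((N - 1).choose k : ℝ)
def DD {N : ℕ} (x : Fin N → S2) : ℝ := ∏ i : Fin N, ∏ j ∈ Finset.Ioi i, (1 - vv (x i) (x j))
def kap (N : ℕ) : ℝ := N.factorial * (1 / N : ℝ) ^ N

lemma cN_pos (N : ℕ) : 0 < cN N := by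
  apply Finset.prod_pos
  intro k _
  have : 0 < (N - 1).choose k.1 := Nat.choose_pos (by omega)
  exact_mod_cast this

lemma kap_pos {N : ℕ} (hN : 0 < N) : 0 < kap N := by unfold kap; positivity

lemma slater_DD {N : ℕ} (x : Fin N → S2) : slater (spsi N) x = cN N * DD x := slater_spsi x

lemma continuous_DD {N : ℕ} : Continuous (DD : (Fin N → S2) → ℝ) := by
  unfold DD; fun_prop

lemma DD_nonneg {N : ℕ} (x : Fin N → S2) : 0 ≤ DD x := by
  unfold DD
  exact Finset.prod_nonneg fun i _ => Finset.prod_nonneg fun j _ => by linarith [vv_le_one (x i) (x j)]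

lemma dens_eq (N : ℕ) : ∃ c : ℝ, 0 < c ∧ ∀ x, ensembleDensity N x = ENNReal.ofReal c * ENNReal.ofReal (slater (spsi N) x) := by
  refine ⟨(∏ i : Fin N, ∏ j ∈ Finset.Ioi i, 4) / cN N, by have := cN_pos N; positivity, fun x => ?_⟩
  have := cN_pos N
  rw [ensembleDensity, prod_offDiag_pairs (fun i j => dist (x i) (x j)), ← ENNReal.ofReal_mul (by positivity), slater_DD]
  congr 1
  rw [div_mul_eq_mul_div, mul_left_comm, mul_div_cancel_left₀ _ this.ne', DD, ← Finset.prod_mul_distrib]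
  apply Finset.prod_congr rfl
  intro i _
  rw [← Finset.prod_mul_distrib]
  apply Finset.prod_congr rfl
  intro j _
  rw [dist_comm (x j), dist_sq]

lemma slater_cont (N : ℕ) : Continuous (slater (spsi N)) := by
  have : slater (spsi N) = fun x => cN N * DD x := funext slater_DD
  rw [this]; have := @continuous_DD N; fun_prop

lemma slater_nonneg {N : ℕ} (x : Fin N → S2) : 0 ≤ slater (spsi N) x := by unfold slater; positivity

theorem ens_eq {N : ℕ} (hN : 0 < N) : sphericalEnsemble N = (ENNReal.ofReal (kap N))⁻¹ •
    (Measure.pi fun _ : Fin N => sphereUniform).withDensity (fun x => ENNReal.ofReal (slater (spsi N) x)) := by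
  obtain ⟨c, hc, h⟩ := dens_eq N
  have hm : Measurable (fun x => ENNReal.ofReal (slater (spsi N) x)) := (slater_cont N).measurable.ennreal_ofReal
  have hc' : ENNReal.ofReal c ≠ 0 := by simpa using hc
  have h1 := int_slater (spsi_ON hN)
  have h2 : ∫⁻ x, ENNReal.ofReal (slater (spsi N) x) ∂(Measure.pi fun _ : Fin N => sphereUniform) = ENNReal.ofReal (kap N) := by
    rw [← ofReal_integral_eq_lintegral_ofReal h1.1 (Filter.Eventually.of_forall slater_nonneg), h1.2, kap]
  have hd : ensembleDensity N = ENNReal.ofReal c • (fun x => ENNReal.ofReal (slater (spsi N) x)) := by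
    funext x; rw [h x]; rfl
  rw [sphericalEnsemble, hd, withDensity_smul _ hm, smul_smul]
  congr 1
  simp only [Pi.smul_apply, smul_eq_mul]
  rw [lintegral_const_mul _ hm, h2, ENNReal.mul_inv (Or.inl hc') (Or.inl ENNReal.ofReal_ne_top), mul_comm, ← mul_assoc,
    ENNReal.mul_inv_cancel hc' ENNReal.ofReal_ne_top, one_mul]

lemma ens_lint {N : ℕ} (hN : 0 < N) (F : (Fin N → S2) → ℝ≥0∞) (hF : Measurable F) :
    ∫⁻ x, F x ∂(sphericalEnsemble N) = (ENNReal.ofReal (kap N))⁻¹ * ∫⁻ x, ENNReal.ofReal (slater (spsi N) x) * F x ∂(Measure.pi fun _ : Fin N => sphereUniform) := by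
  have hm : Measurable (fun x => ENNReal.ofReal (slater (spsi N) x)) := (slater_cont N).measurable.ennreal_ofReal
  rw [ens_eq hN, lintegral_smul_measure, lintegral_withDensity_eq_lintegral_mul _ hm hF]
  rfl

theorem ens_prob {N : ℕ} (hN : 0 < N) : IsProbabilityMeasure (sphericalEnsemble N) := by
  constructor
  have h := ens_lint hN (fun _ => 1) measurable_const
  have h1 := int_slater (spsi_ON hN)
  simp only [lintegral_const, one_mul, mul_one] at h
  rw [h, ← ofReal_integral_eq_lintegral_ofReal h1.1 (Filter.Eventually.of_forall slater_nonneg), h1.2]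
  have hk := kap_pos hN
  exact ENNReal.inv_mul_cancel (ENNReal.ofReal_pos.2 hk).ne' ENNReal.ofReal_ne_top

/-- quadratic functional in the exponential bound -/
def QQ (N : ℕ) (u : S2 → ℝ) : ℝ := (N : ℝ) ^ 2 * ∫ p : S2 × S2, vv p.1 p.2 ^ (N - 1) * (cosh (u p.2 - u p.1) - 1) ∂(sphereUniform.prod sphereUniform)

theorem ens_laplace {N : ℕ} (hN : 0 < N) {u : S2 → ℝ} (hu : Continuous u) :
    ∫⁻ x, ENNReal.ofReal (rexp (∑ i, u (x i) - N * ∫ y, u y ∂sphereUniform - QQ N u)) ∂(sphericalEnsemble N) ≤ 1 := by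
  have hb : ∃ C, ∀ x, |u x| ≤ C := by
    obtain ⟨C, hC⟩ := (isCompact_range hu.abs).bddAbove
    exact ⟨C, fun x => hC ⟨x, rfl⟩⟩
  obtain ⟨C, hC⟩ := hb
  have h := dpp_bound (spsi_ON hN) hN hu.measurable C hC
  have hQ : QF sphereUniform N (spsi N) u = QQ N u := by
    unfold QF QQ; simp_rw [ker_spsi_norm hN]
  rw [hQ] at h
  set m := ∫ y, u y ∂sphereUniform
  have hc : Continuous fun x : Fin N → S2 => rexp (∑ i, u (x i) - N * m - QQ N u) := by fun_prop
  rw [ens_lint hN _ hc.measurable.ennreal_ofReal]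
  have e : ∀ x : Fin N → S2, ENNReal.ofReal (slater (spsi N) x) * ENNReal.ofReal (rexp (∑ i, u (x i) - N * m - QQ N u)) =
      ENNReal.ofReal (rexp (-(N * m + QQ N u)) * ((∏ i, rexp (u (x i))) * slater (spsi N) x)) := by
    intro x
    rw [← ENNReal.ofReal_mul (slater_nonneg x), ← Real.exp_sum]
    congr 1
    rw [show ∑ i, u (x i) - N * m - QQ N u = -(N * m + QQ N u) + ∑ i, u (x i) by ring, Real.exp_add]; ring
  simp_rw [e]
  rw [← ofReal_integral_eq_lintegral_ofReal (h.1.const_mul _), integral_const_mul]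
  · have hk := kap_pos hN
    rw [ENNReal.inv_mul_le_iff (by simpa using hk) ENNReal.ofReal_ne_top, mul_one]
    apply ENNReal.ofReal_le_ofReal
    calc _ ≤ rexp (-(N * m + QQ N u)) * (kap N * rexp (N * m + QQ N u)) := by
          apply mul_le_mul_of_nonneg_left h.2 (exp_pos _).le
      _ = kap N := by rw [mul_left_comm, ← Real.exp_add]; simp
  · exact Filter.Eventually.of_forall fun x => mul_nonneg (exp_pos _).le (mul_nonneg (Finset.prod_nonneg fun i _ => (exp_pos _).le) (slater_nonneg x))

/-- low density configurations are unlikely -/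
theorem ens_energy {N : ℕ} (hN : 0 < N) (t : ℝ) :
    sphericalEnsemble N {x | cN N * DD x ≤ kap N * rexp (-t)} ≤ ENNReal.ofReal (rexp (-t)) := by
  have hs : MeasurableSet {x : Fin N → S2 | cN N * DD x ≤ kap N * rexp (-t)} := by
    apply measurableSet_le
    · exact (continuous_const.mul continuous_DD).measurable
    · exact measurable_const
  have hk := kap_pos hN
  rw [← lintegral_indicator_one hs, ens_lint hN _ (measurable_one.indicator hs),
    ENNReal.inv_mul_le_iff (by simpa using hk) ENNReal.ofReal_ne_top, ← ENNReal.ofReal_mul hk.le]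
  calc _ ≤ ∫⁻ x : Fin N → S2, ENNReal.ofReal (kap N * rexp (-t)) ∂(Measure.pi fun _ : Fin N => sphereUniform) := by
        apply lintegral_mono
        intro x
        by_cases hx : x ∈ {x : Fin N → S2 | cN N * DD x ≤ kap N * rexp (-t)}
        · simp only [Set.indicator_of_mem hx, Pi.one_apply, mul_one]
          apply ENNReal.ofReal_le_ofReal
          rw [slater_DD]; exact hx
        · simp [Set.indicator_of_notMem hx]
    _ = _ := by simp

end SE
end

open MeasureTheory Real Metric
open scoped ENNReal RealInnerProductSpace Manifold ContDiff ComplexConjugate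

noncomputable section
namespace SE

lemma cN_succ (M : ℕ) : cN (M + 2) * (M + 1).factorial = cN (M + 1) * (M + 1 : ℝ) ^ (M + 1) := by
  unfold cN
  rw [Fin.prod_univ_castSucc]
  have e : ∀ k : Fin (M + 1), (((M + 2 - 1).choose k.castSucc.1 : ℕ) : ℝ) * (M + 1 - k.1 : ℝ) = ((M + 1 - 1).choose k.1 : ℝ) * (M + 1 : ℝ) := by
    intro k
    have h := Nat.choose_mul_succ_eq M k.1
    have hk : k.1 ≤ M + 1 := by omega
    have h' := congrArg (Nat.cast : ℕ → ℝ) h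
    push_cast [Nat.cast_sub hk] at h'
    simpa using h'.symm
  have h1 : ∏ k : Fin (M + 1), (M + 1 - k.1 : ℝ) = (M + 1).factorial := by
    rw [← Finset.prod_range_add_one_eq_factorial, Fin.prod_univ_eq_prod_range (fun k => (M + 1 - k : ℝ)) (M + 1), ← Finset.prod_range_reflect]
    push_cast
    apply Finset.prod_congr rfl
    intro k hk
    have : k ≤ M := by simp at hk; omega
    rw [Nat.cast_sub this]; ring
  rw [← h1]
  simp only [Fin.val_last, show M + 2 - 1 = M + 1 by omega, Nat.choose_self, Nat.cast_one, mul_one]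
  rw [← Finset.prod_mul_distrib]
  simp only [show M + 2 - 1 = M + 1 by omega] at e
  rw [Finset.prod_congr rfl fun k _ => e k, Finset.prod_mul_distrib]
  simp

/-- minus the log of the normalized partition function -/
def ell (N : ℕ) : ℝ := log (cN N) - log (kap N)

lemma ell_succ (M : ℕ) : ell (M + 2) - ell (M + 1) = (M + 1) * log (M + 2) - log ((M + 1).factorial) := by
  have h := congrArg log (cN_succ M)
  have c1 := cN_pos (M + 1)
  have c2 := cN_pos (M + 2)
  have f1 : (0 : ℝ) < (M + 1).factorial := by positivity
  rw [log_mul c2.ne' f1.ne', log_mul c1.ne' (by positivity), log_pow] at h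
  have k : ∀ n : ℕ, log (kap (n + 1)) = log ((n + 1).factorial) - (n + 1) * log (n + 1) := by
    intro n
    unfold kap
    rw [log_mul (by positivity) (by positivity), log_pow, one_div, log_inv]
    push_cast; ring
  have k1 := k M
  have k2 := k (M + 1)
  rw [Nat.factorial_succ (M + 1)] at k2
  push_cast at k2 h
  rw [log_mul (by positivity) (by positivity), show ((M : ℝ) + 1 + 1) = M + 2 by ring] at k2
  unfold ell
  rw [k1, show M + 2 = M + 1 + 1 by omega, k2]
  linarith

lemma log_two_pi : 7 / 4 ≤ log (2 * π) := by
  have h : 7 / 4 ≤ log 6 := by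
    rw [Real.le_log_iff_exp_le (by norm_num)]
    have h1 := Real.exp_one_lt_d9
    have h2 : rexp (7 / 4) ^ 4 = rexp 1 ^ 7 := by
      rw [← Real.exp_nat_mul, ← Real.exp_nat_mul]; norm_num
    have h3 : rexp 1 ^ 7 ≤ 2.7182818286 ^ 7 := by
      apply pow_le_pow_left₀ (exp_pos _).le h1.le
    have h4 : rexp (7 / 4) ^ 4 ≤ 6 ^ 4 := by rw [h2]; exact h3.trans (by norm_num)
    exact le_of_pow_le_pow_left₀ (by norm_num) (by norm_num) h4
  refine h.trans (log_le_log (by norm_num) ?_)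
  linarith [Real.pi_gt_three]

lemma log_fac (n : ℕ) (hn : 0 < n) : n * log n - n + log n / 2 + 7 / 8 ≤ log (n.factorial) := by
  have h := Stirling.le_log_factorial_stirling (n := n) (by omega)
  have := log_two_pi
  linarith

lemma ell_bound (M : ℕ) : ell (M + 1) ≤ (M + 1) ^ 2 / 2 - (M + 1) * log (M + 1) / 2 + 0.43 * (M + 1) := by
  induction M with
  | zero => simp [ell, cN, kap]; norm_num
  | succ M ih =>
    have h := ell_succ M
    have hf := log_fac (M + 1) (by omega)
    push_cast at hf
    have hl : log (M + 2 : ℝ) = log (M + 1) + log (1 + 1 / (M + 1)) := by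
      rw [← log_mul (by positivity) (by positivity)]; congr 1; field_simp; ring
    set δ := log (1 + 1 / (M + 1 : ℝ))
    have key : (3 * (M + 1 : ℝ) / 2 + 1 / 2) * δ ≤ 1.805 := by
      rcases Nat.eq_zero_or_pos M with h0 | h0
      · subst h0
        have := Real.log_two_lt_d9
        simp only [δ]; norm_num; linarith
      · have hM : (1 : ℝ) ≤ M := by exact_mod_cast h0
        have hd : δ ≤ 1 / (M + 1 : ℝ) := by
          have := Real.log_le_sub_one_of_pos (show (0 : ℝ) < 1 + 1 / (M + 1) by positivity)
          simp only [δ]; linarith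
        calc (3 * (M + 1 : ℝ) / 2 + 1 / 2) * δ ≤ (3 * (M + 1 : ℝ) / 2 + 1 / 2) * (1 / (M + 1)) := by gcongr
          _ = 3 / 2 + 1 / (2 * (M + 1)) := by field_simp
          _ ≤ 3 / 2 + 1 / (2 * (1 + 1)) := by gcongr
          _ ≤ _ := by norm_num
    rw [show M + 1 + 1 = M + 2 by omega]
    push_cast
    rw [show ((M : ℝ) + 1 + 1) = M + 2 by ring]
    rw [hl] at h ⊢
    nlinarith

lemma one_sub_le_exp {v : ℝ} (h0 : 0 ≤ v) (h1 : v ≤ 1) (K : ℕ) :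
    1 - v ≤ rexp (-∑ n ∈ Finset.range K, v ^ (n + 1) / (n + 1)) := by
  rcases h1.eq_or_lt with h | h
  · subst h; simp; positivity
  · have hs := Real.hasSum_pow_div_log_of_abs_lt_one (x := v) (by rw [abs_of_nonneg h0]; exact h)
    have := sum_le_hasSum (Finset.range K) (fun n _ => by positivity) hs
    rw [← Real.log_le_iff_le_exp (by linarith)]
    linarith

lemma sum_pairs {N : ℕ} (f : Fin N → Fin N → ℝ) (hs : ∀ i j, f i j = f j i) :
    ∑ i, ∑ j, f i j = 2 * ∑ i, ∑ j ∈ Finset.Ioi i, f i j + ∑ i, f i i := by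
  have h3 : ∑ i, ∑ j ∈ Finset.Iio i, f i j = ∑ i, ∑ j ∈ Finset.Ioi i, f i j := by
    rw [Finset.sum_sigma', Finset.sum_sigma']
    apply Finset.sum_nbij' (fun p => ⟨p.2, p.1⟩) (fun p => ⟨p.2, p.1⟩) <;> simp [hs]
  have h1 : ∀ i : Fin N, ∑ j, f i j = ∑ j ∈ Finset.Iio i, f i j + ∑ j ∈ Finset.Ioi i, f i j + f i i := by
    intro i
    have : (Finset.univ : Finset (Fin N)) = (Finset.Iio i ∪ Finset.Ioi i) ∪ {i} := by
      ext j; simp; exact lt_or_ge j i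
    rw [this, Finset.sum_union, Finset.sum_union]
    · simp
    · rw [Finset.disjoint_left]; intro j hj; simp at *; exact hj.le
    · simp
  simp_rw [h1]
  rw [Finset.sum_add_distrib, Finset.sum_add_distrib, h3]; ring

/-- unnormalized power sums -/
def SS {N : ℕ} (n : ℕ) (x : Fin N → S2) : ℝ := ∑ i, ∑ j, vv (x i) (x j) ^ n

variable {N : ℕ}

lemma UU_SS (n : ℕ) (x : Fin N → S2) : UU n x = SS n x - N ^ 2 / (n + 1) := by
  unfold UU SS
  simp only [Finset.sum_sub_distrib, Finset.sum_const, Finset.card_univ, Fintype.card_fin, nsmul_eq_mul]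
  ring

lemma SS_anti (x : Fin N → S2) {m n : ℕ} (h : m ≤ n) : SS n x ≤ SS m x := by
  unfold SS
  exact Finset.sum_le_sum fun i _ => Finset.sum_le_sum fun j _ => pow_le_pow_of_le_one (vv_nonneg _ _) (vv_le_one _ _) h

def HH (K : ℕ) : ℝ := ∑ n ∈ Finset.range K, 1 / ((n : ℝ) + 1)

lemma tele_sum (a b : ℕ) (h : a ≤ b) : ∑ n ∈ Finset.Ico a b, 1 / (((n : ℝ) + 1) * (n + 1 + 1)) = 1 / (a + 1) - 1 / (b + 1) := by
  induction b, h using Nat.le_induction with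
  | base => simp
  | succ b hb ih =>
    rw [Finset.sum_Ico_succ_top hb, ih]; push_cast; field_simp; ring

lemma DD_le (K : ℕ) (x : Fin N → S2) :
    DD x ≤ rexp ((N * HH K - N ^ 2 * (1 - 1 / (K + 1)) - W1 K x) / 2) := by
  have h1 : DD x ≤ rexp (∑ i, ∑ j ∈ Finset.Ioi i, -∑ n ∈ Finset.range K, vv (x i) (x j) ^ (n + 1) / (n + 1)) := by
    rw [Real.exp_sum]
    simp_rw [Real.exp_sum]
    unfold DD
    apply Finset.prod_le_prod
    · intro i _
      exact Finset.prod_nonneg fun j _ => by linarith [vv_le_one (x i) (x j)]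
    · intro i _
      apply Finset.prod_le_prod
      · intro j _; linarith [vv_le_one (x i) (x j)]
      · intro j _; exact one_sub_le_exp (vv_nonneg _ _) (vv_le_one _ _) K
  refine h1.trans (Real.exp_le_exp.2 (le_of_eq ?_))
  have h2 := sum_pairs (fun i j => ∑ n ∈ Finset.range K, vv (x i) (x j) ^ (n + 1) / ((n : ℝ) + 1)) (fun i j => by simp [vv_comm])
  have h3 : ∑ i, ∑ j, ∑ n ∈ Finset.range K, vv (x i) (x j) ^ (n + 1) / ((n : ℝ) + 1) = ∑ n ∈ Finset.range K, SS (n + 1) x / (n + 1) := by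
    have : ∀ i, ∑ j, ∑ n ∈ Finset.range K, vv (x i) (x j) ^ (n + 1) / ((n : ℝ) + 1) = ∑ n ∈ Finset.range K, ∑ j, vv (x i) (x j) ^ (n + 1) / ((n : ℝ) + 1) := fun i => Finset.sum_comm
    simp_rw [this]
    rw [Finset.sum_comm]
    simp_rw [SS, Finset.sum_div]
  have h4 : ∑ n ∈ Finset.range K, SS (n + 1) x / ((n : ℝ) + 1) = W1 K x + N ^ 2 * (1 - 1 / (K + 1)) := by
    have := tele_sum 0 K (Nat.zero_le _)
    simp only [Nat.cast_zero, zero_add, Nat.Ico_zero_eq_range, div_one] at this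
    rw [← this, W1, Finset.mul_sum, ← Finset.sum_add_distrib]
    apply Finset.sum_congr rfl
    intro n _
    rw [UU_SS]; push_cast; field_simp; ring
  have h5 : ∑ i : Fin N, ∑ n ∈ Finset.range K, vv (x i) (x i) ^ (n + 1) / ((n : ℝ) + 1) = N * HH K := by
    simp [vv_self, HH]
  rw [h3, h4, h5] at h2
  simp only [Finset.sum_neg_distrib]
  linarith

lemma HH_le (K : ℕ) (hK : 4 ≤ K) : HH K ≤ log K + 0.7 := by
  have h := Real.strictAnti_eulerMascheroniSeq'.antitone hK
  have e : ∀ n : ℕ, ((harmonic n : ℚ) : ℝ) = HH n := by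
    intro n; simp [harmonic, HH]
  simp only [Real.eulerMascheroniSeq'] at h
  rw [if_neg (by omega), if_neg (by omega), e, e] at h
  have h4 : HH 4 = 25 / 12 := by simp [HH, Finset.sum_range_succ]; norm_num
  have := Real.log_two_gt_d9
  have l4 : log ((4 : ℕ) : ℝ) = 2 * log 2 := by
    rw [show ((4 : ℕ) : ℝ) = 2 ^ 2 by norm_num, log_pow]; norm_num
  rw [h4, l4] at h
  linarith

/-- good energy event implies the control of the log energy -/
lemma W1_bound (hN : 2 ≤ N) (x : Fin N → S2) (t : ℝ) (h : kap N * rexp (-t) < cN N * DD x) :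
    W1 (2 * N) x ≤ 2.76 * N + 2 * t := by
  have hk := kap_pos (show 0 < N by omega)
  have hc := cN_pos N
  have h1 : kap N * rexp (-t) < cN N * rexp ((N * HH (2 * N) - N ^ 2 * (1 - 1 / ((2 * N : ℕ) + 1)) - W1 (2 * N) x) / 2) :=
    h.trans_le (mul_le_mul_of_nonneg_left (DD_le _ _) hc.le)
  have h2 := Real.log_lt_log (by positivity) h1
  rw [log_mul hk.ne' (exp_pos _).ne', log_mul hc.ne' (exp_pos _).ne', log_exp, log_exp] at h2
  obtain ⟨M, rfl⟩ : ∃ M, N = M + 1 := ⟨N - 1, by omega⟩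
  have h3 := ell_bound M
  unfold ell at h3
  have h4 := HH_le (2 * (M + 1)) (by omega)
  have l2 := Real.log_two_lt_d9
  push_cast at *
  rw [log_mul (by norm_num) (by positivity)] at h4
  have h5 : ((M : ℝ) + 1) ^ 2 * (1 / (2 * (M + 1) + 1)) ≤ (M + 1) / 2 := by
    rw [mul_one_div, div_le_div_iff₀ (by positivity) (by norm_num)]; nlinarith [show (0 : ℝ) ≤ M by positivity]
  have h6 : ((M : ℝ) + 1) * HH (2 * (M + 1)) ≤ (M + 1) * (log 2 + log (M + 1) + 0.7) := by gcongr
  have h7 : ((M : ℝ) + 1) * log 2 ≤ (M + 1) * 0.6932 := by gcongr; linarith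
  nlinarith [show (0 : ℝ) ≤ M by positivity]

lemma W1_mono_part (m K : ℕ) (hm : m ≤ K) (x : Fin N → S2) : ∑ n ∈ Finset.Ico m K, UU (n + 1) x / ((n : ℝ) + 1) ≤ W1 K x := by
  unfold W1
  rw [Finset.range_eq_Ico]
  apply Finset.sum_le_sum_of_subset_of_nonneg
  · exact Finset.Ico_subset_Ico_left (Nat.zero_le _)
  · intro n _ _; have := UU_nonneg (n + 1) x; positivity

lemma W1_nonneg (K : ℕ) (x : Fin N → S2) : 0 ≤ W1 K x := 
  Finset.sum_nonneg fun n _ => by have := UU_nonneg (n + 1) x; positivity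

/-- intermediate frequencies -/
lemma W2_mid (m K : ℕ) (hm : m ≤ K) (x : Fin N → S2) : W2 K x ≤ W2 m x + W1 K x / (m + 1) := by
  have h1 : W2 K x = W2 m x + ∑ n ∈ Finset.Ico m K, UU (n + 1) x / ((n : ℝ) + 1) ^ 2 := by
    unfold W2; rw [Finset.sum_range_add_sum_Ico _ hm]
  have h2 : ∑ n ∈ Finset.Ico m K, UU (n + 1) x / ((n : ℝ) + 1) ^ 2 ≤ (∑ n ∈ Finset.Ico m K, UU (n + 1) x / ((n : ℝ) + 1)) / (m + 1) := by
    rw [Finset.sum_div]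
    apply Finset.sum_le_sum
    intro n hn
    have hn' : (m : ℝ) ≤ n := by exact_mod_cast (Finset.mem_Ico.1 hn).1
    have := UU_nonneg (n + 1) x
    rw [sq, ← div_div]
    gcongr
  have h3 := W1_mono_part m K hm x
  rw [h1]
  have : (∑ n ∈ Finset.Ico m K, UU (n + 1) x / ((n : ℝ) + 1)) / (m + 1) ≤ W1 K x / (m + 1) := by gcongr
  linarith

/-- high frequencies -/
lemma W2_tail (hN : 0 < N) (K : ℕ) (x : Fin N → S2) : W2 K x ≤ W2 (2 * N) x + W1 (2 * N) x / N + 1 / 2 := by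
  have hW := W1_nonneg (2 * N) x
  have hN' : (0 : ℝ) < N := by exact_mod_cast hN
  have hw2 : ∀ m, 0 ≤ UU (m + 1) x / ((m : ℝ) + 1) ^ 2 := fun m => by have := UU_nonneg (m + 1) x; positivity
  rcases le_or_gt K (2 * N) with hK | hK
  · have : W2 K x ≤ W2 (2 * N) x := by
      unfold W2
      apply Finset.sum_le_sum_of_subset_of_nonneg
      · intro i hi; simp at *; omega
      · intro n _ _; exact hw2 n
    have : 0 ≤ W1 (2 * N) x / N := by positivity
    linarith
  · have h1 : W2 K x = W2 (2 * N) x + ∑ n ∈ Finset.Ico (2 * N) K, UU (n + 1) x / ((n : ℝ) + 1) ^ 2 := by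
      unfold W2; rw [Finset.sum_range_add_sum_Ico _ hK.le]
    have hS : 0 ≤ SS (2 * N) x := Finset.sum_nonneg fun i _ => Finset.sum_nonneg fun j _ => by have := vv_nonneg (x i) (x j); positivity
    have h2 : ∑ n ∈ Finset.Ico (2 * N) K, UU (n + 1) x / ((n : ℝ) + 1) ^ 2 ≤ SS (2 * N) x * (1 / (2 * N)) := by
      calc _ ≤ ∑ n ∈ Finset.Ico (2 * N) K, SS (2 * N) x * (1 / ((((n - 1 : ℕ) : ℝ) + 1) * (((n - 1 : ℕ) : ℝ) + 1 + 1))) := by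
            apply Finset.sum_le_sum
            intro n hn
            have hn1 := (Finset.mem_Ico.1 hn).1
            have hn2 : (0 : ℝ) < n := by exact_mod_cast (by omega : 0 < n)
            rw [Nat.cast_sub (by omega), Nat.cast_one, sub_add_cancel, mul_one_div]
            have : UU (n + 1) x ≤ SS (2 * N) x := by
              rw [UU_SS]
              have := SS_anti x (show 2 * N ≤ n + 1 by omega)
              have : (0 : ℝ) ≤ N ^ 2 / (((n + 1 : ℕ) : ℝ) + 1) := by positivity
              linarith
            apply div_le_div₀ hS this (by positivity)
            nlinarith
        _ = SS (2 * N) x * ∑ n ∈ Finset.Ico (2 * N - 1) (K - 1), 1 / (((n : ℝ) + 1) * (n + 1 + 1)) := by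
            rw [← Finset.mul_sum]
            congr 1
            have e1 : 2 * N = 2 * N - 1 + 1 := by omega
            have e2 : K = K - 1 + 1 := by omega
            rw [e1, e2, ← Finset.sum_Ico_add' (fun n : ℕ => 1 / ((((n - 1 : ℕ) : ℝ) + 1) * (((n - 1 : ℕ) : ℝ) + 1 + 1)))]
            simp
        _ ≤ _ := by
            apply mul_le_mul_of_nonneg_left _ hS
            rw [tele_sum _ _ (by omega), Nat.cast_sub (by omega)]
            push_cast
            rw [sub_add_cancel]
            have : (0 : ℝ) ≤ 1 / (((K - 1 : ℕ) : ℝ) + 1) := by positivity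
            linarith
    have h3 : SS (2 * N) x * (1 / 2) ≤ W1 (2 * N) x + N ^ 2 * (1 / (N + 1) - 1 / (2 * N + 1)) := by
      have a1 := W1_mono_part N (2 * N) (by omega) x
      have a2 := tele_sum N (2 * N) (by omega)
      push_cast at a2
      have a3 : ∑ n ∈ Finset.Ico N (2 * N), SS (n + 1) x / ((n : ℝ) + 1) = ∑ n ∈ Finset.Ico N (2 * N), UU (n + 1) x / ((n : ℝ) + 1) + N ^ 2 * (1 / (N + 1) - 1 / (2 * N + 1)) := by
        rw [← a2, Finset.mul_sum, ← Finset.sum_add_distrib]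
        apply Finset.sum_congr rfl
        intro n _
        rw [UU_SS]; push_cast; field_simp; ring
      have a4 : SS (2 * N) x * (1 / 2) ≤ ∑ n ∈ Finset.Ico N (2 * N), SS (n + 1) x / ((n : ℝ) + 1) := by
        calc SS (2 * N) x * (1 / 2) = ∑ n ∈ Finset.Ico N (2 * N), SS (2 * N) x / (2 * N) := by
              rw [Finset.sum_const, Nat.card_Ico, nsmul_eq_mul, show 2 * N - N = N by omega]; field_simp
          _ ≤ _ := by
              apply Finset.sum_le_sum
              intro n hn
              have hn1 := (Finset.mem_Ico.1 hn)
              have hn2 : (n : ℝ) + 1 ≤ 2 * N := by exact_mod_cast hn1.2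
              apply div_le_div₀ (hS.trans (SS_anti x (by omega))) (SS_anti x (by omega)) (by positivity) hn2
      linarith
    have h4 : (N : ℝ) ^ 2 * (1 / (N + 1) - 1 / (2 * N + 1)) ≤ N / 2 := by
      rw [div_sub_div _ _ (by positivity) (by positivity), mul_div_assoc', div_le_div_iff₀ (by positivity) (by norm_num)]
      nlinarith [hN', mul_pos hN' hN']
    have h5 : SS (2 * N) x * (1 / (2 * N)) ≤ W1 (2 * N) x / N + 1 / 2 := by
      have : SS (2 * N) x * (1 / (2 * N)) = (SS (2 * N) x * (1 / 2)) / N := by field_simp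
      rw [this, div_add_div _ _ hN'.ne' (by norm_num), div_le_div_iff₀ hN' (by positivity)]
      nlinarith
    linarith

end SE
end

open MeasureTheory Real Metric
open scoped ENNReal RealInnerProductSpace Manifold ContDiff ComplexConjugate

noncomputable section
namespace SE

section Gauss
variable {ι : Type} [Fintype ι]

/-- normalization of the Gaussian density -/
def c0 (ι : Type) [Fintype ι] : ℝ := ∫ w : EuclideanSpace ℝ ι, rexp (-‖w‖ ^ 2)

lemma gauss_integrable : Integrable (fun w : EuclideanSpace ℝ ι => rexp (-‖w‖ ^ 2)) := by
  have h := (GaussianFourier.integrable_cexp_neg_mul_sq_norm_add (b := 1) (by simp) 0 (0 : EuclideanSpace ℝ ι)).norm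
  refine h.congr (Filter.Eventually.of_forall fun w => ?_)
  simp [Complex.norm_exp]
  rw [← Complex.ofReal_pow, Complex.ofReal_re]

lemma c0_pos : 0 < c0 ι := by
  unfold c0
  have := GaussianFourier.integral_rexp_neg_mul_sq_norm (V := EuclideanSpace ℝ ι) (b := 1) (by norm_num)
  simp only [neg_mul, one_mul] at this
  rw [this]; positivity

/-- centered Gaussian probability measure with covariance one half -/
def gam (ι : Type) [Fintype ι] : Measure (EuclideanSpace ℝ ι) :=
  volume.withDensity (fun w => ENNReal.ofReal ((c0 ι)⁻¹ * rexp (-‖w‖ ^ 2)))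

lemma dens_meas : Measurable (fun w : EuclideanSpace ℝ ι => ENNReal.ofReal ((c0 ι)⁻¹ * rexp (-‖w‖ ^ 2))) := by
  fun_prop

lemma lint_gam {f : EuclideanSpace ℝ ι → ℝ≥0∞} (hf : Measurable f) :
    ∫⁻ w, f w ∂(gam ι) = ∫⁻ w, ENNReal.ofReal ((c0 ι)⁻¹ * rexp (-‖w‖ ^ 2)) * f w := by
  rw [gam, lintegral_withDensity_eq_lintegral_mul _ dens_meas hf]; rfl

instance : IsProbabilityMeasure (gam ι) := by
  constructor
  have h := lint_gam (ι := ι) (f := fun _ => 1) measurable_const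
  simp only [lintegral_const, one_mul, mul_one] at h
  rw [h, ← ofReal_integral_eq_lintegral_ofReal (gauss_integrable.const_mul _)]
  · rw [integral_const_mul]
    have := (c0_pos (ι := ι)).ne'
    change ENNReal.ofReal ((c0 ι)⁻¹ * c0 ι) = 1
    rw [inv_mul_cancel₀ this]; simp
  · have := c0_pos (ι := ι)
    exact Filter.Eventually.of_forall fun w => by positivity

lemma gam_shift {f : EuclideanSpace ℝ ι → ℝ≥0∞} (hf : Measurable f) (m : EuclideanSpace ℝ ι) :
    ∫⁻ w, f w ∂(gam ι) = ∫⁻ w, ENNReal.ofReal (rexp (-2 * inner ℝ w m - ‖m‖ ^ 2)) * f (w + m) ∂(gam ι) := by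
  have hc := c0_pos (ι := ι)
  rw [lint_gam hf, lint_gam (by fun_prop), ← lintegral_add_right_eq_self _ m]
  congr 1; ext w
  rw [← mul_assoc, ← ENNReal.ofReal_mul (by positivity), mul_assoc, ← Real.exp_add]
  congr 4
  rw [norm_add_sq_real]; ring

lemma gam_neg : MeasurePreserving (fun w => -w) (gam ι) (gam ι) := by
  refine ⟨measurable_neg, ?_⟩
  ext s hs
  rw [Measure.map_apply measurable_neg hs, ← lintegral_indicator_one hs, ← lintegral_indicator_one (measurable_neg hs), lint_gam (measurable_one.indicator hs),
    lint_gam (measurable_one.indicator (measurable_neg hs)), ← lintegral_neg_eq_self]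
  congr 1; ext w
  simp only [Set.indicator, norm_neg]
  have e : (-w ∈ (fun w : EuclideanSpace ℝ ι => -w) ⁻¹' s) ↔ w ∈ s := by
    simp only [Set.mem_preimage, neg_neg]
  by_cases hw : w ∈ s
  · rw [if_pos (e.2 hw), if_pos hw]
    rfl
  · rw [if_neg (fun h => hw (e.1 h)), if_neg hw]

lemma gam_mgf (a : EuclideanSpace ℝ ι) : ∫⁻ w, ENNReal.ofReal (rexp (inner ℝ w a)) ∂(gam ι) = ENNReal.ofReal (rexp (‖a‖ ^ 2 / 4)) := by
  have h := gam_shift (ι := ι) (f := fun _ => 1) measurable_const (-(1 / 2 : ℝ) • a)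
  simp only [lintegral_const, measure_univ, mul_one] at h
  have e : ∀ w : EuclideanSpace ℝ ι, ENNReal.ofReal (rexp (inner ℝ w a)) = ENNReal.ofReal (rexp (‖a‖ ^ 2 / 4)) * ENNReal.ofReal (rexp (-2 * inner ℝ w (-(1 / 2 : ℝ) • a) - ‖-(1 / 2 : ℝ) • a‖ ^ 2)) := by
    intro w
    rw [← ENNReal.ofReal_mul (exp_pos _).le, ← Real.exp_add, inner_smul_right, norm_smul, mul_pow]
    congr 2
    norm_num; ring
  simp_rw [e]
  rw [lintegral_const_mul _ (by fun_prop), ← h, mul_one]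

lemma gam_exp_int (a : EuclideanSpace ℝ ι) : Integrable (fun w => rexp (inner ℝ w a)) (gam ι) := by
  refine ⟨by fun_prop, ?_⟩
  rw [hasFiniteIntegral_iff_ofReal (Filter.Eventually.of_forall fun w => (exp_pos _).le), gam_mgf]
  exact ENNReal.ofReal_lt_top

lemma gam_exp (a : EuclideanSpace ℝ ι) : ∫ w, rexp (inner ℝ w a) ∂(gam ι) = rexp (‖a‖ ^ 2 / 4) := by
  rw [integral_eq_lintegral_of_nonneg_ae (Filter.Eventually.of_forall fun w => (exp_pos _).le) (by fun_prop), gam_mgf,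
    ENNReal.toReal_ofReal (exp_pos _).le]

lemma gam_lin_int (a : EuclideanSpace ℝ ι) : Integrable (fun w => (inner ℝ w a : ℝ)) (gam ι) := by
  have h1 := gam_exp_int a
  have h2 := gam_exp_int (-a)
  refine (h1.add h2).mono' (by fun_prop) (Filter.Eventually.of_forall fun w => ?_)
  simp only [Pi.add_apply, inner_neg_right, norm_eq_abs]
  have a1 := Real.add_one_le_exp (inner ℝ w a : ℝ)
  have a2 := Real.add_one_le_exp (-(inner ℝ w a : ℝ))
  have a3 := exp_pos (inner ℝ w a : ℝ)
  have a4 := exp_pos (-(inner ℝ w a : ℝ))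
  rw [abs_le]; constructor <;> linarith

lemma gam_lin (a : EuclideanSpace ℝ ι) : ∫ w, (inner ℝ w a : ℝ) ∂(gam ι) = 0 := by
  have h := (gam_neg (ι := ι)).integral_comp (MeasurableEquiv.neg _).measurableEmbedding (fun w => (inner ℝ w a : ℝ))
  simp only [inner_neg_left, integral_neg] at h
  linarith

lemma ofReal_int_le {X : Type*} [MeasurableSpace X] {μ : Measure X} {g f : X → ℝ} (hg : Integrable g μ) (h : ∀ x, g x ≤ f x) :
    ENNReal.ofReal (∫ x, g x ∂μ) ≤ ∫⁻ x, ENNReal.ofReal (f x) ∂μ := by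
  calc ENNReal.ofReal (∫ x, g x ∂μ) ≤ ENNReal.ofReal (∫ x, max (g x) 0 ∂μ) := by
        apply ENNReal.ofReal_le_ofReal
        exact integral_mono hg hg.pos_part fun x => le_max_left _ _
    _ = ∫⁻ x, ENNReal.ofReal (max (g x) 0) ∂μ := ofReal_integral_eq_lintegral_ofReal hg.pos_part (Filter.Eventually.of_forall fun x => le_max_right _ _)
    _ ≤ _ := by
        apply lintegral_mono
        intro x
        change ENNReal.ofReal (max (g x) 0) ≤ ENNReal.ofReal (f x)
        rw [ENNReal.ofReal_max, ENNReal.ofReal_zero]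
        exact max_le (ENNReal.ofReal_le_ofReal (h x)) bot_le

/-- change of measure inequality -/
theorem pac {J : EuclideanSpace ℝ ι → ℝ} (hJm : Measurable J) (hJ0 : ∀ w, 0 ≤ J w) (Y m : EuclideanSpace ℝ ι) (Jt : ℝ) (hJt0 : 0 ≤ Jt)
    (hJt : ∫⁻ w, ENNReal.ofReal (J (w + m)) ∂(gam ι) ≤ ENNReal.ofReal Jt) :
    ENNReal.ofReal (rexp (inner ℝ m Y - ‖m‖ ^ 2 - Jt)) ≤ ∫⁻ w, ENNReal.ofReal (rexp (inner ℝ w Y - J w)) ∂(gam ι) := by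
  have hJi : Integrable (fun w => J (w + m)) (gam ι) := by
    refine ⟨(hJm.comp (measurable_add_const m)).aestronglyMeasurable, ?_⟩
    rw [hasFiniteIntegral_iff_ofReal (Filter.Eventually.of_forall fun w => hJ0 _)]
    exact hJt.trans_lt ENNReal.ofReal_lt_top
  have hJI : ∫ w, J (w + m) ∂(gam ι) ≤ Jt := by
    rw [integral_eq_lintegral_of_nonneg_ae (Filter.Eventually.of_forall fun w => hJ0 _) hJi.1]
    exact ENNReal.toReal_le_of_le_ofReal hJt0 hJt
  rw [gam_shift (by fun_prop) m]
  set c : ℝ := inner ℝ m Y - ‖m‖ ^ 2 - Jt with hc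
  have i1 : Integrable (fun w => (inner ℝ w (Y - (2 : ℝ) • m) : ℝ)) (gam ι) := gam_lin_int _
  have i2 : Integrable (fun w => (inner ℝ w (Y - (2 : ℝ) • m) : ℝ) + (1 + Jt)) (gam ι) := i1.add (integrable_const _)
  have i3 : Integrable (fun w => (inner ℝ w (Y - (2 : ℝ) • m) : ℝ) + (1 + Jt) - J (w + m)) (gam ι) := i2.sub hJi
  have i4 : Integrable (fun w => rexp c * ((inner ℝ w (Y - (2 : ℝ) • m) : ℝ) + (1 + Jt) - J (w + m))) (gam ι) := i3.const_mul _
  have h1 : rexp c ≤ ∫ w, rexp c * ((inner ℝ w (Y - (2 : ℝ) • m) : ℝ) + (1 + Jt) - J (w + m)) ∂(gam ι) := by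
    rw [integral_const_mul, integral_sub i2 hJi, integral_add i1 (integrable_const _), gam_lin]
    simp only [integral_const, probReal_univ, one_smul, zero_add]
    have := exp_pos c
    nlinarith
  refine (ENNReal.ofReal_le_ofReal h1).trans ?_
  have e : ∀ w : EuclideanSpace ℝ ι, ENNReal.ofReal (rexp (-2 * inner ℝ w m - ‖m‖ ^ 2)) * ENNReal.ofReal (rexp (inner ℝ (w + m) Y - J (w + m))) =
      ENNReal.ofReal (rexp (c + ((inner ℝ w (Y - (2 : ℝ) • m) : ℝ) + Jt - J (w + m)))) := by
    intro w
    rw [← ENNReal.ofReal_mul (exp_pos _).le, ← Real.exp_add]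
    congr 2
    rw [inner_sub_right, inner_smul_right, inner_add_left, hc]; ring
  simp_rw [e]
  apply ofReal_int_le i4
  intro w
  rw [Real.exp_add]
  apply mul_le_mul_of_nonneg_left _ (exp_pos _).le
  have := Real.add_one_le_exp ((inner ℝ w (Y - (2 : ℝ) • m) : ℝ) + Jt - J (w + m))
  linarith

end Gauss

end SE
end

open MeasureTheory Real Metric
open scoped ENNReal RealInnerProductSpace Manifold ContDiff ComplexConjugate

noncomputable section
namespace SE

/-- kernels with a finite dimensional continuous feature map -/
def HasFeat (k : S2 → S2 → ℝ) : Prop := ∃ (ι : Type) (_ : Fintype ι) (F : S2 → ι → ℝ),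
  (∀ i, Continuous fun x => F x i) ∧ ∀ x y, k x y = ∑ i, F x i * F y i

lemma HasFeat.add {k k' : S2 → S2 → ℝ} (h : HasFeat k) (h' : HasFeat k') : HasFeat (fun x y => k x y + k' x y) := by
  obtain ⟨ι, i1, F, hF, hk⟩ := h
  obtain ⟨κ, i2, G, hG, hk'⟩ := h'
  refine ⟨ι ⊕ κ, inferInstance, fun x => Sum.elim (F x) (G x), ?_, ?_⟩
  · rintro (i | i)
    · exact hF i
    · exact hG i
  · intro x y
    simp only [Fintype.sum_sum_type, hk, hk', Sum.elim_inl, Sum.elim_inr]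

lemma HasFeat.mul {k k' : S2 → S2 → ℝ} (h : HasFeat k) (h' : HasFeat k') : HasFeat (fun x y => k x y * k' x y) := by
  obtain ⟨ι, i1, F, hF, hk⟩ := h
  obtain ⟨κ, i2, G, hG, hk'⟩ := h'
  refine ⟨ι × κ, inferInstance, fun x p => F x p.1 * G x p.2, fun p => (hF p.1).mul (hG p.2), ?_⟩
  intro x y
  simp only [hk, hk', Finset.sum_mul_sum, Fintype.sum_prod_type]
  refine Finset.sum_congr rfl fun i _ => Finset.sum_congr rfl fun j _ => ?_
  ring

lemma HasFeat.const {c : ℝ} (hc : 0 ≤ c) : HasFeat (fun _ _ => c) := by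
  refine ⟨Unit, inferInstance, fun _ _ => √c, fun _ => continuous_const, ?_⟩
  intro x y
  simp [Real.mul_self_sqrt hc]

lemma HasFeat.ip : HasFeat ip := by
  refine ⟨Fin 3, inferInstance, fun x i => (x : E3) i, fun i => by fun_prop, ?_⟩
  intro x y
  unfold SE.ip
  rw [PiLp.inner_apply]
  refine Finset.sum_congr rfl fun i _ => ?_
  simp [mul_comm]

lemma HasFeat.vv : HasFeat vv := by
  have := (HasFeat.const (c := 1 / 2) (by norm_num)).mul ((HasFeat.const (c := 1) (by norm_num)).add HasFeat.ip)
  convert this using 3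
  unfold SE.vv; ring

lemma HasFeat.pow {k : S2 → S2 → ℝ} (h : HasFeat k) (n : ℕ) : HasFeat (fun x y => k x y ^ n) := by
  induction n with
  | zero => simpa using HasFeat.const (c := 1) (by norm_num)
  | succ n ih => simpa [pow_succ] using ih.mul h

/-- the truncated kernel -/
def kf (n0 : ℕ) (x y : S2) : ℝ := ∑ n ∈ Finset.range n0, vv x y ^ (n + 1) / ((n : ℝ) + 1) ^ 2

lemma HasFeat.kf (n0 : ℕ) : HasFeat (kf n0) := by
  induction n0 with
  | zero =>
    have e : SE.kf 0 = fun _ _ => (0 : ℝ) := by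
      ext x y; simp [SE.kf]
    rw [e]; exact HasFeat.const le_rfl
  | succ n ih =>
    have := ih.add ((HasFeat.vv.pow (n + 1)).mul (HasFeat.const (c := (((n : ℝ) + 1) ^ 2)⁻¹) (by positivity)))
    convert this using 3
    unfold SE.kf
    rw [Finset.sum_range_succ, div_eq_mul_inv (_ ^ _)]

lemma exists_feat (n0 : ℕ) : ∃ (ι : Type) (_ : Fintype ι) (F : S2 → EuclideanSpace ℝ ι),
    Continuous F ∧ ∀ x y, inner ℝ (F x) (F y) = kf n0 x y := by
  obtain ⟨ι, i1, F, hF, hk⟩ := HasFeat.kf n0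
  refine ⟨ι, i1, fun x => WithLp.toLp 2 (F x), ?_, ?_⟩
  · have := continuous_pi hF
    fun_prop
  · intro x y
    rw [PiLp.inner_apply, hk]
    refine Finset.sum_congr rfl fun i _ => ?_
    simp [mul_comm]

section OpNorm
variable {ι : Type} [Fintype ι] {n0 : ℕ} {F : S2 → EuclideanSpace ℝ ι}

lemma form_bz (n L : ℕ) (hL : n ≤ L) {g : S2 → ℝ} (hg : Continuous g) :
    ∫ x, g x * bz n g x ∂sphereUniform = ∑ l ∈ Finset.range (L + 1), be n l * qf l g := by
  have hc : ∀ l, Continuous (pr l g) := fun l => continuous_pr l hg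
  simp only [bz_eq' n L hL hg, Finset.mul_sum]
  rw [integral_finsetSum _ (fun i _ => integrable_cont (by fun_prop))]
  refine Finset.sum_congr rfl fun l _ => ?_
  unfold qf
  rw [← integral_const_mul]
  congr 1; ext x; ring

lemma energy_eq (n : ℕ) {h : S2 → ℝ} (hh : Continuous h) :
    ∫ p : S2 × S2, vv p.1 p.2 ^ n * (h p.2 - h p.1) ^ 2 ∂(sphereUniform.prod sphereUniform) =
      2 / (n + 1) * (∫ x, h x ^ 2 ∂sphereUniform - ∫ x, h x * bz n h x ∂sphereUniform) := by
  have hb := continuous_bz n hh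
  have c1 : Continuous fun p : S2 × S2 => vv p.1 p.2 ^ n * (h p.2 - h p.1) ^ 2 := by fun_prop
  rw [integral_prod _ (integrable_cont c1)]
  have e1 : ∀ x, ∫ y, vv x y ^ n * (h y - h x) ^ 2 ∂sphereUniform =
      ∫ y, vv x y ^ n * h y ^ 2 ∂sphereUniform + (h x ^ 2 * (1 / (n + 1)) - 2 / (n + 1) * (h x * bz n h x)) := by
    intro x
    rw [← int_vv n x]
    have : 2 / ((n : ℝ) + 1) * (h x * bz n h x) = ∫ y, 2 * h x * (vv x y ^ n * h y) ∂sphereUniform := by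
      unfold bz
      rw [← mul_assoc, ← integral_const_mul]
      congr 1; ext y; field_simp
    rw [this, ← integral_const_mul, ← integral_sub (integrable_cont (by fun_prop)) (integrable_cont (by fun_prop)),
      ← integral_add (integrable_cont (by fun_prop)) (integrable_cont (by fun_prop))]
    congr 1; ext y; ring
  simp only [e1]
  have c2 : Continuous fun x => ∫ y, vv x y ^ n * h y ^ 2 ∂sphereUniform := continuous_op (K := fun x y => vv x y ^ n * h y ^ 2) (by fun_prop)
  rw [integral_add (integrable_cont c2) (integrable_cont (by fun_prop)), integral_sub (integrable_cont (by fun_prop)) (integrable_cont (by fun_prop)),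
    swap_cont (f := fun x y => vv x y ^ n * h y ^ 2) (by fun_prop)]
  have e2 : ∀ y, ∫ x, vv x y ^ n * h y ^ 2 ∂sphereUniform = h y ^ 2 * (1 / (n + 1)) := by
    intro y
    rw [integral_mul_const, ← int_vv n y, mul_comm]
    simp only [vv_comm]
  simp only [e2]
  rw [integral_mul_const, integral_const_mul]
  field_simp; ring

lemma op_norm (hF : Continuous F) (hk : ∀ x y, inner ℝ (F x) (F y) = kf n0 x y) (n : ℕ) (m : EuclideanSpace ℝ ι) :
    ∫ p : S2 × S2, vv p.1 p.2 ^ n * (inner ℝ m (F p.2) - inner ℝ m (F p.1)) ^ 2 ∂(sphereUniform.prod sphereUniform) ≤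
      ‖m‖ ^ 2 / ((n + 1) * (n + 2)) := by
  set h : S2 → ℝ := fun x => inner ℝ m (F x) with hh
  have hc : Continuous h := by fun_prop
  have hb := continuous_bz n hc
  rw [energy_eq n hc]
  set A : ℝ := ∫ x, h x ^ 2 ∂sphereUniform - ∫ x, h x * bz n h x ∂sphereUniform with hA
  set g : S2 → ℝ := fun x => h x - bz n h x with hg
  have gc : Continuous g := by fun_prop
  set M := max n n0 with hM
  have hA1 : ∑ l ∈ Finset.range (M + 1), (1 - be n l) * qf l h ≤ A := by
    have := bessel (M + 1) hc
    rw [hA, form_bz n M (le_max_left _ _) hc]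
    simp only [sub_mul, one_mul, Finset.sum_sub_distrib]
    linarith
  have hA0 : 0 ≤ A := le_trans (Finset.sum_nonneg fun l _ => mul_nonneg (by linarith [be_le_one n l]) (qf_nonneg l hc)) hA1
  -- the quadratic form of the kernel on g
  have hB : ∑ i, (∫ x, F x i * g x ∂sphereUniform) ^ 2 ≤ A / (2 * (n + 2)) := by
    have b1 : ∑ i, (∫ x, F x i * g x ∂sphereUniform) ^ 2 = ∑ k ∈ Finset.range n0, 1 / ((k : ℝ) + 1) ^ 2 * (1 / (k + 2) * ∫ x, g x * bz (k + 1) g x ∂sphereUniform) := by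
      have e1 : ∀ i, (∫ x, F x i * g x ∂sphereUniform) ^ 2 = ∫ x, ∫ y, (F x i * F y i) * (g x * g y) ∂sphereUniform ∂sphereUniform := by
        intro i
        rw [sq, ← integral_mul_const]
        congr 1; ext x
        rw [← integral_const_mul]
        congr 1; ext y; ring
      have e2 : ∀ k : ℕ, 1 / ((k : ℝ) + 1) ^ 2 * (1 / (k + 2) * ∫ x, g x * bz (k + 1) g x ∂sphereUniform) =
          ∫ x, ∫ y, (vv x y ^ (k + 1) / ((k : ℝ) + 1) ^ 2) * (g x * g y) ∂sphereUniform ∂sphereUniform := by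
        intro k
        unfold bz
        rw [← mul_assoc, ← integral_const_mul]
        congr 1; ext x
        rw [← mul_assoc, ← integral_const_mul]
        congr 1; ext y; push_cast; field_simp; ring
      simp only [e1, e2]
      have cF : ∀ i, Continuous fun x => F x i := fun i => by fun_prop
      rw [← integral_finsetSum _ (fun i _ => integrable_cont (continuous_op (K := fun x y => (F x i * F y i) * (g x * g y)) (by fun_prop))),
        ← integral_finsetSum _ (fun (i : ℕ) _ => integrable_cont (continuous_op (K := fun x y => (vv x y ^ (i + 1) / ((i : ℝ) + 1) ^ 2) * (g x * g y)) (by fun_prop)))]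
      congr 1; ext x
      rw [← integral_finsetSum _ (fun i _ => integrable_cont (by fun_prop)), ← integral_finsetSum _ (fun i _ => integrable_cont (by fun_prop))]
      congr 1; ext y
      rw [← Finset.sum_mul, ← Finset.sum_mul]
      congr 1
      have := hk x y
      unfold kf at this
      rw [← this, PiLp.inner_apply]
      refine Finset.sum_congr rfl fun i _ => ?_
      simp [mul_comm]
    rw [b1]
    have b2 : ∀ k ∈ Finset.range n0, 1 / ((k : ℝ) + 1) ^ 2 * (1 / (k + 2) * ∫ x, g x * bz (k + 1) g x ∂sphereUniform) =
        ∑ l ∈ Finset.range (M + 1), II (k + 1) l / (k + 1) ^ 2 * ((1 - be n l) ^ 2 * qf l h) := by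
      intro k hkk
      have : k + 1 ≤ M := by
        have := Finset.mem_range.1 hkk
        exact le_trans (by omega) (le_max_right n n0)
      rw [form_bz (k + 1) M this gc, Finset.mul_sum, Finset.mul_sum]
      refine Finset.sum_congr rfl fun l _ => ?_
      rw [qf_sub_bz n l hc]
      unfold be
      push_cast; field_simp; ring
    rw [Finset.sum_congr rfl b2, Finset.sum_comm]
    calc _ ≤ ∑ l ∈ Finset.range (M + 1), 1 / (2 * (n + 2)) * ((1 - be n l) * qf l h) := by
          refine Finset.sum_le_sum fun l _ => ?_
          rw [← Finset.sum_mul]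
          rcases Nat.eq_zero_or_pos l with rfl | hl
          · simp [be_zero]
          have t := tel2_le n0 l hl
          have l2 := two_le_lam hl
          have q := qf_nonneg l hc
          have o := one_sub_be_le n l
          have o1 : 0 ≤ 1 - be n l := by linarith [be_le_one n l]
          have o2 : (1 - be n l) ^ 2 * qf l h ≤ lam l / (n + 2) * ((1 - be n l) * qf l h) := by
            rw [sq, mul_assoc]; exact mul_le_mul_of_nonneg_right o (by positivity)
          calc _ ≤ 1 / lam l ^ 2 * (lam l / (n + 2) * ((1 - be n l) * qf l h)) := by
                apply mul_le_mul t o2 (by positivity) (by positivity)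
            _ = 1 / lam l * (1 / (n + 2) * ((1 - be n l) * qf l h)) := by
                have : lam l ≠ 0 := by linarith
                field_simp
            _ ≤ 1 / 2 * (1 / (n + 2) * ((1 - be n l) * qf l h)) := by
                apply mul_le_mul_of_nonneg_right _ (by positivity)
                exact one_div_le_one_div_of_le (by norm_num) l2
            _ = _ := by
                have : (n : ℝ) + 2 ≠ 0 := by positivity
                field_simp
      _ ≤ _ := by
          rw [← Finset.mul_sum, one_div_mul_eq_div]
          gcongr
  have hA2 : A = ∑ i, m i * ∫ x, F x i * g x ∂sphereUniform := by
    have cF : ∀ i, Continuous fun x => F x i := fun i => by fun_prop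
    rw [hA, ← integral_sub (integrable_cont (by fun_prop)) (integrable_cont (by fun_prop))]
    simp only [← integral_const_mul]
    rw [← integral_finsetSum _ (fun i _ => integrable_cont (by fun_prop))]
    congr 1; ext x
    have : h x = ∑ i, m i * F x i := by
      simp only [hh, PiLp.inner_apply]
      refine Finset.sum_congr rfl fun i _ => ?_
      simp [mul_comm]
    simp only [← mul_assoc]
    rw [← Finset.sum_mul, ← this, hg]; ring
  have hCS : A ^ 2 ≤ ‖m‖ ^ 2 * (A / (2 * (n + 2))) := by
    have := Finset.sum_mul_sq_le_sq_mul_sq Finset.univ (fun i => m i) (fun i => ∫ x, F x i * g x ∂sphereUniform)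
    rw [← hA2] at this
    have e : ‖m‖ ^ 2 = ∑ i, m i ^ 2 := by simp [EuclideanSpace.norm_sq_eq]
    rw [e]
    exact this.trans (mul_le_mul_of_nonneg_left hB (Finset.sum_nonneg fun i _ => sq_nonneg _))
  have hfin : A ≤ ‖m‖ ^ 2 / (2 * (n + 2)) := by
    rcases hA0.eq_or_lt with h0 | h0
    · rw [← h0]; positivity
    · have : A * A ≤ (‖m‖ ^ 2 / (2 * (n + 2))) * A := by
        calc A * A = A ^ 2 := by ring
          _ ≤ _ := hCS
          _ = _ := by ring
      exact le_of_mul_le_mul_right this h0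
  calc 2 / ((n : ℝ) + 1) * A ≤ 2 / ((n : ℝ) + 1) * (‖m‖ ^ 2 / (2 * (n + 2))) := by gcongr
    _ = _ := by field_simp

end OpNorm

end SE
end

open MeasureTheory Real Metric
open scoped ENNReal RealInnerProductSpace Manifold ContDiff ComplexConjugate

noncomputable section
namespace SE

lemma fact_bound (k : ℕ) : 2 * 12 ^ k * k.factorial ≤ (2 * (k + 1)).factorial := by
  induction k with
  | zero => simp
  | succ k ih =>
    have e : (2 * (k + 1 + 1)).factorial = (2 * (k + 1) + 2) * ((2 * (k + 1) + 1) * (2 * (k + 1)).factorial) := by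
      rw [show 2 * (k + 1 + 1) = (2 * (k + 1) + 1) + 1 by ring, Nat.factorial_succ, Nat.factorial_succ]
    rw [e, Nat.factorial_succ, pow_succ]
    calc 2 * (12 ^ k * 12) * ((k + 1) * k.factorial) = (12 * (k + 1)) * (2 * 12 ^ k * k.factorial) := by ring
      _ ≤ ((2 * (k + 1) + 2) * (2 * (k + 1) + 1)) * (2 * (k + 1)).factorial := by
          apply Nat.mul_le_mul _ ih
          nlinarith
      _ = _ := by ring

lemma cosh_bound (d : ℝ) : cosh d - 1 ≤ 1 / 2 * d ^ 2 * rexp (d ^ 2 / 12) := by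
  have h1 := Real.hasSum_cosh d
  have h2 : HasSum (fun k : ℕ => d ^ (2 * (k + 1)) / ((2 * (k + 1)).factorial : ℝ)) (cosh d - 1) := by
    have := (hasSum_nat_add_iff' (f := fun k : ℕ => d ^ (2 * k) / ((2 * k).factorial : ℝ)) 1).2 h1
    simpa using this
  have h3 : HasSum (fun k : ℕ => 1 / 2 * d ^ 2 * ((d ^ 2 / 12) ^ k / (k.factorial : ℝ))) (1 / 2 * d ^ 2 * rexp (d ^ 2 / 12)) := by
    apply HasSum.mul_left
    rw [Real.exp_eq_exp_ℝ]
    exact NormedSpace.expSeries_div_hasSum_exp (d ^ 2 / 12)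
  refine hasSum_le (fun k => ?_) h2 h3
  have f : (2 * 12 ^ k * k.factorial : ℝ) ≤ ((2 * (k + 1)).factorial : ℝ) := by exact_mod_cast fact_bound k
  have fp : (0 : ℝ) < k.factorial := by exact_mod_cast k.factorial_pos
  calc d ^ (2 * (k + 1)) / ((2 * (k + 1)).factorial : ℝ) ≤ d ^ (2 * (k + 1)) / (2 * 12 ^ k * k.factorial : ℝ) := by
        apply div_le_div_of_nonneg_left _ (by positivity) f
        rw [pow_mul]; positivity
    _ = _ := by
        rw [pow_mul, div_pow, pow_succ]; field_simp

lemma vpow_exp {v κ : ℝ} {k n : ℕ} (hv0 : 0 ≤ v) (hκ : κ ≤ k) (hv1 : v ≤ 1) (hkn : k ≤ n) :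
    v ^ n * rexp (κ * (1 - v)) ≤ v ^ (n - k) := by
  have h1 : v ^ k * rexp (κ * (1 - v)) ≤ 1 := by
    have : v ≤ rexp (-(1 - v)) := by
      have := Real.add_one_le_exp (-(1 - v)); linarith
    calc v ^ k * rexp (κ * (1 - v)) ≤ rexp (-(1 - v)) ^ k * rexp (κ * (1 - v)) := by gcongr
      _ = rexp (-(k - κ) * (1 - v)) := by rw [← Real.exp_nat_mul, ← Real.exp_add]; congr 1; ring
      _ ≤ 1 := by
          apply Real.exp_le_one_iff.2
          have : 0 ≤ (k - κ) * (1 - v) := mul_nonneg (by linarith) (by linarith)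
          linarith
  calc v ^ n * rexp (κ * (1 - v)) = v ^ (n - k) * (v ^ k * rexp (κ * (1 - v))) := by
        rw [← mul_assoc, ← pow_add, Nat.sub_add_cancel hkn]
    _ ≤ v ^ (n - k) * 1 := by gcongr
    _ = _ := mul_one _

section Low
variable {ι : Type} [Fintype ι] {n0 : ℕ} {F : S2 → EuclideanSpace ℝ ι} {N : ℕ}

/-- the vector of discrepancies -/
def YY (F : S2 → EuclideanSpace ℝ ι) {N : ℕ} (x : Fin N → S2) : EuclideanSpace ℝ ι :=
  ∑ i, F (x i) - (N : ℝ) • ∫ y, F y ∂sphereUniform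

lemma integrable_feat (hF : Continuous F) : Integrable F sphereUniform :=
  integrableOn_univ.1 (hF.continuousOn.integrableOn_compact isCompact_univ)

lemma inner_YY (hF : Continuous F) (w : EuclideanSpace ℝ ι) (x : Fin N → S2) :
    inner ℝ w (YY F x) = ∑ i, inner ℝ w (F (x i)) - N * ∫ y, inner ℝ w (F y) ∂sphereUniform := by
  unfold YY
  rw [inner_sub_right, inner_sum, inner_smul_right, integral_inner (integrable_feat hF)]

lemma continuous_YY (hF : Continuous F) : Continuous (fun x : Fin N → S2 => YY F x) := by
  unfold YY
  fun_prop

lemma int_kf (n0 : ℕ) (x : S2) : ∫ y, kf n0 x y ∂sphereUniform = ∑ n ∈ Finset.range n0, 1 / (((n + 1 : ℕ) : ℝ) + 1) / ((n : ℝ) + 1) ^ 2 := by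
  unfold kf
  rw [integral_finsetSum _ (fun i _ => integrable_cont (by fun_prop))]
  refine Finset.sum_congr rfl fun n _ => ?_
  rw [integral_div, int_vv]

lemma norm_YY (hF : Continuous F) (hk : ∀ x y, inner ℝ (F x) (F y) = kf n0 x y) (x : Fin N → S2) :
    ‖YY F x‖ ^ 2 = W2 n0 x := by
  set c : ℝ := ∑ n ∈ Finset.range n0, 1 / (((n + 1 : ℕ) : ℝ) + 1) / ((n : ℝ) + 1) ^ 2 with hc
  have h1 : ∀ a, inner ℝ (F a) (∫ y, F y ∂sphereUniform) = c := by
    intro a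
    rw [← integral_inner (integrable_feat hF)]
    simp only [hk]; exact int_kf n0 a
  have h2 : inner ℝ (∫ y, F y ∂sphereUniform) (∫ y, F y ∂sphereUniform) = c := by
    rw [← integral_inner (integrable_feat hF)]
    simp only [real_inner_comm, h1]
    simp
  have h3 : ‖YY F x‖ ^ 2 = ∑ i, ∑ j, (kf n0 (x i) (x j) - c) := by
    rw [← real_inner_self_eq_norm_sq]
    unfold YY
    simp only [inner_sub_left, inner_sub_right, inner_sum, sum_inner, inner_smul_left, inner_smul_right, h1, h2, hk,
      Finset.sum_sub_distrib, Finset.sum_const, Finset.card_univ, Fintype.card_fin, nsmul_eq_mul]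
    have h4 : ∀ i, inner ℝ (∫ y, F y ∂sphereUniform) (F (x i)) = c := fun i => by rw [real_inner_comm, h1]
    simp [h4, kf, vv_comm]
    try ring
  rw [h3]
  unfold W2 UU
  simp only [Finset.sum_div]
  rw [Finset.sum_comm (s := Finset.range n0)]
  refine Finset.sum_congr rfl fun i _ => ?_
  rw [Finset.sum_comm (s := Finset.range n0)]
  refine Finset.sum_congr rfl fun j _ => ?_
  rw [hc, kf, ← Finset.sum_sub_distrib]
  refine Finset.sum_congr rfl fun n _ => ?_
  rw [sub_div]

lemma feat_dist (hk : ∀ x y, inner ℝ (F x) (F y) = kf n0 x y) (x y : S2) : ‖F y - F x‖ ^ 2 ≤ 2 * (1 - vv x y) * HH n0 := by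
  rw [norm_sub_sq_real, ← real_inner_self_eq_norm_sq, ← real_inner_self_eq_norm_sq, hk, hk, hk]
  unfold kf HH
  simp only [vv_self, one_pow, Finset.mul_sum]
  rw [← Finset.sum_sub_distrib, ← Finset.sum_add_distrib]
  refine Finset.sum_le_sum fun n _ => ?_
  have h : 1 - vv x y ^ (n + 1) ≤ (n + 1) * (1 - vv x y) := by
    have := one_add_mul_le_pow (a := vv x y - 1) (by linarith [vv_nonneg x y]) (n + 1)
    push_cast at this
    rw [show 1 + (vv x y - 1) = vv x y by ring] at this
    linarith
  rw [vv_comm y x]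
  calc _ = 2 * (1 - vv x y ^ (n + 1)) / ((n : ℝ) + 1) ^ 2 := by ring
    _ ≤ 2 * ((n + 1) * (1 - vv x y)) / ((n : ℝ) + 1) ^ 2 := by gcongr
    _ = _ := by field_simp

/-- the exponent -/
def JJ (N : ℕ) (F : S2 → EuclideanSpace ℝ ι) (w : EuclideanSpace ℝ ι) : ℝ := QQ N (fun x => inner ℝ w (F x))

lemma cosh_gam (c : ℝ) (a : EuclideanSpace ℝ ι) : Integrable (fun w => cosh (inner ℝ w a + c)) (gam ι) ∧
    ∫ w, cosh (inner ℝ w a + c) ∂(gam ι) = cosh c * rexp (‖a‖ ^ 2 / 4) := by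
  have i1 := gam_exp_int a
  have i2 := gam_exp_int (-a)
  have e : ∀ w, cosh (inner ℝ w a + c) = rexp c / 2 * rexp (inner ℝ w a) + rexp (-c) / 2 * rexp (inner ℝ w (-a)) := by
    intro w
    rw [Real.cosh_eq, inner_neg_right, neg_add, Real.exp_add, Real.exp_add]; ring
  simp only [e]
  refine ⟨(i1.const_mul _).add (i2.const_mul _), ?_⟩
  rw [integral_add (i1.const_mul _) (i2.const_mul _), integral_const_mul, integral_const_mul, gam_exp, gam_exp, norm_neg, Real.cosh_eq]
  ring

/-- the averaged exponent -/
def JT (N : ℕ) (F : S2 → EuclideanSpace ℝ ι) (m : EuclideanSpace ℝ ι) : ℝ :=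
  ∫ p : S2 × S2, N ^ 2 * (vv p.1 p.2 ^ (N - 1) * (cosh (inner ℝ m (F p.2 - F p.1)) * rexp (‖F p.2 - F p.1‖ ^ 2 / 4) - 1)) ∂(sphereUniform.prod sphereUniform)

lemma JJ_eq (w : EuclideanSpace ℝ ι) : JJ N F w =
    ∫ p : S2 × S2, N ^ 2 * (vv p.1 p.2 ^ (N - 1) * (cosh (inner ℝ w (F p.2 - F p.1)) - 1)) ∂(sphereUniform.prod sphereUniform) := by
  unfold JJ QQ
  rw [← integral_const_mul]
  simp only [inner_sub_right]

lemma JJ_nonneg (w : EuclideanSpace ℝ ι) : 0 ≤ JJ N F w := by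
  rw [JJ_eq]
  refine integral_nonneg fun p => ?_
  have := vv_nonneg p.1 p.2
  have := Real.one_le_cosh (inner ℝ w (F p.2 - F p.1))
  exact mul_nonneg (by positivity) (mul_nonneg (by positivity) (by linarith))

lemma JT_int_nonneg (m : EuclideanSpace ℝ ι) (p : S2 × S2) : 0 ≤ N ^ 2 * (vv p.1 p.2 ^ (N - 1) * (cosh (inner ℝ m (F p.2 - F p.1)) * rexp (‖F p.2 - F p.1‖ ^ 2 / 4) - 1)) := by
  have := vv_nonneg p.1 p.2
  have := Real.one_le_cosh (inner ℝ m (F p.2 - F p.1))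
  have := Real.one_le_exp (x := ‖F p.2 - F p.1‖ ^ 2 / 4) (by positivity)
  exact mul_nonneg (by positivity) (mul_nonneg (by positivity) (by nlinarith))

lemma continuous_JJ (hF : Continuous F) : Continuous (JJ N F) := by
  have e : JJ N F = fun w => ∫ p : S2 × S2, N ^ 2 * (vv p.1 p.2 ^ (N - 1) * (cosh (inner ℝ w (F p.2 - F p.1)) - 1)) ∂(sphereUniform.prod sphereUniform) := by
    ext w; exact JJ_eq w
  rw [e]
  have := continuous_parametric_integral_of_continuous (μ := sphereUniform.prod sphereUniform)
    (f := fun (w : EuclideanSpace ℝ ι) (p : S2 × S2) => (N : ℝ) ^ 2 * (vv p.1 p.2 ^ (N - 1) * (cosh (inner ℝ w (F p.2 - F p.1)) - 1))) (by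
      have h1 := Real.continuous_cosh
      simp only [Function.uncurry_def]
      fun_prop) (s := Set.univ) isCompact_univ
  simpa using this

lemma JJ_avg (hF : Continuous F) (m : EuclideanSpace ℝ ι) :
    ∫⁻ w, ENNReal.ofReal (JJ N F (w + m)) ∂(gam ι) ≤ ENNReal.ofReal (JT N F m) := by
  have hch := Real.continuous_cosh
  have e1 : ∀ w, ENNReal.ofReal (JJ N F (w + m)) = ∫⁻ p : S2 × S2, ENNReal.ofReal (N ^ 2 * (vv p.1 p.2 ^ (N - 1) * (cosh (inner ℝ (w + m) (F p.2 - F p.1)) - 1))) ∂(sphereUniform.prod sphereUniform) := by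
    intro w
    rw [JJ_eq, ofReal_integral_eq_lintegral_ofReal (integrable_cont (by fun_prop))]
    refine Filter.Eventually.of_forall fun p => ?_
    have := vv_nonneg p.1 p.2
    have := Real.one_le_cosh (inner ℝ (w + m) (F p.2 - F p.1))
    exact mul_nonneg (by positivity) (mul_nonneg (by positivity) (by linarith))
  simp only [e1]
  rw [lintegral_lintegral_swap (by
    apply Measurable.aemeasurable
    apply ENNReal.measurable_ofReal.comp
    apply Continuous.measurable
    fun_prop)]
  unfold JT
  rw [ofReal_integral_eq_lintegral_ofReal (integrable_cont (by fun_prop)) (Filter.Eventually.of_forall fun p => JT_int_nonneg m p)]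
  apply lintegral_mono
  intro p
  obtain ⟨i1, i2⟩ := cosh_gam (inner ℝ m (F p.2 - F p.1)) (F p.2 - F p.1)
  have i3 : Integrable (fun w => cosh (inner ℝ w (F p.2 - F p.1) + inner ℝ m (F p.2 - F p.1)) - 1) (gam ι) := i1.sub (integrable_const _)
  have i4 : Integrable (fun w => (N : ℝ) ^ 2 * (vv p.1 p.2 ^ (N - 1) * (cosh (inner ℝ w (F p.2 - F p.1) + inner ℝ m (F p.2 - F p.1)) - 1))) (gam ι) := (i3.const_mul _).const_mul _
  simp only [inner_add_left]
  rw [← ofReal_integral_eq_lintegral_ofReal i4, integral_const_mul, integral_const_mul, integral_sub i1 (integrable_const _), i2]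
  · simp
  · refine Filter.Eventually.of_forall fun w => ?_
    have := vv_nonneg p.1 p.2
    have := Real.one_le_cosh (inner ℝ w (F p.2 - F p.1) + inner ℝ m (F p.2 - F p.1))
    exact mul_nonneg (by positivity) (mul_nonneg (by positivity) (by linarith))

lemma low_set (hN : 0 < N) (hF : Continuous F) (t : ℝ) : ∃ E : Set (Fin N → S2),
    sphericalEnsemble N E ≤ ENNReal.ofReal (rexp (-t)) ∧ ∀ x ∉ E, ∀ m, inner ℝ m (YY F x) ≤ ‖m‖ ^ 2 + t + JT N F m := by
  have := ens_prob hN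
  have hJ := continuous_JJ (N := N) hF
  have hY := continuous_YY (N := N) hF
  set Zf : (Fin N → S2) → ℝ≥0∞ := fun x => ∫⁻ w, ENNReal.ofReal (rexp (inner ℝ w (YY F x) - JJ N F w)) ∂(gam ι) with hZ
  have hm : Measurable (fun q : (Fin N → S2) × EuclideanSpace ℝ ι => ENNReal.ofReal (rexp (inner ℝ q.2 (YY F q.1) - JJ N F q.2))) := by
    apply ENNReal.measurable_ofReal.comp
    apply Continuous.measurable
    fun_prop
  have hZm : Measurable Zf := hm.lintegral_prod_right'
  have hZ1 : ∫⁻ x, Zf x ∂(sphericalEnsemble N) ≤ 1 := by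
    rw [hZ, lintegral_lintegral_swap hm.aemeasurable]
    calc _ ≤ ∫⁻ w, 1 ∂(gam ι) := by
          apply lintegral_mono
          intro w
          have := ens_laplace hN (u := fun y => inner ℝ w (F y)) (by fun_prop)
          simp only [inner_YY hF]
          exact this
      _ = 1 := by simp
  refine ⟨{x | ENNReal.ofReal (rexp t) ≤ Zf x}, ?_, ?_⟩
  · have h := mul_meas_ge_le_lintegral hZm (μ := sphericalEnsemble N) (ENNReal.ofReal (rexp t))
    have h2 := h.trans hZ1
    rw [Real.exp_neg, ENNReal.ofReal_inv_of_pos (exp_pos t)]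
    rw [mul_comm] at h2
    exact ENNReal.le_inv_iff_mul_le.2 h2
  · intro x hx m
    simp only [Set.mem_ofPred_eq, not_le] at hx
    have h := pac hJ.measurable JJ_nonneg (YY F x) m (JT N F m) (integral_nonneg fun p => JT_int_nonneg m p) (JJ_avg hF m)
    have h2 := h.trans_lt hx
    rw [ENNReal.ofReal_lt_ofReal_iff (exp_pos _), Real.exp_lt_exp] at h2
    linarith

lemma int_v1v (n : ℕ) : ∫ p : S2 × S2, vv p.1 p.2 ^ n * (1 - vv p.1 p.2) ∂(sphereUniform.prod sphereUniform) = 1 / (((n : ℝ) + 1) * (n + 2)) := by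
  rw [integral_prod _ (integrable_cont (by fun_prop))]
  have : ∀ x, ∫ y, vv x y ^ n * (1 - vv x y) ∂sphereUniform = 1 / (((n : ℝ) + 1) * (n + 2)) := by
    intro x
    have e : ∀ y, vv x y ^ n * (1 - vv x y) = vv x y ^ n - vv x y ^ (n + 1) := fun y => by ring
    simp only [e]
    rw [integral_sub (integrable_cont (by fun_prop)) (integrable_cont (by fun_prop)), int_vv, int_vv]
    push_cast
    field_simp; ring
  simp [this]

lemma JT_bound (hF : Continuous F) (hk : ∀ x y, inner ℝ (F x) (F y) = kf n0 x y) (m : EuclideanSpace ℝ ι) (k1 k2 : ℕ)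
    (h1 : k1 < N) (h2 : k2 < N) (hk1 : HH n0 * (‖m‖ ^ 2 / 6 + 1 / 2) ≤ k1) (hk2 : HH n0 / 2 ≤ k2) :
    JT N F m ≤ N ^ 2 * (1 / 2 * (‖m‖ ^ 2 / (((N - k1 : ℕ) : ℝ) * ((N - k1 : ℕ) + 1))) + 1 / 2 * (HH n0 / (((N - k2 : ℕ) : ℝ) * ((N - k2 : ℕ) + 1)))) := by
  have hch := Real.continuous_cosh
  have hH : 0 ≤ HH n0 := Finset.sum_nonneg fun i _ => by positivity
  have hpt : ∀ p : S2 × S2, N ^ 2 * (vv p.1 p.2 ^ (N - 1) * (cosh (inner ℝ m (F p.2 - F p.1)) * rexp (‖F p.2 - F p.1‖ ^ 2 / 4) - 1)) ≤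
      N ^ 2 * (1 / 2 * (vv p.1 p.2 ^ (N - 1 - k1) * (inner ℝ m (F p.2) - inner ℝ m (F p.1)) ^ 2) + HH n0 / 2 * (vv p.1 p.2 ^ (N - 1 - k2) * (1 - vv p.1 p.2))) := by
    intro p
    apply mul_le_mul_of_nonneg_left _ (by positivity)
    rw [← inner_sub_right]
    set d : ℝ := inner ℝ m (F p.2 - F p.1) with hd
    set δ : ℝ := ‖F p.2 - F p.1‖ with hδ
    set v := vv p.1 p.2 with hv
    have v0 : 0 ≤ v := vv_nonneg _ _
    have v1 : v ≤ 1 := vv_le_one _ _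
    have b1 : δ ^ 2 ≤ 2 * (1 - v) * HH n0 := feat_dist hk p.1 p.2
    have b2 : d ^ 2 ≤ ‖m‖ ^ 2 * δ ^ 2 := by
      rw [← mul_pow]; exact sq_le_sq' (by linarith [neg_abs_le d, abs_real_inner_le_norm m (F p.2 - F p.1)]) (real_inner_le_norm _ _)
    have b3 : d ^ 2 / 12 + δ ^ 2 / 4 ≤ HH n0 * (‖m‖ ^ 2 / 6 + 1 / 2) * (1 - v) := by nlinarith [sq_nonneg ‖m‖, mul_le_mul_of_nonneg_left b1 (sq_nonneg ‖m‖)]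
    have b4 : δ ^ 2 / 4 ≤ HH n0 / 2 * (1 - v) := by nlinarith
    have c1 : (cosh d - 1) * rexp (δ ^ 2 / 4) ≤ 1 / 2 * d ^ 2 * rexp (HH n0 * (‖m‖ ^ 2 / 6 + 1 / 2) * (1 - v)) := by
      calc _ ≤ (1 / 2 * d ^ 2 * rexp (d ^ 2 / 12)) * rexp (δ ^ 2 / 4) := by
            apply mul_le_mul_of_nonneg_right (cosh_bound d) (exp_pos _).le
        _ = 1 / 2 * d ^ 2 * rexp (d ^ 2 / 12 + δ ^ 2 / 4) := by rw [Real.exp_add]; ring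
        _ ≤ _ := by gcongr
    have c2 : rexp (δ ^ 2 / 4) - 1 ≤ HH n0 / 2 * (1 - v) * rexp (HH n0 / 2 * (1 - v)) := by
      have e0 : ∀ z : ℝ, rexp z - 1 ≤ z * rexp z := by
        intro z
        have := Real.add_one_le_exp (-z)
        have h3 : rexp z * rexp (-z) = 1 := by rw [← Real.exp_add]; simp
        nlinarith [exp_pos z]
      refine le_trans ?_ (e0 _)
      have := Real.exp_le_exp.2 b4
      linarith
    have d1 := vpow_exp (k := k1) (n := N - 1) v0 hk1 v1 (by omega)
    have d2 := vpow_exp (k := k2) (n := N - 1) v0 hk2 v1 (by omega)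
    have vp : 0 ≤ v ^ (N - 1) := by positivity
    calc v ^ (N - 1) * (cosh d * rexp (δ ^ 2 / 4) - 1) = v ^ (N - 1) * ((cosh d - 1) * rexp (δ ^ 2 / 4)) + v ^ (N - 1) * (rexp (δ ^ 2 / 4) - 1) := by ring
      _ ≤ v ^ (N - 1) * (1 / 2 * d ^ 2 * rexp (HH n0 * (‖m‖ ^ 2 / 6 + 1 / 2) * (1 - v))) + v ^ (N - 1) * (HH n0 / 2 * (1 - v) * rexp (HH n0 / 2 * (1 - v))) := by gcongr
      _ = (1 / 2 * d ^ 2) * (v ^ (N - 1) * rexp (HH n0 * (‖m‖ ^ 2 / 6 + 1 / 2) * (1 - v))) + (HH n0 / 2 * (1 - v)) * (v ^ (N - 1) * rexp (HH n0 / 2 * (1 - v))) := by ring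
      _ ≤ (1 / 2 * d ^ 2) * v ^ (N - 1 - k1) + (HH n0 / 2 * (1 - v)) * v ^ (N - 1 - k2) := by
          apply add_le_add
          · exact mul_le_mul_of_nonneg_left d1 (by positivity)
          · exact mul_le_mul_of_nonneg_left d2 (mul_nonneg (by positivity) (by linarith))
      _ = _ := by ring
  have i0 : Integrable (fun p : S2 × S2 => (N : ℝ) ^ 2 * (vv p.1 p.2 ^ (N - 1) * (cosh (inner ℝ m (F p.2 - F p.1)) * rexp (‖F p.2 - F p.1‖ ^ 2 / 4) - 1))) (sphereUniform.prod sphereUniform) := integrable_cont (by fun_prop)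
  have i1 : Integrable (fun p : S2 × S2 => 1 / 2 * (vv p.1 p.2 ^ (N - 1 - k1) * (inner ℝ m (F p.2) - inner ℝ m (F p.1)) ^ 2)) (sphereUniform.prod sphereUniform) := integrable_cont (by fun_prop)
  have i2 : Integrable (fun p : S2 × S2 => HH n0 / 2 * (vv p.1 p.2 ^ (N - 1 - k2) * (1 - vv p.1 p.2))) (sphereUniform.prod sphereUniform) := integrable_cont (by fun_prop)
  have i3 : Integrable (fun p : S2 × S2 => (N : ℝ) ^ 2 * (1 / 2 * (vv p.1 p.2 ^ (N - 1 - k1) * (inner ℝ m (F p.2) - inner ℝ m (F p.1)) ^ 2) + HH n0 / 2 * (vv p.1 p.2 ^ (N - 1 - k2) * (1 - vv p.1 p.2)))) (sphereUniform.prod sphereUniform) := (i1.add i2).const_mul _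
  unfold JT
  refine (integral_mono i0 i3 hpt).trans ?_
  rw [integral_const_mul, integral_add i1 i2, integral_const_mul, integral_const_mul, int_v1v]
  have o := op_norm hF hk (N - 1 - k1) m
  have e1 : ((N - 1 - k1 : ℕ) : ℝ) + 1 = ((N - k1 : ℕ) : ℝ) := by
    have : N - k1 = (N - 1 - k1) + 1 := by omega
    rw [this]; push_cast; ring
  have e2 : ((N - 1 - k2 : ℕ) : ℝ) + 1 = ((N - k2 : ℕ) : ℝ) := by
    have : N - k2 = (N - 1 - k2) + 1 := by omega
    rw [this]; push_cast; ring
  rw [show ((N - 1 - k1 : ℕ) : ℝ) + 2 = (((N - 1 - k1 : ℕ) : ℝ) + 1) + 1 by ring, e1] at o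
  rw [show ((N - 1 - k2 : ℕ) : ℝ) + 2 = (((N - 1 - k2 : ℕ) : ℝ) + 1) + 1 by ring, e2]
  apply mul_le_mul_of_nonneg_left _ (by positivity)
  apply add_le_add
  · exact mul_le_mul_of_nonneg_left o (by norm_num)
  · apply le_of_eq; ring

end Low

/-- the low frequency event -/
theorem low_event {N : ℕ} (hN : 0 < N) (n0 : ℕ) (t s : ℝ) (ht : 0 ≤ t) (hs : 0 < s) (k1 k2 : ℕ)
    (h1 : k1 < N) (h2 : k2 < N) (hk1 : HH n0 * (s ^ 2 / 6 + 1 / 2) ≤ k1) (hk2 : HH n0 / 2 ≤ k2) :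
    ∃ E : Set (Fin N → S2), sphericalEnsemble N E ≤ ENNReal.ofReal (rexp (-t)) ∧ ∀ x ∉ E,
      s * √(W2 n0 x) ≤ s ^ 2 + t + N ^ 2 * (1 / 2 * (s ^ 2 / (((N - k1 : ℕ) : ℝ) * ((N - k1 : ℕ) + 1))) + 1 / 2 * (HH n0 / (((N - k2 : ℕ) : ℝ) * ((N - k2 : ℕ) + 1)))) := by
  obtain ⟨ι, i1, F, hF, hk⟩ := exists_feat n0
  obtain ⟨E, hE1, hE2⟩ := low_set hN hF t
  refine ⟨E, hE1, fun x hx => ?_⟩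
  have hH : 0 ≤ HH n0 := Finset.sum_nonneg fun i _ => by positivity
  rw [← norm_YY hF hk, Real.sqrt_sq (norm_nonneg _)]
  by_cases hY : YY F x = 0
  · rw [hY, norm_zero, mul_zero]; positivity
  have hn : 0 < ‖YY F x‖ := norm_pos_iff.2 hY
  set m : EuclideanSpace ℝ ι := (s / ‖YY F x‖) • YY F x with hm
  have m1 : ‖m‖ = s := by
    rw [hm, norm_smul, Real.norm_of_nonneg (by positivity)]; field_simp
  have m2 : inner ℝ m (YY F x) = s * ‖YY F x‖ := by
    rw [hm, inner_smul_left, real_inner_self_eq_norm_sq]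
    simp only [conj_trivial]
    field_simp
  have h := hE2 x hx m
  have b := JT_bound hF hk m k1 k2 h1 h2 (by rw [m1]; exact hk1) hk2
  rw [m1] at h b
  rw [m2] at h
  linarith

end SE
end

open MeasureTheory Real Metric
open scoped ENNReal RealInnerProductSpace Manifold ContDiff ComplexConjugate

noncomputable section
namespace SE

lemma log_tan {u u0 : ℝ} (hu : 0 < u) (h0 : 0 < u0) : log u ≤ log u0 + (u / u0 - 1) := by
  have h := Real.log_le_sub_one_of_pos (div_pos hu h0)
  rw [Real.log_div hu.ne' h0.ne'] at h
  linarith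

lemma log_pow_le {x : ℝ} (k m : ℕ) (hx : 0 < x) (h : x ^ k ≤ 2 ^ m) : k * log x ≤ m * log 2 := by
  have := Real.log_le_log (by positivity) h
  rwa [Real.log_pow, Real.log_pow] at this

lemma log_pow_ge {x : ℝ} (k m : ℕ) (h : 2 ^ m ≤ x ^ k) : m * log 2 ≤ k * log x := by
  have := Real.log_le_log (by positivity) h
  rwa [Real.log_pow, Real.log_pow] at this

lemma log24 : log 24 ≤ 3.189 := by
  have h := log_pow_le (x := 24) 5 23 (by norm_num) (by norm_num)
  have := Real.log_two_lt_d9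
  norm_num at h; linarith

lemma log25 : 3.218 ≤ log 25 := by
  have h := log_pow_ge (x := 25) 14 65 (by norm_num)
  have := Real.log_two_gt_d9
  norm_num at h; linarith

lemma log193 : log 193 ≤ 5.268 := by
  have h := log_pow_le (x := 193) 5 38 (by norm_num) (by norm_num)
  have := Real.log_two_lt_d9
  norm_num at h; linarith

lemma log49 : log 49 ≤ 3.8991 := by
  have h := log_pow_le (x := 49) 8 45 (by norm_num) (by norm_num)
  have := Real.log_two_lt_d9
  norm_num at h; linarith

lemma log8 : log 8 ≤ 2.08 := by
  have h := log_pow_le (x := 8) 1 3 (by norm_num) (by norm_num)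
  have := Real.log_two_lt_d9
  norm_num at h; linarith

lemma log16 : 2.77 ≤ log 16 := by
  have h := log_pow_ge (x := 16) 1 4 (by norm_num)
  have := Real.log_two_gt_d9
  norm_num at h; linarith

/-- the regime of small particle number -/
lemma core_pure {N : ℕ} (hN : 2 ≤ N) (Q t : ℝ) (hQ : 25 ≤ Q) (ht : 2 * t ≤ Q) (hNQ : (N : ℝ) ≤ 2 * Q) :
    ∃ E : Set (Fin N → S2), sphericalEnsemble N E ≤ ENNReal.ofReal (rexp (-t)) ∧ ∀ x ∉ E, ∀ K, W2 K x ≤ 3.69 * Q := by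
  refine ⟨_, ens_energy (by omega) t, fun x hx K => ?_⟩
  simp only [Set.mem_ofPred_eq, not_le] at hx
  have h1 := W1_bound hN x t hx
  have h2 := W2_tail (N := N) (by omega) K x
  have h3 := W2_le_W1 (2 * N) x
  have h0 := W1_nonneg (2 * N) x
  have n2 : (2 : ℝ) ≤ N := by exact_mod_cast hN
  push_cast at h3
  have e1 : 1 / (2 * (N : ℝ) + 1) ≤ 1 / 2 / N := by
    rw [div_div]; exact one_div_le_one_div_of_le (by positivity) (by linarith)
  have h4 : W2 K x ≤ (1 / 2 + 3 / 2 / N) * (2.76 * N + Q) + 1 / 2 := by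
    have : W2 K x ≤ (1 / 2 + 3 / 2 / N) * W1 (2 * N) x + 1 / 2 := by
      have : (1 / 2 + 1 / (2 * (N : ℝ) + 1)) * W1 (2 * N) x ≤ (1 / 2 + 1 / 2 / N) * W1 (2 * N) x := by gcongr
      have e : (1 / 2 + 3 / 2 / (N : ℝ)) * W1 (2 * N) x = (1 / 2 + 1 / 2 / N) * W1 (2 * N) x + W1 (2 * N) x / N := by
        field_simp; ring
      linarith
    refine this.trans ?_
    have : W1 (2 * N) x ≤ 2.76 * N + Q := by linarith
    gcongr
  have h5 : (1 / 2 + 3 / 2 / (N : ℝ)) * (2.76 * N + Q) + 1 / 2 = 1.38 * N + Q / 2 + 4.64 + 1.5 * Q / N := by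
    field_simp; ring
  have h6 : 1.5 * Q / N ≤ 2.76 * Q + 0.75 - 1.38 * N := by
    rw [div_le_iff₀ (by positivity)]
    nlinarith [mul_nonneg (by linarith : (0 : ℝ) ≤ 2 * Q - N) (by linarith : (0 : ℝ) ≤ 1.38 * N - 0.75)]
  linarith

lemma frac_bound {N k : ℕ} {α P X : ℝ} (hN : 0 < N) (hX : 0 ≤ X) (hk : (k : ℝ) ≤ α * N) (hα : α < 1) (hP : 1 ≤ P * (1 - α) ^ 2) :
    (N : ℝ) ^ 2 * (1 / 2 * (X / (((N - k : ℕ) : ℝ) * ((N - k : ℕ) + 1)))) ≤ 1 / 2 * X * P := by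
  have n0 : (0 : ℝ) < N := by exact_mod_cast hN
  have hkN : k < N := by
    have : (k : ℝ) < N := by nlinarith
    exact_mod_cast this
  rw [Nat.cast_sub hkN.le]
  set d : ℝ := (N : ℝ) - k with hd
  have d1 : (1 - α) * N ≤ d := by rw [hd]; linarith
  have d0 : 0 < (1 - α) * N := mul_pos (by linarith) n0
  have d2 : ((1 - α) * N) ^ 2 ≤ d * (d + 1) := by nlinarith
  have dp : 0 < d := by linarith
  have h : (N : ℝ) ^ 2 ≤ P * (d * (d + 1)) := by
    have P0 : 0 < P := by
      by_contra hc
      have : P * (1 - α) ^ 2 ≤ 0 := mul_nonpos_of_nonpos_of_nonneg (by linarith) (sq_nonneg _)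
      linarith
    calc (N : ℝ) ^ 2 = 1 * (N : ℝ) ^ 2 := by ring
      _ ≤ (P * (1 - α) ^ 2) * (N : ℝ) ^ 2 := by gcongr
      _ = P * ((1 - α) * N) ^ 2 := by ring
      _ ≤ _ := by gcongr
  rw [show (N : ℝ) ^ 2 * (1 / 2 * (X / (d * (d + 1)))) = (1 / 2 * X) * (N ^ 2 / (d * (d + 1))) by ring]
  apply mul_le_mul_of_nonneg_left _ (by positivity)
  rw [div_le_iff₀ (by positivity)]
  exact h

/-- abstract low frequency bound with explicit constants -/
lemma low_num {N : ℕ} (hN : 0 < N) (n0 : ℕ) (t T H D α β P R : ℝ) (ht : 0 ≤ t) (hT : T = 2 * t) (hH : H = HH n0) (hD : D = H + T) (hH0 : 0 < H)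
    (hk1 : H * (D / 21 + 1 / 2) + 1 ≤ α * N) (hk2 : H / 2 + 1 ≤ β * N) (hα : α < 1) (hβ : β < 1)
    (hP : 1 ≤ P * (1 - α) ^ 2) (hR : 1 ≤ R * (1 - β) ^ 2) :
    ∃ E : Set (Fin N → S2), sphericalEnsemble N E ≤ ENNReal.ofReal (rexp (-t)) ∧ ∀ x ∉ E,
      D * W2 n0 x ≤ 3.5 * ((1 + P / 2) / 3.5 * D + (T + H * R) / 2) ^ 2 := by
  have n0' : (0 : ℝ) < N := by exact_mod_cast hN
  have hD0 : 0 < D := by rw [hD, hT]; linarith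
  set s := √(D / 3.5) with hs
  have s2 : s ^ 2 = D / 3.5 := Real.sq_sqrt (by positivity)
  have s0 : 0 < s := Real.sqrt_pos.2 (by positivity)
  have e6 : s ^ 2 / 6 = D / 21 := by rw [s2]; ring
  set k1 := ⌈H * (D / 21 + 1 / 2)⌉₊ with hk1'
  set k2 := ⌈H / 2⌉₊ with hk2'
  have b1 : (k1 : ℝ) ≤ α * N := (Nat.ceil_lt_add_one (by positivity)).le.trans hk1
  have b2 : (k2 : ℝ) ≤ β * N := (Nat.ceil_lt_add_one (by positivity)).le.trans hk2
  have c1 : k1 < N := by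
    have : (k1 : ℝ) < N := by nlinarith
    exact_mod_cast this
  have c2 : k2 < N := by
    have : (k2 : ℝ) < N := by nlinarith
    exact_mod_cast this
  obtain ⟨E, hE1, hE2⟩ := low_event hN n0 t s ht s0 k1 k2 c1 c2 (by rw [e6, ← hH]; exact Nat.le_ceil _) (by rw [← hH]; exact Nat.le_ceil _)
  refine ⟨E, hE1, fun x hx => ?_⟩
  have h := hE2 x hx
  rw [← hH, mul_add] at h
  have f1 := frac_bound hN (sq_nonneg s) b1 hα hP
  have f2 := frac_bound hN hH0.le b2 hβ hR
  have g : s * √(W2 n0 x) ≤ (1 + P / 2) / 3.5 * D + (T + H * R) / 2 := by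
    have : s ^ 2 + t + (1 / 2 * s ^ 2 * P + 1 / 2 * H * R) = (1 + P / 2) / 3.5 * D + (T + H * R) / 2 := by
      rw [s2, hT]; ring
    linarith
  have w0 : 0 ≤ W2 n0 x := Finset.sum_nonneg fun n _ => div_nonneg (UU_nonneg _ _) (by positivity)
  have g2 : (s * √(W2 n0 x)) ^ 2 ≤ ((1 + P / 2) / 3.5 * D + (T + H * R) / 2) ^ 2 := pow_le_pow_left₀ (by positivity) g 2
  rw [mul_pow, s2, Real.sq_sqrt w0] at g2
  have : D * W2 n0 x = 3.5 * (D / 3.5 * W2 n0 x) := by ring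
  rw [this]
  gcongr

set_option maxHeartbeats 1600000 in
/-- the regime of large particle number -/
lemma core_split {N : ℕ} (hN : 2 ≤ N) (Q a t : ℝ) (hQ : 25.1 ≤ Q) (ha : 2 < a) (hQa : Q = log N + a)
    (ht : 2 * t ≤ a - 2 - log a) (ht0 : 0 ≤ t) (hNQ : 2 * Q ≤ N) :
    ∃ E : Set (Fin N → S2), sphericalEnsemble N E ≤ ENNReal.ofReal (rexp (-t)) ∧ ∀ x ∉ E, ∀ K, W2 K x ≤ 3.69 * Q := by
  have Np : (0 : ℝ) < N := by linarith
  have Qp : 0 < Q := by linarith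
  have N51 : (51 : ℝ) ≤ N := by
    have : (50 : ℝ) < N := by linarith
    have : 50 < N := by exact_mod_cast this
    exact_mod_cast this
  have l2a := Real.log_two_lt_d9
  have l2b := Real.log_two_gt_d9
  set r : ℝ := N / Q with hr
  have r2 : 2 ≤ r := by rw [hr, le_div_iff₀ Qp]; exact hNQ
  have hrQ : r * Q = N := by rw [hr]; field_simp
  have hr25 : 25.1 * r ≤ N := by rw [← hrQ]; nlinarith
  set n0 : ℕ := ⌈24 * r⌉₊ with hn0
  have n0a : 24 * r ≤ n0 := Nat.le_ceil _
  have n0b : (n0 : ℝ) < 24 * r + 1 := Nat.ceil_lt_add_one (by positivity)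
  have n0c : n0 ≤ N := by
    apply Nat.ceil_le.2
    linarith
  have n04 : 4 ≤ n0 := by
    have : (4 : ℝ) ≤ n0 := by linarith
    exact_mod_cast this
  set H : ℝ := HH n0 with hH
  have hH1 : H ≤ log (24 * r + 1) + 0.7 := by
    have := HH_le n0 n04
    have := Real.log_le_log (by linarith) n0b.le
    linarith
  have hH2 : 2 ≤ H := by
    have : HH 4 ≤ HH n0 := by
      unfold HH
      apply Finset.sum_le_sum_of_subset_of_nonneg
      · simpa using n04
      · intros; positivity
    have e : (2 : ℝ) ≤ HH 4 := by norm_num [HH, Finset.sum_range_succ]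
    linarith
  set t' := t + log 2 with ht'
  set T : ℝ := 2 * t' with hT
  set D : ℝ := H + T with hD
  have hT0 : 0 ≤ T := by rw [hT, ht']; linarith
  have loga : 0.69 ≤ log a := by
    have := Real.log_le_log (by norm_num) ha.le
    linarith
  have logQ : 3.218 ≤ log Q := by
    have := Real.log_le_log (by norm_num) (by linarith : (25 : ℝ) ≤ Q)
    have := log25
    linarith
  have hlogr : log r = log N - log Q := by rw [hr, Real.log_div Np.ne' Qp.ne']
  have hD1 : D ≤ Q + 3.3 - log Q - log a := by
    have h1 : log (24 * r + 1) ≤ log 24 + log r + 0.021 := by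
      have h2 := log_tan (u := 24 * r + 1) (u0 := 24 * r) (by positivity) (by positivity)
      rw [Real.log_mul (by norm_num) (by positivity)] at h2
      have : (24 * r + 1) / (24 * r) - 1 = 1 / (24 * r) := by field_simp; ring
      rw [this] at h2
      have : 1 / (24 * r) ≤ 1 / 48 := one_div_le_one_div_of_le (by norm_num) (by linarith)
      norm_num at *
      linarith
    have := log24
    rw [hD, hT, ht']
    linarith
  -- the low frequency part
  have low : ∃ E : Set (Fin N → S2), sphericalEnsemble N E ≤ ENNReal.ofReal (rexp (-t')) ∧ ∀ x ∉ E, W2 n0 x ≤ 3.69 * Q - (0.115 * Q + 3.26 + 0.0405 * D) := by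
    have D2 : 2 ≤ D := by linarith
    rcases le_total 8 r with h8 | h8
    · have hHr : H ≤ 0.75 * r := by
        have := log_tan (u := 24 * r + 1) (u0 := 193) (by positivity) (by norm_num)
        have := log193
        linarith
      have hDQ : D ≤ Q := by linarith
      have N200 : 200 ≤ (N : ℝ) := by rw [← hrQ]; nlinarith
      have k1b : H * (D / 21 + 1 / 2) + 1 ≤ 0.0558 * N := by
        have : H * (D / 21) ≤ (0.75 * r) * (Q / 21) := by gcongr
        have : (0.75 * r) * (Q / 21) = 0.75 / 21 * N := by rw [← hrQ]; ring
        linarith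
      have k2b : H / 2 + 1 ≤ 0.02 * N := by linarith
      obtain ⟨E, hE1, hE2⟩ := low_num (N := N) (by omega) n0 t' T H D 0.0558 0.02 1.123 1.0413 (by linarith) hT hH hD (by linarith) k1b k2b
        (by norm_num) (by norm_num) (by norm_num) (by norm_num)
      refine ⟨E, hE1, fun x hx => ?_⟩
      have h := hE2 x hx
      have h1 : (1 + 1.123 / 2) / 3.5 * D + (T + H * 1.0413) / 2 ≤ 0.967 * D := by
        rw [hD]; linarith
      have h0 : 0 ≤ (1 + 1.123 / 2) / 3.5 * D + (T + H * 1.0413) / 2 := by positivity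
      have h2 := pow_le_pow_left₀ h0 h1 2
      have h3 : D * W2 n0 x ≤ D * (3.273 * D) := by nlinarith
      have h4 := le_of_mul_le_mul_left h3 (by linarith)
      linarith
    · have hHr : H ≤ 2.31 * r := by
        have := log_tan (u := 24 * r + 1) (u0 := 49) (by positivity) (by norm_num)
        have := log49
        linarith
      have hH6 : H ≤ 6 := by
        have := Real.log_le_log (by positivity) (by linarith : 24 * r + 1 ≤ 193)
        have := log193
        linarith
      have a16 : 16 ≤ a := by
        have h1 := Real.log_le_log (by positivity) h8
        have h2 := log8
        have h3 := log_tan (u := Q) (u0 := 8) Qp (by norm_num)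
        linarith
      have la := (log16).trans (Real.log_le_log (by norm_num) a16)
      have hDQ : D ≤ Q - 2.6 := by linarith
      have k1b : H * (D / 21 + 1 / 2) + 1 ≤ 0.1757 * N := by
        have : H * (D / 21) ≤ (2.31 * r) * (Q / 21) := by gcongr; linarith
        have : (2.31 * r) * (Q / 21) = 2.31 / 21 * N := by rw [← hrQ]; ring
        linarith
      have k2b : H / 2 + 1 ≤ 0.066 * N := by linarith
      obtain ⟨E, hE1, hE2⟩ := low_num (N := N) (by omega) n0 t' T H D 0.1757 0.066 1.472 1.15 (by linarith) hT hH hD (by linarith) k1b k2b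
        (by norm_num) (by norm_num) (by norm_num) (by norm_num)
      refine ⟨E, hE1, fun x hx => ?_⟩
      have h := hE2 x hx
      have h1 : (1 + 1.472 / 2) / 3.5 * D + (T + H * 1.15) / 2 ≤ 0.996 * D + 0.45 := by
        rw [hD]; linarith
      have h0 : 0 ≤ (1 + 1.472 / 2) / 3.5 * D + (T + H * 1.15) / 2 := by positivity
      have h2 := pow_le_pow_left₀ h0 h1 2
      have h3 : D * W2 n0 x ≤ D * (3.4721 * D + 3.6) := by nlinarith
      have h4 := le_of_mul_le_mul_left h3 (by linarith)
      linarith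
  obtain ⟨E1, hE1, hE1'⟩ := low
  have hE2 := ens_energy (N := N) (by omega) t'
  refine ⟨E1 ∪ {x | cN N * DD x ≤ kap N * rexp (-t')}, ?_, ?_⟩
  · refine (measure_union_le _ _).trans ((add_le_add hE1 hE2).trans ?_)
    rw [← ENNReal.ofReal_add (exp_pos _).le (exp_pos _).le]
    apply ENNReal.ofReal_le_ofReal
    rw [ht', neg_add, Real.exp_add, Real.exp_neg (log 2), Real.exp_log (by norm_num)]
    linarith
  · intro x hx K
    simp only [Set.mem_union, Set.mem_ofPred_eq, not_or, not_le] at hx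
    have h1 := hE1' x hx.1
    have h2 := W1_bound hN x t' hx.2
    have h3 := W2_tail (N := N) (by omega) K x
    have h4 := W2_mid n0 (2 * N) (by omega) x
    have h0 := W1_nonneg (2 * N) x
    set W := W1 (2 * N) x
    have e1 : W / (n0 + 1) ≤ W * (Q / (24 * N)) := by
      rw [div_eq_mul_inv]
      apply mul_le_mul_of_nonneg_left _ h0
      have : Q / (24 * N) = (24 * r)⁻¹ := by rw [← hrQ]; field_simp
      rw [this]
      exact inv_anti₀ (by positivity) (by linarith)
    have e2 : W * (Q / (24 * N)) + W / N ≤ (2.76 * N + T) * (Q / (24 * N) + 1 / N) := by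
      calc _ = W * (Q / (24 * N) + 1 / N) := by ring
        _ ≤ _ := by gcongr
    have e3 : (2.76 * N + T) * (Q / (24 * N) + 1 / N) = 0.115 * Q + 2.76 + T * (Q / (24 * N) + 1 / N) := by
      field_simp; ring
    have e4 : Q / (24 * N) + 1 / N ≤ 0.0405 := by
      have u1 : Q / (24 * N) ≤ 1 / 48 := by rw [div_le_div_iff₀ (by positivity) (by norm_num)]; linarith
      have u2 : 1 / (N : ℝ) ≤ 1 / 51 := one_div_le_one_div_of_le (by norm_num) N51
      norm_num at *
      linarith
    have e5 : T * (Q / (24 * N) + 1 / N) ≤ D * 0.0405 := by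
      apply mul_le_mul (by linarith) e4 (by positivity) (by linarith)
    linarith

theorem core {N : ℕ} (hN : 2 ≤ N) (Q a t : ℝ) (hQ : 25.1 ≤ Q) (ha : 2 < a) (hQa : Q = log N + a)
    (ht : 2 * t ≤ a - 2 - log a) (ht0 : 0 ≤ t) :
    ∃ E : Set (Fin N → S2), sphericalEnsemble N E ≤ ENNReal.ofReal (rexp (-t)) ∧ ∀ x ∉ E, ∀ K, W2 K x ≤ 3.69 * Q := by
  rcases le_total (2 * Q) N with h | h
  · exact core_split hN Q a t hQ ha hQa ht ht0 h
  · have : 0 ≤ log a := Real.log_nonneg (by linarith)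
    have : 0 ≤ log N := Real.log_natCast_nonneg N
    exact core_pure hN Q t (by linarith) (by linarith) h

end SE
end


noncomputable section

/-- Explicit form of the concentration bound for `s = 2`: if `N ≥ 2`, `η > 0`,
`η log N > 2` and `(1+η) log N ≥ 8π`, then
`𝐏_N( wce(x_N; 2) ≤ e √((1+η)/(8π)) (log N)^{1/2}/N )
  ≥ 1 − (log N)^{1/2} N^{−η/2} (η e^{(1+η)/(η−2/log N)+1})^{1/2}`. -/
theorem spherical_ensemble_explicit_bound (N : ℕ) (hN : 2 ≤ N) (η : ℝ) (hη : 0 < η)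
    (hη1 : 2 < η * Real.log N) (hη2 : 8 * π ≤ (1 + η) * Real.log N) :
    ENNReal.ofReal (1 - Real.sqrt (Real.log N) * (N : ℝ) ^ (-(η / 2)) *
        Real.sqrt (η * Real.exp ((1 + η) / (η - 2 / Real.log N) + 1))) ≤
      sphericalEnsemble N
        {x | wce N 2 x ≤
          Real.exp 1 * Real.sqrt ((1 + η) / (8 * π)) * Real.sqrt (Real.log N) / N} := by
  have N2 : (2 : ℝ) ≤ N := by exact_mod_cast hN
  have Np : (0 : ℝ) < N := by linarith
  set L := Real.log N with hL
  have Lp : 0 < L := Real.log_pos (by linarith)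
  set a := η * L with ha
  set t : ℝ := (a - 1 - Real.log a - (1 + η) / (η - 2 / L)) / 2 with ht
  have key : Real.sqrt L * (N : ℝ) ^ (-(η / 2)) * Real.sqrt (η * Real.exp ((1 + η) / (η - 2 / L) + 1)) = Real.exp (-t) := by
    rw [Real.rpow_def_of_pos Np, Real.sqrt_eq_rpow, Real.sqrt_eq_rpow, Real.rpow_def_of_pos Lp,
      Real.rpow_def_of_pos (by positivity), Real.log_mul hη.ne' (Real.exp_pos _).ne', Real.log_exp,
      ← Real.exp_add, ← Real.exp_add]
    congr 1
    rw [ht, ha, Real.log_mul hη.ne' Lp.ne']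
    ring
  rw [key]
  by_cases ht0 : t < 0
  · have : 1 - Real.exp (-t) ≤ 0 := by
      have := Real.add_one_le_exp (-t); linarith
    rw [ENNReal.ofReal_of_nonpos this]
    exact bot_le
  push Not at ht0
  have hpi := Real.pi_gt_d4
  have hQ : 25.1 ≤ L + a := by
    have : (1 + η) * L = L + a := by rw [ha]; ring
    rw [this] at hη2
    linarith
  have hdiv : (1 + η) / (η - 2 / L) = 1 + (L + 2) / (a - 2) := by
    have h1 : η - 2 / L = (a - 2) / L := by rw [ha]; field_simp
    have h2 : a - 2 ≠ 0 := by linarith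
    rw [h1]
    field_simp
    rw [ha]; ring
  have htb : 2 * t ≤ a - 2 - Real.log a := by
    have : 0 ≤ (L + 2) / (a - 2) := div_nonneg (by linarith) (by linarith)
    rw [ht, hdiv]; linarith
  obtain ⟨E, hE1, hE2⟩ := SE.core hN (L + a) a t hQ hη1 rfl htb ht0
  have := SE.ens_prob (N := N) (by omega)
  set S : Set (Fin N → S2) := {x | wce N 2 x ≤ Real.exp 1 * Real.sqrt ((1 + η) / (8 * π)) * Real.sqrt L / N} with hS
  have hcov : Set.univ ⊆ E ∪ S := by
    intro x _
    by_cases hx : x ∈ E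
    · exact Or.inl hx
    · right
      have h := SE.wce_le (N := N) (by omega) x (3.69 * (L + a)) (hE2 x hx)
      refine h.trans ?_
      have e1 : Real.exp 1 * Real.sqrt ((1 + η) / (8 * π)) * Real.sqrt L = Real.sqrt (Real.exp 1 ^ 2 * ((1 + η) / (8 * π)) * L) := by
        rw [Real.sqrt_mul (by positivity), Real.sqrt_mul (by positivity), Real.sqrt_sq (by positivity)]
      rw [e1]
      apply div_le_div_of_nonneg_right _ Np.le
      apply Real.sqrt_le_sqrt
      have e2 : Real.exp 1 ^ 2 * ((1 + η) / (8 * π)) * L = (Real.exp 1 ^ 2 / 2 * (L + a)) / (4 * π) := by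
        rw [ha]; field_simp; ring
      rw [e2]
      have he := Real.exp_one_gt_d9
      have : 3.69 ≤ Real.exp 1 ^ 2 / 2 := by nlinarith
      have : 0 ≤ L + a := by linarith
      gcongr
  have h1 : (1 : ℝ≥0∞) ≤ ENNReal.ofReal (Real.exp (-t)) + sphericalEnsemble N S := by
    calc (1 : ℝ≥0∞) = sphericalEnsemble N Set.univ := measure_univ.symm
      _ ≤ sphericalEnsemble N (E ∪ S) := measure_mono hcov
      _ ≤ sphericalEnsemble N E + sphericalEnsemble N S := measure_union_le _ _
      _ ≤ _ := by gcongr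
  rw [ENNReal.ofReal_sub _ (Real.exp_pos _).le, ENNReal.ofReal_one]
  exact tsub_le_iff_left.2 h1

end
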